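/- There exists an absolute constant C > 0 such that for every graph H with at least one edge the following holds: if G is a 3-connected graph on n vertices, then G admits a family F of subgraphs of G, each of which is either a single edge or a subdivision of H, such that F strongly separates the edges of G and |F| ≤ C·|V(H)|²·n. -/

import Mathlib

open SimpleGraph

/-- `K` is a subdivision of `H`. -/
def IsSubdivision {α β : Type*} (H : SimpleGraph α) (K : SimpleGraph β) : Prop :=
  ∃ (f : α → β) (P : ∀ ⦃x y⦄, H.Adj x y → K.Walk (f x) (f y)),
    Function.Injective f ∧
    (∀ ⦃x y⦄ (h : H.Adj x y), (P h).IsPath) ∧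
    (∀ ⦃x y⦄ (h : H.Adj x y), P h.symm = (P h).reverse) ∧
    (∀ ⦃x y⦄ (h : H.Adj x y), ∀ v ∈ (P h).support, v ∈ Set.range f → v = f x ∨ v = f y) ∧
    (∀ ⦃x y x' y'⦄ (h : H.Adj x y) (h' : H.Adj x' y'), s(x, y) ≠ s(x', y') →
      ∀ v ∈ (P h).support, v ∈ (P h').support → v ∈ Set.range f) ∧
    (∀ v : β, v ∈ Set.range f ∨ ∃ (x y : α) (h : H.Adj x y), v ∈ (P h).support) ∧
    (∀ e ∈ K.edgeSet, ∃ (x y : α) (h : H.Adj x y), e ∈ (P h).edges)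

/-- The subgraph `A` of `G` is a single edge. -/
def IsSingleEdge {V : Type*} {G : SimpleGraph V} (A : G.Subgraph) : Prop :=
  ∃ (v w : V) (h : G.Adj v w), A = G.subgraphOfAdj h

/-- The family `F` of subgraphs of `G` strongly separates the edges of `G`. -/
def StronglySeparatesEdges {V : Type*} (G : SimpleGraph V) (F : Set G.Subgraph) : Prop :=
  ∀ e ∈ G.edgeSet, ∀ e' ∈ G.edgeSet, e ≠ e' → ∃ A ∈ F, e ∈ A.edgeSet ∧ e' ∉ A.edgeSet

/-- `G` is 3-connected: it has more than 3 vertices and stays connected after deleting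
any set of fewer than 3 vertices. -/
def ThreeConnected {V : Type*} [Fintype V] (G : SimpleGraph V) : Prop :=
  3 < Fintype.card V ∧ ∀ S : Set V, S.ncard < 3 → (G.induce Sᶜ).Connected

namespace EdgeSeparation

open Relation

section Separations

variable {V : Type*} [DecidableEq V]

/-- `(A, B)` is a separation of the subgraph of `G` induced on `D`. -/
def IsSep (G : SimpleGraph V) (D A B : Finset V) : Prop :=
  A ∪ B = D ∧ ∀ a ∈ A, ∀ b ∈ B, a ∉ B → b ∉ A → ¬ G.Adj a b

/-- One step along an edge of `G[D]` inside a colour class of `f`. -/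
def Step {γ : Type*} (G : SimpleGraph V) (D : Finset V) (f : V → γ) (a b : V) : Prop :=
  G.Adj a b ∧ a ∈ D ∧ b ∈ D ∧ f a = f b

variable {G : SimpleGraph V} {D A B A' B' : Finset V}

theorem IsSep.symm (h : IsSep G D A B) : IsSep G D B A :=
  ⟨by rw [Finset.union_comm]; exact h.1, fun a ha b hb h1 h2 hab => h.2 b hb a ha h2 h1 hab.symm⟩

theorem IsSep.left_subset (h : IsSep G D A B) : A ⊆ D := h.1 ▸ Finset.subset_union_left

theorem IsSep.right_subset (h : IsSep G D A B) : B ⊆ D := h.1 ▸ Finset.subset_union_right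

theorem IsSep.mem (h : IsSep G D A B) {v : V} (hv : v ∈ D) : v ∈ A ∨ v ∈ B := by
  rw [← h.1] at hv; exact Finset.mem_union.1 hv

theorem IsSep.card (h : IsSep G D A B) : (A ∩ B).card + D.card = A.card + B.card := by
  rw [← h.1, add_comm, Finset.card_union_add_card_inter]

theorem IsSep.cross (h : IsSep G D A B) (h' : IsSep G D A' B') :
    IsSep G D (A ∪ A') (B ∩ B') := by
  refine ⟨?_, ?_⟩
  · ext v
    constructor
    · intro hv
      rcases Finset.mem_union.1 hv with hv | hv
      · rcases Finset.mem_union.1 hv with hv | hv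
        exacts [h.left_subset hv, h'.left_subset hv]
      · exact h.right_subset (Finset.mem_inter.1 hv).1
    · intro hv
      have := h.mem hv
      have := h'.mem hv
      simp only [Finset.mem_union, Finset.mem_inter]; tauto
  · intro a ha b hb hab hba hadj
    simp only [Finset.mem_union, Finset.mem_inter, not_or, not_and] at *
    have hbD : b ∈ D := h.right_subset hb.1
    have haD : a ∈ D := by
      rcases ha with ha | ha
      exacts [h.left_subset ha, h'.left_subset ha]
    by_cases haB : a ∈ B
    · have haB' := hab haB
      have haA' : a ∈ A' := by have := h'.mem haD; tauto
      exact h'.2 a haA' b hb.2 haB' hba.2 hadj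
    · have haA : a ∈ A := by have := h.mem haD; tauto
      exact h.2 a haA b hb.1 haB hba.1 hadj

theorem IsSep.card_cross (h : IsSep G D A B) (h' : IsSep G D A' B') :
    ((A ∪ A') ∩ (B ∩ B')).card + ((A ∩ A') ∩ (B ∪ B')).card
      = (A ∩ B).card + (A' ∩ B').card := by
  have h1 := (h.cross h').card
  have h2 := (h.symm.cross h'.symm).symm.card
  have h3 := h.card
  have h4 := h'.card
  have h5 := Finset.card_union_add_card_inter A A'
  have h6 := Finset.card_union_add_card_inter B B'
  omega

theorem IsSep.insert_both (v : V) (h : IsSep G (D.erase v) A B) (hv : v ∈ D) :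
    IsSep G D (insert v A) (insert v B) := by
  refine ⟨?_, ?_⟩
  · ext w
    have := h.1
    have h1 : w ∈ A ∪ B ↔ w ∈ D.erase v := by rw [this]
    simp only [Finset.mem_union, Finset.mem_erase, Finset.mem_insert] at *
    by_cases hw : w = v
    · simp [hw, hv]
    · simp only [hw, false_or, h1]; simp [hw]
  · intro a ha b hb h1 h2
    simp only [Finset.mem_insert, not_or] at *
    exact h.2 a (by tauto) b (by tauto) h1.2 h2.2

theorem IsSep.insert_left (v : V) (h : IsSep G (D.erase v) A B) (hv : v ∈ D)
    (hN : ∀ w ∈ B, G.Adj v w → w ∈ A) : IsSep G D (insert v A) B := by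
  refine ⟨?_, ?_⟩
  · ext w
    have := h.1
    have h1 : w ∈ A ∪ B ↔ w ∈ D.erase v := by rw [this]
    simp only [Finset.mem_union, Finset.mem_erase, Finset.mem_insert] at *
    by_cases hw : w = v
    · simp [hw, hv]
    · simp only [hw, false_or, h1]; simp [hw]
  · intro a ha b hb h1 h2 hab
    simp only [Finset.mem_insert, not_or] at *
    rcases ha with rfl | ha
    · exact h2.2 (hN b hb hab)
    · exact h.2 a ha b hb h1 h2.2 hab

omit [DecidableEq V] in
theorem Step.symm {γ : Type*} {f : V → γ} {a b : V} (h : Step G D f a b) : Step G D f b a :=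
  ⟨h.1.symm, h.2.2.1, h.2.1, h.2.2.2.symm⟩

omit [DecidableEq V] in
theorem reach_symm {γ : Type*} {f : V → γ} {a b : V} (h : ReflTransGen (Step G D f) a b) :
    ReflTransGen (Step G D f) b a := by
  induction h with
  | refl => exact .refl
  | tail _ h ih => exact .head h.symm ih

/-- Menger's theorem: disjoint paths from all of `Y` to `Z`, given by their colour classes. -/
theorem menger (G : SimpleGraph V) : ∀ (n : ℕ) (D Y Z : Finset V), D.card = n → Y ⊆ D → Z ⊆ D →
    (∀ A B, IsSep G D A B → Y ⊆ A → Z ⊆ B → Y.card ≤ (A ∩ B).card) →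
    ∃ g : V → V, (∀ y ∈ Y, g y = y) ∧
      ∀ y ∈ Y, ∃ z ∈ Z, g z = y ∧ ReflTransGen (Step G D g) y z := by
  intro n
  induction n with
  | zero =>
    intro D Y Z hD hY hZ _
    have : D = ∅ := Finset.card_eq_zero.1 hD
    subst this
    exact ⟨id, by simp, fun y hy => absurd (hY hy) (by simp)⟩
  | succ n ih =>
    intro D Y Z hD hY hZ hsep
    by_cases hYZ : Y ⊆ Z
    · exact ⟨id, by simp, fun y hy => ⟨y, hYZ hy, rfl, .refl⟩⟩
    obtain ⟨y, hyY, hyZ⟩ := Finset.not_subset.1 hYZ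
    have hyD := hY hyY
    have hYc : (Y.erase y).card + 1 = Y.card := Finset.card_erase_add_one hyY
    have hZ' : Z ⊆ D.erase y := fun z hz =>
      Finset.mem_erase.2 ⟨fun h => hyZ (h ▸ hz), hZ hz⟩
    have hlow : ∀ A B, IsSep G (D.erase y) A B → Y.erase y ⊆ A → Z ⊆ B →
        (Y.erase y).card ≤ (A ∩ B).card := by
      intro A B hAB hA hB
      have h1 := hsep _ _ (hAB.insert_both y hyD) (by
        intro w hw
        by_cases h : w = y
        · simp [h]
        · exact Finset.mem_insert_of_mem (hA (Finset.mem_erase.2 ⟨h, hw⟩)))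
        (hB.trans (Finset.subset_insert _ _))
      rw [← Finset.insert_inter_distrib] at h1
      have := Finset.card_insert_le y (A ∩ B)
      omega
    have key : ∃ w ∈ D.erase y, G.Adj y w ∧ w ∉ Y ∧ ∀ A B, IsSep G (D.erase y) A B →
        insert w (Y.erase y) ⊆ A → Z ⊆ B → Y.card ≤ (A ∩ B).card := by
      by_cases hex : ∃ A B, IsSep G (D.erase y) A B ∧ Y.erase y ⊆ A ∧ Z ⊆ B ∧
          (A ∩ B).card = (Y.erase y).card
      · obtain ⟨A, ⟨B, hAB, hA, hB, hc⟩, hmax⟩ :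
            ∃ A, (∃ B, IsSep G (D.erase y) A B ∧ Y.erase y ⊆ A ∧ Z ⊆ B ∧
              (A ∩ B).card = (Y.erase y).card) ∧
            ∀ A', (∃ B', IsSep G (D.erase y) A' B' ∧ Y.erase y ⊆ A' ∧ Z ⊆ B' ∧
              (A' ∩ B').card = (Y.erase y).card) → A'.card ≤ A.card := by
          have hfin : {A : Finset V | ∃ B, IsSep G (D.erase y) A B ∧ Y.erase y ⊆ A ∧ Z ⊆ B ∧
              (A ∩ B).card = (Y.erase y).card}.Finite := by
            refine Set.Finite.subset (D.erase y).powerset.finite_toSet ?_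
            rintro A ⟨B, h, -⟩
            exact Finset.mem_coe.2 (Finset.mem_powerset.2 h.left_subset)
          obtain ⟨A, hA, hm⟩ := Set.exists_max_image _ Finset.card hfin hex
          exact ⟨A, hA, hm⟩
        have hyB : y ∉ B := fun h => by simpa using hAB.right_subset h
        have hw : ∃ w ∈ B, G.Adj y w ∧ w ∉ A := by
          by_contra! hcon
          have := hsep _ _ (hAB.insert_left y hyD hcon) (by
            intro w hw
            by_cases h : w = y
            · simp [h]
            · exact Finset.mem_insert_of_mem (hA (Finset.mem_erase.2 ⟨h, hw⟩))) hB
          rw [Finset.insert_inter_of_notMem hyB] at this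
          omega
        obtain ⟨w, hwB, hyw, hwA⟩ := hw
        have hwD := hAB.right_subset hwB
        refine ⟨w, hwD, hyw, fun hwY => hwA (hA (Finset.mem_erase.2 ⟨hyw.ne.symm, hwY⟩)), ?_⟩
        intro A' B' hAB' hA' hB'
        by_contra! hlt
        have h1 := hAB.card_cross hAB'
        have h2 := hlow _ _ (hAB.cross hAB') (hA.trans Finset.subset_union_left)
          (Finset.subset_inter hB hB')
        have hA'' : Y.erase y ⊆ A' := (Finset.subset_insert _ _).trans hA'
        have h3 := hlow _ _ (hAB.symm.cross hAB'.symm).symm (Finset.subset_inter hA hA'')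
          (hB.trans Finset.subset_union_left)
        have h4 := hmax (A ∪ A') ⟨_, hAB.cross hAB', hA.trans Finset.subset_union_left,
          Finset.subset_inter hB hB', by omega⟩
        have h5 : A.card < (A ∪ A').card := Finset.card_lt_card
          ⟨Finset.subset_union_left, fun h => hwA (h (Finset.mem_union_right _
            (hA' (Finset.mem_insert_self _ _))))⟩
        omega
      · have hw : ∃ w ∈ D, G.Adj y w ∧ w ∉ Y := by
          by_contra! hcon
          have := hsep Y (D.erase y) ⟨by
            ext w
            simp only [Finset.mem_union, Finset.mem_erase]
            by_cases h : w = y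
            · simp [h, hyY, hyD]
            · constructor
              · rintro (h | h)
                exacts [hY h, h.2]
              · exact fun hh => Or.inr ⟨h, hh⟩, by
            intro a ha b hb h1 h2 hab
            have hay : a = y := by
              by_contra h
              exact h1 (Finset.mem_erase.2 ⟨h, hY ha⟩)
            subst hay
            exact h2 (hcon b (Finset.mem_of_mem_erase hb) hab)⟩ subset_rfl hZ'
          have h1 : Y ∩ D.erase y = Y.erase y := by
            ext w
            simp only [Finset.mem_inter, Finset.mem_erase]
            exact ⟨fun h => ⟨h.2.1, h.1⟩, fun h => ⟨h.2, h.1, hY h.2⟩⟩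
          rw [h1] at this
          omega
        obtain ⟨w, hwD, hyw, hwY⟩ := hw
        refine ⟨w, Finset.mem_erase.2 ⟨hyw.ne.symm, hwD⟩, hyw, hwY, ?_⟩
        intro A B hAB hA hB
        have hA'' : Y.erase y ⊆ A := (Finset.subset_insert _ _).trans hA
        have h1 := hlow A B hAB hA'' hB
        by_contra! hlt
        exact hex ⟨A, B, hAB, hA'', hB, by omega⟩
    obtain ⟨w, hwD, hyw, hwY, hws⟩ := key
    have hwYe : w ∉ Y.erase y := fun h => hwY (Finset.mem_of_mem_erase h)
    obtain ⟨g, hg, hp⟩ := ih (D.erase y) (insert w (Y.erase y)) Z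
      (by rw [Finset.card_erase_of_mem hyD, hD]; rfl)
      (Finset.insert_subset hwD (Finset.erase_subset_erase _ hY)) hZ'
      (fun A B hAB hA hB => by
        rw [Finset.card_insert_of_notMem hwYe, hYc]; exact hws A B hAB hA hB)
    let g' : V → V := fun v => if v = y then y else if g v = w then y else g v
    have hstep : ∀ a b, Step G (D.erase y) g a b → Step G D g' a b := by
      rintro a b ⟨h1, h2, h3, h4⟩
      have ha := Finset.mem_erase.1 h2
      have hb := Finset.mem_erase.1 h3
      refine ⟨h1, ha.2, hb.2, ?_⟩
      simp only [g', ha.1, hb.1, if_false, h4]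
    refine ⟨g', ?_, ?_⟩
    · intro v hv
      by_cases h : v = y
      · simp [g', h]
      · have h1 := hg v (Finset.mem_insert_of_mem (Finset.mem_erase.2 ⟨h, hv⟩))
        have h2 : v ≠ w := fun h => hwY (h ▸ hv)
        simp [g', h, h1, h2]
    · intro v hv
      by_cases h : v = y
      · subst h
        obtain ⟨z, hz, hgz, hr⟩ := hp w (Finset.mem_insert_self _ _)
        refine ⟨z, hz, ?_, ?_⟩
        · simp [g', hgz]
        · refine .head ⟨hyw, hyD, Finset.mem_of_mem_erase hwD, ?_⟩ (ReflTransGen.mono hstep _ _ hr)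
          have := hg w (Finset.mem_insert_self _ _)
          simp [g', this]
      · obtain ⟨z, hz, hgz, hr⟩ := hp v (Finset.mem_insert_of_mem (Finset.mem_erase.2 ⟨h, hv⟩))
        refine ⟨z, hz, ?_, ReflTransGen.mono hstep _ _ hr⟩
        have h2 : v ≠ w := fun h => hwY (h ▸ hv)
        have h3 : z ≠ y := fun h => hyZ (h ▸ hz)
        simp [g', h3, hgz, h2]

end Separations

section Linkage

variable {V : Type*} [DecidableEq V]

/-- Every colouring of the terminals `X` extends to a colouring of `G[D]` in which terminals of
equal colour lie in a common monochromatic component. -/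
def Linked (G : SimpleGraph V) (D X : Finset V) : Prop :=
  ∀ c : V → ℕ, ∃ f : V → ℕ, (∀ x ∈ X, f x = c x) ∧
    ∀ x ∈ X, ∀ y ∈ X, c x = c y → ReflTransGen (Step G D f) x y

/-- `G` together with all edges inside `Z`. -/
def addClique (G : SimpleGraph V) (Z : Finset V) : SimpleGraph V where
  Adj a b := G.Adj a b ∨ (a ≠ b ∧ a ∈ Z ∧ b ∈ Z)
  symm := ⟨fun a b h => by
    rcases h with h | ⟨h1, h2, h3⟩
    exacts [Or.inl h.symm, Or.inr ⟨h1.symm, h3, h2⟩]⟩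
  loopless := ⟨fun a h => by
    rcases h with h | h
    exacts [h.ne rfl, h.1 rfl]⟩

/-- `G` with the neighbours of `v` added to the neighbourhood of `u`. -/
def absorb (G : SimpleGraph V) (u v : V) : SimpleGraph V where
  Adj x y := x ≠ y ∧ (G.Adj x y ∨ (x = u ∧ G.Adj v y) ∨ (y = u ∧ G.Adj v x))
  symm := ⟨fun a b h => by
    rcases h with ⟨h0, h | h | h⟩
    exacts [⟨h0.symm, Or.inl h.symm⟩, ⟨h0.symm, Or.inr (Or.inr h)⟩, ⟨h0.symm, Or.inr (Or.inl h)⟩]⟩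
  loopless := ⟨fun a h => h.1 rfl⟩

variable {G : SimpleGraph V} {D A B X Y Z : Finset V}

theorem IsSep.anti {G' : SimpleGraph V} (hG : G ≤ G') (h : IsSep G' D A B) : IsSep G D A B :=
  ⟨h.1, fun a ha b hb h1 h2 hab => h.2 a ha b hb h1 h2 (hG hab)⟩

theorem IsSep.glue_left {P Q : Finset V} (h : IsSep G D A B) (h' : IsSep G B P Q)
    (hP : A ∩ B ⊆ P) : IsSep G D (A ∪ P) Q ∧ (A ∪ P) ∩ Q = P ∩ Q := by
  have hQB := h'.right_subset
  have hPB := h'.left_subset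
  refine ⟨⟨?_, ?_⟩, ?_⟩
  · rw [Finset.union_assoc, h'.1, h.1]
  · intro a ha b hb h1 h2 hab
    simp only [Finset.mem_union, not_or] at ha h2
    by_cases haP : a ∈ P
    · exact h'.2 a haP b hb h1 h2.2 hab
    · have haA : a ∈ A := by tauto
      exact h.2 a haA b (hQB hb) (fun haB => haP (hP (Finset.mem_inter.2 ⟨haA, haB⟩))) h2.1 hab
  · ext v
    simp only [Finset.mem_union, Finset.mem_inter]
    refine ⟨fun hv => ⟨?_, hv.2⟩, fun hv => ⟨Or.inr hv.1, hv.2⟩⟩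
    rcases hv.1 with h1 | h1
    · exact hP (Finset.mem_inter.2 ⟨h1, hQB hv.2⟩)
    · exact h1

theorem IsSep.glue_right {P Q : Finset V} (h : IsSep G D A B) (h' : IsSep G A P Q)
    (hQ : A ∩ B ⊆ Q) : IsSep G D P (Q ∪ B) ∧ P ∩ (Q ∪ B) = P ∩ Q := by
  have := h.symm.glue_left h'.symm (by rwa [Finset.inter_comm])
  rw [Finset.union_comm Q B, Finset.inter_comm P, Finset.inter_comm P]
  exact ⟨this.1.symm, this.2⟩

omit [DecidableEq V] in
theorem Step.mono {γ : Type*} {G' : SimpleGraph V} {D' : Finset V} {f f' : V → γ} {a b : V}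
    (hG : G ≤ G') (hD : D ⊆ D') (hf : f a = f b → f' a = f' b) (h : Step G D f a b) :
    Step G' D' f' a b :=
  ⟨hG h.1, hD h.2.1, hD h.2.2.1, hf h.2.2.2⟩

omit [DecidableEq V] in
theorem Linked.congr {G' : SimpleGraph V} (h : Linked G D X)
    (hG : ∀ a ∈ D, ∀ b ∈ D, G.Adj a b → G'.Adj a b) : Linked G' D X := by
  intro c
  obtain ⟨f, h1, h2⟩ := h c
  exact ⟨f, h1, fun x hx y hy hxy => ReflTransGen.mono (fun a b hab =>
    ⟨hG a hab.2.1 b hab.2.2.1 hab.1, hab.2⟩) _ _ (h2 x hx y hy hxy)⟩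

omit [DecidableEq V] in
theorem Linked.mono {G' : SimpleGraph V} {D' : Finset V} (h : Linked G D X)
    (hG : G ≤ G') (hD : D ⊆ D') : Linked G' D' X := by
  intro c
  obtain ⟨f, h1, h2⟩ := h c
  exact ⟨f, h1, fun x hx y hy hxy =>
    ReflTransGen.mono (fun a b hab => hab.mono hG hD id) _ _ (h2 x hx y hy hxy)⟩

omit [DecidableEq V] in
theorem le_addClique (G : SimpleGraph V) (Z : Finset V) : G ≤ addClique G Z :=
  fun _ _ h => Or.inl h

theorem Linked.of_addClique (hX : X ⊆ A) (hA : Linked (addClique G (A ∩ B)) A X)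
    (hB : Linked G B (A ∩ B)) : Linked G (A ∪ B) X := by
  intro c
  obtain ⟨f1, h1, h1'⟩ := hA c
  obtain ⟨f2, h2, h2'⟩ := hB f1
  let f : V → ℕ := fun v => if v ∈ A then f1 v else f2 v
  have hfA : ∀ v ∈ A, f v = f1 v := fun v hv => by simp [f, hv]
  have hfB : ∀ v ∈ B, f v = f2 v := fun v hv => by
    by_cases hvA : v ∈ A
    · rw [hfA v hvA, h2 v (Finset.mem_inter.2 ⟨hvA, hv⟩)]
    · simp [f, hvA]
  refine ⟨f, fun x hx => by rw [hfA x (hX hx), h1 x hx], fun x hx y hy hxy => ?_⟩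
  refine ReflTransGen.lift' id ?_ _ _ (h1' x hx y hy hxy)
  rintro a b ⟨hab, ha, hb, hc⟩
  rcases hab with hab | ⟨-, haZ, hbZ⟩
  · refine .single ⟨hab, Finset.mem_union_left _ ha, Finset.mem_union_left _ hb, ?_⟩
    rw [id, id, hfA a ha, hfA b hb, hc]
  · refine ReflTransGen.mono ?_ _ _ (h2' a haZ b hbZ hc)
    intro p q hpq
    exact ⟨hpq.1, Finset.mem_union_right _ hpq.2.1, Finset.mem_union_right _ hpq.2.2.1, by
      rw [hfB p hpq.2.1, hfB q hpq.2.2.1, hpq.2.2.2]⟩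

theorem Linked.of_absorb {u v : V} (huv : G.Adj u v) (hu : u ∈ D) (hv : v ∉ D) (hX : X ⊆ D)
    (h : Linked (absorb G u v) D X) : Linked G (insert v D) X := by
  intro c
  obtain ⟨f1, h1, h1'⟩ := h c
  let f : V → ℕ := fun w => if w = v then f1 u else f1 w
  have hfD : ∀ w ∈ D, f w = f1 w := fun w hw => by
    have : w ≠ v := fun h => hv (h ▸ hw)
    simp [f, this]
  have hfv : f v = f1 u := by simp [f]
  refine ⟨f, fun x hx => by rw [hfD x (hX hx), h1 x hx], fun x hx y hy hxy => ?_⟩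
  refine ReflTransGen.lift' id ?_ _ _ (h1' x hx y hy hxy)
  rintro a b ⟨⟨-, hab⟩, ha, hb, hc⟩
  have ha' := Finset.mem_insert_of_mem (b := v) ha
  have hb' := Finset.mem_insert_of_mem (b := v) hb
  have hv' := Finset.mem_insert_self v D
  rcases hab with hab | ⟨rfl, hab⟩ | ⟨rfl, hab⟩
  · exact .single ⟨hab, ha', hb', by rw [id, id, hfD a ha, hfD b hb, hc]⟩
  · refine .head (b := v) ⟨huv, ha', hv', ?_⟩ (.single ⟨hab, hv', hb', ?_⟩)
    · rw [id, hfD _ ha, hfv]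
    · rw [id, hfD _ hb, hfv, hc]
  · refine .head (b := v) ⟨hab.symm, ha', hv', ?_⟩ (.single ⟨huv.symm, hv', hb', ?_⟩)
    · rw [id, hfD _ ha, hfv, hc]
    · rw [id, hfD _ hb, hfv]

theorem Linked.of_paths {g : V → V} (hX : X ⊆ A) (hg : ∀ x ∈ X, g x = x)
    (hp : ∀ x ∈ X, ∃ z ∈ A ∩ B, g z = x ∧ ReflTransGen (Step G A g) x z)
    (hB : Linked G B (A ∩ B)) : Linked G (A ∪ B) X := by
  intro c
  obtain ⟨f2, h2, h2'⟩ := hB (fun z => c (g z))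
  let f : V → ℕ := fun v => if v ∈ A then c (g v) else f2 v
  have hfA : ∀ v ∈ A, f v = c (g v) := fun v hv => by simp [f, hv]
  have hfB : ∀ v ∈ B, f v = f2 v := fun v hv => by
    by_cases hvA : v ∈ A
    · rw [hfA v hvA, h2 v (Finset.mem_inter.2 ⟨hvA, hv⟩)]
    · simp [f, hvA]
  have hl : ∀ a b, ReflTransGen (Step G A g) a b → ReflTransGen (Step G (A ∪ B) f) a b := by
    intro a b
    refine ReflTransGen.mono ?_ _ _
    intro p q hpq
    exact ⟨hpq.1, Finset.mem_union_left _ hpq.2.1, Finset.mem_union_left _ hpq.2.2.1, by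
      rw [hfA p hpq.2.1, hfA q hpq.2.2.1, hpq.2.2.2]⟩
  refine ⟨f, fun x hx => by rw [hfA x (hX hx), hg x hx], fun x hx y hy hxy => ?_⟩
  obtain ⟨z, hz, hgz, hxz⟩ := hp x hx
  obtain ⟨w, hw, hgw, hyw⟩ := hp y hy
  refine (hl _ _ hxz).trans (.trans ?_ (hl _ _ (reach_symm hyw)))
  refine ReflTransGen.mono ?_ _ _ (h2' z hz w hw (by simp only [hgz, hgw, hxy]))
  intro p q hpq
  exact ⟨hpq.1, Finset.mem_union_right _ hpq.2.1, Finset.mem_union_right _ hpq.2.2.1, by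
    rw [hfB p hpq.2.1, hfB q hpq.2.2.1, hpq.2.2.2]⟩

omit [DecidableEq V] in
theorem reach_first_hit {r : V → V → Prop} {P : V → Prop} {y z : V} (h : ReflTransGen r y z)
    (hz : P z) : ∃ z', P z' ∧ ReflTransGen (fun a b => r a b ∧ ¬ P a) y z' := by
  induction h using ReflTransGen.head_induction_on with
  | refl => exact ⟨z, hz, .refl⟩
  | @head a b hab _ ih =>
    by_cases ha : P a
    · exact ⟨a, ha, .refl⟩
    · obtain ⟨z', h1, h2⟩ := ih
      exact ⟨z', h1, .head ⟨hab, ha⟩ h2⟩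

omit [DecidableEq V] in
theorem reach_color {γ : Type*} {f : V → γ} {a b : V} (h : ReflTransGen (Step G D f) a b) :
    f a = f b := by
  induction h with
  | refl => rfl
  | tail _ h ih => exact ih.trans h.2.2.2

theorem Linked.of_paths_subset {W : Finset V} {g : V → V} (hW : W ⊆ D)
    (hg : ∀ x ∈ X, g x = x)
    (hp : ∀ x ∈ X, ∃ z ∈ W, g z = x ∧ ReflTransGen (Step G D g) x z)
    (hL : ∀ Y ⊆ W, Y.card ≤ X.card → Linked G W Y) : Linked G D X := by
  have hp' : ∀ x : V, ∃ z, x ∈ X → z ∈ W ∧ g z = x ∧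
      ReflTransGen (fun a b => Step G D g a b ∧ ¬ a ∈ W) x z := by
    intro x
    by_cases hx : x ∈ X
    · obtain ⟨z, hz, -, h⟩ := hp x hx
      obtain ⟨z', h1, h2⟩ := reach_first_hit (P := (· ∈ W)) h hz
      refine ⟨z', fun _ => ⟨h1, ?_, h2⟩⟩
      rw [← reach_color (ReflTransGen.mono (fun a b hab => hab.1) _ _ h2), hg x hx]
    · exact ⟨x, fun h => absurd h hx⟩
  choose ζ hζ using hp'
  intro c
  obtain ⟨f2, h2, h2'⟩ := hL (X.image ζ) (by
    intro z hz
    obtain ⟨x, hx, rfl⟩ := Finset.mem_image.1 hz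
    exact (hζ x hx).1) Finset.card_image_le (fun z => c (g z))
  let f : V → ℕ := fun v => if v ∈ W then f2 v else c (g v)
  have hfW : ∀ v ∈ W, f v = f2 v := fun v hv => by simp [f, hv]
  have hfN : ∀ v, v ∉ W → f v = c (g v) := fun v hv => by simp [f, hv]
  have hfζ : ∀ x ∈ X, f (ζ x) = c (g (ζ x)) := fun x hx => by
    rw [hfW _ (hζ x hx).1, h2 _ (Finset.mem_image_of_mem _ hx)]
  have hl : ∀ x ∈ X, ∀ a, ReflTransGen (fun a b => Step G D g a b ∧ ¬ a ∈ W) a (ζ x) →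
      f a = c (g a) ∧ ReflTransGen (Step G D f) a (ζ x) := by
    intro x hx a ha
    induction ha using ReflTransGen.head_induction_on with
    | refl => exact ⟨hfζ x hx, .refl⟩
    | @head a b hab _ ih =>
      refine ⟨hfN a hab.2, .head ⟨hab.1.1, hab.1.2.1, hab.1.2.2.1, ?_⟩ ih.2⟩
      rw [hfN a hab.2, ih.1, hab.1.2.2.2]
  refine ⟨f, fun x hx => by rw [(hl x hx x (hζ x hx).2.2).1, hg x hx], fun x hx y hy hxy => ?_⟩
  refine (hl x hx x (hζ x hx).2.2).2.trans
    (.trans ?_ (reach_symm (hl y hy y (hζ y hy).2.2).2))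
  refine ReflTransGen.mono ?_ _ _ (h2' (ζ x) (Finset.mem_image_of_mem _ hx) (ζ y)
    (Finset.mem_image_of_mem _ hy) (by simp only [(hζ x hx).2.1, (hζ y hy).2.1, hxy]))
  intro p q hpq
  exact ⟨hpq.1, hW hpq.2.1, hW hpq.2.2.1, by
    rw [hfW p hpq.2.1, hfW q hpq.2.2.1, hpq.2.2.2]⟩

end Linkage

section Massed

variable {V : Type*} [DecidableEq V]

open Classical in
/-- Twice the number of edges of `G[D]` that are not inside `X`. -/
noncomputable def rho (G : SimpleGraph V) (D X : Finset V) : ℕ :=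
  ((D ×ˢ D).filter fun p => G.Adj p.1 p.2 ∧ ¬ (p.1 ∈ X ∧ p.2 ∈ X)).card

/-- `G[D]` has average degree more than `Λ` outside of `X`. -/
def Dense (Λ : ℕ) (G : SimpleGraph V) (D X : Finset V) : Prop :=
  Λ * (D \ X).card < rho G D X

/-- `G[D]` is dense outside of `X`, and no separation of order less than `|X|` cuts off a
dense part from `X`. -/
def Massed (Λ : ℕ) (G : SimpleGraph V) (D X : Finset V) : Prop :=
  Dense Λ G D X ∧ ∀ A B, IsSep G D A B → X ⊆ A → (A ∩ B).card < X.card →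
    ¬ Dense Λ G B (A ∩ B)

variable {Λ s : ℕ} {G : SimpleGraph V} {D A B X Y Z : Finset V}

theorem rho_le_of_sep (h : IsSep G D A B) (X : Finset V) :
    rho G D X ≤ rho G A X + rho G B (A ∩ B) := by
  classical
  unfold rho
  refine (Finset.card_le_card ?_).trans (Finset.card_union_le _ _)
  rintro ⟨a, b⟩ hp
  simp only [Finset.mem_filter, Finset.mem_product, Finset.mem_union, Finset.mem_inter] at hp ⊢
  obtain ⟨⟨ha, hb⟩, hab, hX⟩ := hp
  have h1 := h.mem ha
  have h2 := h.mem hb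
  have h3 := h.2 a
  have h4 := h.2 b
  have h5 := hab.symm
  by_cases haA : a ∈ A <;> by_cases hbA : b ∈ A <;> by_cases haB : a ∈ B <;>
    by_cases hbB : b ∈ B <;> simp_all

theorem rho_mono {G' : SimpleGraph V} (h : ∀ a ∈ D, ∀ b ∈ D, ¬ (a ∈ X ∧ b ∈ X) → G.Adj a b →
    G'.Adj a b) : rho G D X ≤ rho G' D X := by
  classical
  unfold rho
  refine Finset.card_le_card ?_
  rintro ⟨a, b⟩ hp
  simp only [Finset.mem_filter, Finset.mem_product] at hp ⊢
  exact ⟨hp.1, h a hp.1.1 b hp.1.2 hp.2.2 hp.2.1, hp.2.2⟩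

theorem not_dense_of_subset (h : D ⊆ X) : ¬ Dense Λ G D X := by
  classical
  have : rho G D X = 0 := by
    unfold rho
    rw [Finset.card_eq_zero, Finset.filter_eq_empty_iff]
    rintro ⟨a, b⟩ hp hh
    rw [Finset.mem_product] at hp
    exact hh.2 ⟨h hp.1, h hp.2⟩
  simp [Dense, this]

theorem IsSep.card_sdiff (h : IsSep G D A B) (hX : X ⊆ A) :
    (D \ X).card = (A \ X).card + (B \ (A ∩ B)).card := by
  have h1 := h.card
  have h2 := Finset.card_sdiff_of_subset (hX.trans h.left_subset)
  have h3 := Finset.card_sdiff_of_subset hX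
  have h4 := Finset.card_sdiff_of_subset (Finset.inter_subset_right : A ∩ B ⊆ B)
  have h5 := Finset.card_le_card hX
  have h6 := Finset.card_le_card (Finset.inter_subset_right : A ∩ B ⊆ B)
  omega

theorem Dense.left_of_sep (hd : Dense Λ G D X) (h : IsSep G D A B) (hX : X ⊆ A)
    (hB : ¬ Dense Λ G B (A ∩ B)) : Dense Λ G A X := by
  have h1 := rho_le_of_sep h X
  have h2 := h.card_sdiff hX
  unfold Dense at *
  rw [h2, mul_add] at hd
  omega

theorem massed_of_minimal (h : IsSep G D A B) (hX : X ⊆ A) (hd : Dense Λ G B (A ∩ B))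
    (hmin : ∀ P Q, IsSep G D P Q → X ⊆ P → (P ∩ Q).card < (A ∩ B).card →
      ¬ Dense Λ G Q (P ∩ Q)) : Massed Λ G B (A ∩ B) := by
  refine ⟨hd, fun P Q hPQ hP hlt => ?_⟩
  obtain ⟨h1, h2⟩ := h.glue_left hPQ hP
  rw [← h2]
  exact hmin _ _ h1 (hX.trans Finset.subset_union_left) (by rwa [h2])

theorem exists_massed_of_not_massed (hd : Dense Λ G D X) (hm : ¬ Massed Λ G D X) :
    ∃ A B, IsSep G D A B ∧ X ⊆ A ∧ (A ∩ B).card < X.card ∧ Massed Λ G B (A ∩ B) := by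
  classical
  have hex : ∃ n, ∃ A B, IsSep G D A B ∧ X ⊆ A ∧ (A ∩ B).card < X.card ∧ Dense Λ G B (A ∩ B) ∧
      (A ∩ B).card = n := by
    by_contra! hcon
    exact hm ⟨hd, fun A B h1 h2 h3 h4 => hcon _ A B h1 h2 h3 h4 rfl⟩
  obtain ⟨A, B, h1, h2, h3, h4, h5⟩ := Nat.find_spec hex
  refine ⟨A, B, h1, h2, h3, massed_of_minimal h1 h2 h4 fun P Q h6 h7 h8 h9 => ?_⟩
  exact Nat.find_min hex (h5 ▸ h8) ⟨P, Q, h6, h7, h8.trans h3, h9, rfl⟩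

theorem card_lt_of_dense (h : IsSep G D A B) (hd : Dense Λ G B (A ∩ B)) : A.card < D.card := by
  refine Finset.card_lt_card (h.left_subset.ssubset_of_ne ?_)
  rintro rfl
  exact not_dense_of_subset (by rw [Finset.inter_eq_right.2 h.right_subset]) hd

theorem card_lt_of_order (h : IsSep G D A B) (hX : X ⊆ D) (hc : (A ∩ B).card < X.card)
    (hXA : X ⊆ A) : B.card < D.card := by
  refine Finset.card_lt_card (h.right_subset.ssubset_of_ne ?_)
  rintro rfl
  exact absurd (Finset.card_le_card (Finset.subset_inter hXA hX)) (by omega)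

/-- A separation of minimal order between `X` and `Z` carries disjoint paths. -/
theorem exists_paths_of_min (h : IsSep G D A B) (hXA : X ⊆ A) (hZ : Z ⊆ B)
    (hmin : ∀ P Q, IsSep G D P Q → X ⊆ P → Z ⊆ Q → (A ∩ B).card ≤ (P ∩ Q).card) :
    ∃ g : V → V, (∀ y ∈ A ∩ B, g y = y) ∧
      ∀ y ∈ A ∩ B, ∃ z ∈ Z, g z = y ∧ ReflTransGen (Step G B g) y z := by
  refine menger G _ B (A ∩ B) Z rfl Finset.inter_subset_right hZ fun P Q hPQ hP hQ => ?_
  obtain ⟨h1, h2⟩ := h.glue_left hPQ hP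
  rw [← h2]
  exact hmin _ _ h1 (hXA.trans Finset.subset_union_left) hQ

theorem exists_min_sep (G : SimpleGraph V) (D X Z : Finset V) (n : ℕ) :
    (∀ A B, IsSep G D A B → X ⊆ A → Z ⊆ B → n ≤ (A ∩ B).card) ∨
    ∃ A B, IsSep G D A B ∧ X ⊆ A ∧ Z ⊆ B ∧ (A ∩ B).card < n ∧
      ∀ P Q, IsSep G D P Q → X ⊆ P → Z ⊆ Q → (A ∩ B).card ≤ (P ∩ Q).card := by
  classical
  by_cases hcase : ∀ A B, IsSep G D A B → X ⊆ A → Z ⊆ B → n ≤ (A ∩ B).card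
  · exact Or.inl hcase
  right
  push Not at hcase
  have hex : ∃ m, ∃ A B, IsSep G D A B ∧ X ⊆ A ∧ Z ⊆ B ∧ (A ∩ B).card = m := by
    obtain ⟨A, B, h1, h2, h3, -⟩ := hcase
    exact ⟨_, A, B, h1, h2, h3, rfl⟩
  obtain ⟨A, B, h1, h2, h3, h4⟩ := Nat.find_spec hex
  have hmin : ∀ P Q, IsSep G D P Q → X ⊆ P → Z ⊆ Q → (A ∩ B).card ≤ (P ∩ Q).card :=
    fun P Q h5 h6 h7 => h4 ▸ Nat.find_min' hex ⟨P, Q, h5, h6, h7, rfl⟩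
  refine ⟨A, B, h1, h2, h3, ?_, hmin⟩
  obtain ⟨P, Q, h5, h6, h7, h8⟩ := hcase
  exact (hmin P Q h5 h6 h7).trans_lt h8

theorem linked_of_rigid (hXs : X.card ≤ s) (hm : Massed Λ G D X)
    (ih : ∀ (G' : SimpleGraph V) (D' X' : Finset V), D'.card < D.card → X' ⊆ D' → X'.card ≤ s →
      Massed Λ G' D' X' → Linked G' D' X') :
    ∀ (n : ℕ) (A B : Finset V), A.card = n → IsSep G D A B → X ⊆ A → (A ∩ B).card ≤ X.card →
      A.card < D.card → Linked G B (A ∩ B) → Linked G D X := by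
  intro n
  induction n using Nat.strong_induction_on with
  | _ n IH =>
  intro A B hn hAB hXA hc hAD hL
  rcases hc.eq_or_lt with hc | hc
  · rcases exists_min_sep G A X (A ∩ B) X.card with h | h
    · obtain ⟨g, hg, hp⟩ := menger G _ A X (A ∩ B) rfl hXA Finset.inter_subset_left h
      rw [← hAB.1]
      exact Linked.of_paths hXA hg hp hL
    · obtain ⟨A1, A2, h1, h2, h3, h4, h5⟩ := h
      obtain ⟨g, hg, hp⟩ := exists_paths_of_min h1 h2 h3 h5
      obtain ⟨h6, h7⟩ := hAB.glue_right h1 h3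
      have h8 : A2 ∩ B = A ∩ B := by
        refine subset_antisymm (Finset.inter_subset_inter_right h1.right_subset) ?_
        exact Finset.subset_inter h3 Finset.inter_subset_right
      have h9 : A1.card < A.card := by
        refine Finset.card_lt_card (h1.left_subset.ssubset_of_ne ?_)
        rintro rfl
        have := Finset.card_le_card (Finset.subset_inter (Finset.inter_subset_left : A1 ∩ B ⊆ A1) h3)
        omega
      refine IH _ (hn ▸ h9) A1 (A2 ∪ B) rfl h6 h2 (by rw [h7]; exact h4.le) (h9.trans hAD) ?_
      rw [h7]
      exact Linked.of_paths Finset.inter_subset_right hg (by rwa [h8]) (by rwa [h8])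
  · have hdA : Dense Λ G A X := hm.1.left_of_sep hAB hXA (hm.2 A B hAB hXA hc)
    have hdA' : Dense Λ (addClique G (A ∩ B)) A X :=
      lt_of_lt_of_le hdA (rho_mono fun a _ b _ _ h => Or.inl h)
    by_cases hmA : Massed Λ (addClique G (A ∩ B)) A X
    · rw [← hAB.1]
      exact Linked.of_addClique hXA (ih _ A X hAD hXA hXs hmA) hL
    obtain ⟨A', B', h1, h2, h3, h4⟩ := exists_massed_of_not_massed hdA' hmA
    have h1' := h1.anti (le_addClique G _)
    have hcl : A ∩ B ⊆ A' ∨ A ∩ B ⊆ B' := by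
      by_contra! hcon
      obtain ⟨p, hp, hpA⟩ := Finset.not_subset.1 hcon.1
      obtain ⟨q, hq, hqB⟩ := Finset.not_subset.1 hcon.2
      have hpB := (h1.mem (Finset.mem_inter.1 hp).1).resolve_left hpA
      have hqA := (h1.mem (Finset.mem_inter.1 hq).1).resolve_right hqB
      exact h1.2 q hqA p hpB hqB hpA (Or.inr ⟨fun h => hpA (h ▸ hqA), hq, hp⟩)
    rcases hcl with hZ | hZ
    · exfalso
      obtain ⟨h5, h6⟩ := hAB.symm.glue_left h1' (by rwa [Finset.inter_comm])
      refine hm.2 _ _ h5 (h2.trans Finset.subset_union_right) (by rwa [h6]) ?_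
      rw [h6]
      refine lt_of_lt_of_le h4.1 (rho_mono fun a ha b hb hab h => ?_)
      rcases h with h | ⟨-, h7, h8⟩
      · exact h
      · exact absurd ⟨Finset.mem_inter.2 ⟨hZ h7, ha⟩, Finset.mem_inter.2 ⟨hZ h8, hb⟩⟩ hab
    · obtain ⟨h5, h6⟩ := hAB.glue_right h1' hZ
      have h8 : B' ∩ B = A ∩ B := by
        refine subset_antisymm (Finset.inter_subset_inter_right h1.right_subset) ?_
        exact Finset.subset_inter hZ Finset.inter_subset_right
      have h9 : A'.card < A.card := card_lt_of_dense h1 h4.1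
      refine IH _ (hn ▸ h9) A' (B' ∪ B) rfl h5 h2 (by rw [h6]; exact h3.le) (h9.trans hAD) ?_
      rw [h6]
      refine Linked.of_addClique Finset.inter_subset_right ?_ (by rwa [h8])
      rw [h8]
      exact ih _ _ _ ((Finset.card_le_card h1.right_subset).trans_lt hAD)
        Finset.inter_subset_right (h3.le.trans hXs) h4

end Massed

section Reductions

variable {V : Type*} [DecidableEq V] {Λ s : ℕ} {G : SimpleGraph V} {D A B X : Finset V}

theorem Dense.of_rho_le {G' : SimpleGraph V} {D' X' : Finset V} (hd : Dense Λ G D X)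
    (h : rho G D X ≤ rho G' D' X') (hc : (D' \ X').card ≤ (D \ X).card) : Dense Λ G' D' X' :=
  (Nat.mul_le_mul_left _ hc).trans_lt (lt_of_lt_of_le hd h)

omit [DecidableEq V] in
theorem le_absorb (G : SimpleGraph V) (u v : V) : G ≤ absorb G u v :=
  fun _ _ h => ⟨h.ne, Or.inl h⟩

theorem rho_absorb_le {u v : V} (hv : v ∉ D) (hu : u ∈ X) :
    rho (absorb G u v) D X ≤ rho G (insert v D) (insert v X) := by
  classical
  unfold rho
  refine Finset.card_le_card_of_injOn (fun p => if G.Adj p.1 p.2 then p else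
    (if p.1 = u then v else p.1, if p.2 = u then v else p.2)) ?_ ?_
  · rintro ⟨a, b⟩ hp
    simp only [Finset.coe_filter, Finset.mem_product, Set.mem_ofPred_eq] at hp ⊢
    obtain ⟨⟨ha, hb⟩, ⟨hne, hab⟩, hX'⟩ := hp
    have hav : a ≠ v := fun h => hv (h ▸ ha)
    have hbv : b ≠ v := fun h => hv (h ▸ hb)
    by_cases h : G.Adj a b
    · simp [h, ha, hb, hav, hbv]
      tauto
    · rcases hab.resolve_left h with ⟨rfl, h1⟩ | ⟨rfl, h1⟩
      · have hb' : b ∉ X := fun hbX => hX' ⟨hu, hbX⟩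
        simp [h, hne.symm, h1, hb, hbv, hb']
      · have ha' : a ∉ X := fun haX => hX' ⟨haX, hu⟩
        simp [h, hne, h1.symm, ha, hav, ha']
  · rintro ⟨a, b⟩ hp ⟨a', b'⟩ hp' heq
    simp only [Finset.coe_filter, Finset.mem_product, Set.mem_ofPred_eq] at hp hp'
    have hav : a ≠ v := fun h => hv (h ▸ hp.1.1)
    have hbv : b ≠ v := fun h => hv (h ▸ hp.1.2)
    have hav' : a' ≠ v := fun h => hv (h ▸ hp'.1.1)
    have hbv' : b' ≠ v := fun h => hv (h ▸ hp'.1.2)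
    have h1 := hp.2.1.2
    have h2 := hp'.2.1.2
    have h3 := hp.2.1.1
    have h4 := hp'.2.1.1
    clear hp hp'
    grind

theorem rho_le_absorb {u v : V} {t : ℕ} (huv : G.Adj u v) (hu : u ∈ D)
    (huX : u ∉ X) (hvX : v ∉ X)
    (ht : ∀ T : Finset V, (∀ w ∈ T, w ∈ D ∧ G.Adj u w ∧ G.Adj v w) → T.card ≤ t) :
    rho G D X ≤ rho (absorb G u v) (D.erase v) X + (2 + 2 * t) := by
  classical
  set T := D.filter fun w => G.Adj u w ∧ G.Adj v w with hT
  have hTc : T.card ≤ t := ht T fun w hw => by simpa [hT] using hw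
  set bad : Finset (V × V) := {(u, v), (v, u)} ∪ (T.image (fun w => (v, w)) ∪
    T.image (fun w => (w, v))) with hbad
  have hbc : bad.card ≤ 2 + 2 * t := by
    refine (Finset.card_union_le _ _).trans (Nat.add_le_add Finset.card_le_two ?_)
    refine (Finset.card_union_le _ _).trans ?_
    have h1 := Finset.card_image_le (s := T) (f := fun w => (v, w))
    have h2 := Finset.card_image_le (s := T) (f := fun w => (w, v))
    omega
  unfold rho
  set R := (D ×ˢ D).filter fun p => G.Adj p.1 p.2 ∧ ¬ (p.1 ∈ X ∧ p.2 ∈ X) with hR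
  have h1 : R.card ≤ (R \ bad).card + bad.card := by
    rw [← Finset.card_union_of_disjoint Finset.sdiff_disjoint, Finset.sdiff_union_self_eq_union]
    exact Finset.card_le_card Finset.subset_union_left
  have h2 : (R \ bad).card ≤ (((D.erase v) ×ˢ (D.erase v)).filter fun p =>
      (absorb G u v).Adj p.1 p.2 ∧ ¬ (p.1 ∈ X ∧ p.2 ∈ X)).card := by
    refine Finset.card_le_card_of_injOn (fun p =>
      (if p.1 = v then u else p.1, if p.2 = v then u else p.2)) ?_ ?_
    · rintro ⟨a, b⟩ hp
      simp only [hR, hbad, Finset.coe_filter, Finset.mem_product, Set.mem_ofPred_eq,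
        Finset.coe_sdiff, Set.mem_sdiff, Finset.mem_coe, Finset.mem_union, Finset.mem_insert,
        Finset.mem_singleton, Finset.mem_image, Prod.mk.injEq, hT, Finset.mem_filter,
        Finset.mem_erase] at hp ⊢
      have := huv.ne
      have := huv.symm
      by_cases hav : a = v
      · subst hav
        have : b ≠ a := hp.1.2.1.ne.symm
        have : b ≠ u := by grind
        simp [*, absorb, this.symm]
      · by_cases hbv : b = v
        · subst hbv
          have : a ≠ u := by grind
          simp [*, absorb, huv.ne]
          have := hp.1.2.1.symm
          grind
        · simp only [hav, hbv, if_false, absorb]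
          have := hp.1.2.1.ne
          grind
    · rintro ⟨a, b⟩ hp ⟨a', b'⟩ hp' heq
      simp only [hR, hbad, Finset.coe_filter, Finset.mem_product, Set.mem_ofPred_eq,
        Finset.coe_sdiff, Set.mem_sdiff, Finset.mem_coe, Finset.mem_union, Finset.mem_insert,
        Finset.mem_singleton, Finset.mem_image, Prod.mk.injEq, hT, Finset.mem_filter] at hp hp' heq
      have h1 := hp.1.2.1
      have h2 := hp'.1.2.1
      have h3 := h1.symm
      have h4 := h2.symm
      have h5 := h1.ne
      have h6 := h2.ne
      have h7 := huv.ne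
      grind
  omega

theorem linked_of_insert_dense (hXs : X.card ≤ s) (hm : Massed Λ G D X)
    (ih : ∀ (G' : SimpleGraph V) (D' X' : Finset V), D'.card < D.card → X' ⊆ D' → X'.card ≤ s →
      Massed Λ G' D' X' → Linked G' D' X') {v : V} (hvD : v ∈ D)
    (hAB : IsSep G (D.erase v) A B) (hXA : X ⊆ A) (hc : (A ∩ B).card < X.card)
    (hd : Dense Λ G (insert v B) (insert v (A ∩ B))) (hA : A.card < (D.erase v).card) :
    Linked G D X := by
  have hvA : v ∉ A := fun h => by simpa using hAB.left_subset h
  have hvB : v ∉ B := fun h => by simpa using hAB.right_subset h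
  have hXe : X ⊆ D.erase v := hXA.trans hAB.left_subset
  have hB := card_lt_of_order hAB hXe hc hXA
  have hDc := Finset.card_erase_add_one hvD
  have hsep := hAB.insert_both v hvD
  have hI : insert v A ∩ insert v B = insert v (A ∩ B) := (Finset.insert_inter_distrib _ _ _).symm
  have hXA' := hXA.trans (Finset.subset_insert v A)
  have hcard : (insert v (A ∩ B)).card = (A ∩ B).card + 1 :=
    Finset.card_insert_of_notMem fun h => hvA (Finset.mem_inter.1 h).1
  rw [← hI] at hd hcard
  by_cases h : (insert v A ∩ insert v B).card < X.card
  · exact absurd hd (hm.2 _ _ hsep hXA' h)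
  · have hle : (insert v A ∩ insert v B).card = X.card := by omega
    have hm' := massed_of_minimal hsep hXA' hd fun P Q h1 h2 h3 => hm.2 P Q h1 h2 (by omega)
    refine linked_of_rigid hXs hm ih _ _ _ rfl hsep hXA' hle.le ?_ ?_
    · rw [Finset.card_insert_of_notMem hvA]; omega
    · refine ih _ _ _ ?_ Finset.inter_subset_right (by omega) hm'
      rw [Finset.card_insert_of_notMem hvB]; omega

theorem linked_of_delete (hXs : X.card ≤ s) (hXD : X ⊆ D) (hm : Massed Λ G D X)
    (ih : ∀ (G' : SimpleGraph V) (D' X' : Finset V), D'.card < D.card → X' ⊆ D' → X'.card ≤ s →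
      Massed Λ G' D' X' → Linked G' D' X') {v : V} (hvD : v ∈ D) (hvX : v ∉ X)
    (hd : Dense Λ G (D.erase v) X) : Linked G D X := by
  have hXe : X ⊆ D.erase v := fun x hx => Finset.mem_erase.2 ⟨fun h => hvX (h ▸ hx), hXD hx⟩
  have hDc := Finset.card_erase_add_one hvD
  by_cases hm' : Massed Λ G (D.erase v) X
  · exact (ih G _ X (by omega) hXe hXs hm').mono le_rfl (Finset.erase_subset _ _)
  obtain ⟨A, B, hAB, hXA, hc, hmB⟩ := exists_massed_of_not_massed hd hm'
  have hvB : v ∉ B := fun h => by simpa using hAB.right_subset h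
  refine linked_of_insert_dense hXs hm ih hvD hAB hXA hc (hmB.1.of_rho_le ?_ ?_)
    (card_lt_of_dense hAB hmB.1)
  · unfold rho
    refine Finset.card_le_card ?_
    rintro ⟨a, b⟩ hp
    simp only [Finset.mem_filter, Finset.mem_product, Finset.mem_insert] at hp ⊢
    have hav : a ≠ v := fun h => hvB (h ▸ hp.1.1)
    have hbv : b ≠ v := fun h => hvB (h ▸ hp.1.2)
    tauto
  · refine Finset.card_le_card ?_
    intro w hw
    simp only [Finset.mem_sdiff, Finset.mem_insert] at hw ⊢
    tauto

theorem linked_of_contract (hXs : X.card ≤ s) (hXD : X ⊆ D) (hm : Massed Λ G D X)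
    (ih : ∀ (G' : SimpleGraph V) (D' X' : Finset V), D'.card < D.card → X' ⊆ D' → X'.card ≤ s →
      Massed Λ G' D' X' → Linked G' D' X') {u v : V} (huv : G.Adj u v) (huD : u ∈ D) (hvD : v ∈ D)
    (hvX : v ∉ X) (hd : Dense Λ (absorb G u v) (D.erase v) X) :
    Linked G D X := by
  have hXe : X ⊆ D.erase v := fun x hx => Finset.mem_erase.2 ⟨fun h => hvX (h ▸ hx), hXD hx⟩
  have hDc := Finset.card_erase_add_one hvD
  have hue : u ∈ D.erase v := Finset.mem_erase.2 ⟨huv.ne, huD⟩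
  by_cases hm' : Massed Λ (absorb G u v) (D.erase v) X
  · rw [← Finset.insert_erase hvD]
    exact (ih _ _ X (by omega) hXe hXs hm').of_absorb huv hue (Finset.notMem_erase _ _) hXe
  obtain ⟨A, B, hAB, hXA, hc, hmB⟩ := exists_massed_of_not_massed hd hm'
  have hAB' := hAB.anti (le_absorb G u v)
  have hvA : v ∉ A := fun h => by simpa using hAB.left_subset h
  have hvB : v ∉ B := fun h => by simpa using hAB.right_subset h
  have hA := card_lt_of_dense hAB hmB.1
  have hB := card_lt_of_order hAB hXe hc hXA
  have hLB : Linked (absorb G u v) B (A ∩ B) :=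
    ih _ _ _ (by omega) Finset.inter_subset_right (by omega) hmB
  by_cases huA : u ∈ A
  · by_cases huB : u ∈ B
    · refine linked_of_insert_dense hXs hm ih hvD hAB' hXA hc (hmB.1.of_rho_le ?_ ?_) hA
      · exact rho_absorb_le hvB (Finset.mem_inter.2 ⟨huA, huB⟩)
      · refine Finset.card_le_card ?_
        intro w hw
        simp only [Finset.mem_sdiff, Finset.mem_insert] at hw ⊢
        tauto
    · have hsep : IsSep G D (insert v A) B := by
        refine hAB'.insert_left v hvD fun w hw hvw => ?_
        by_contra hwA
        have hne : u ≠ w := fun h => huB (h ▸ hw)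
        exact hAB.2 u huA w hw huB hwA ⟨hne, Or.inr (Or.inl ⟨rfl, hvw⟩)⟩
      have hI : insert v A ∩ B = A ∩ B := Finset.insert_inter_of_notMem hvB
      refine linked_of_rigid hXs hm ih _ _ _ rfl hsep (hXA.trans (Finset.subset_insert _ _))
        (by rw [hI]; exact hc.le) (by rw [Finset.card_insert_of_notMem hvA]; omega) ?_
      rw [hI]
      refine hLB.congr ?_
      rintro a ha b hb ⟨-, h | ⟨rfl, -⟩ | ⟨rfl, -⟩⟩
      exacts [h, absurd ha huB, absurd hb huB]
  · have huB : u ∈ B := (hAB.mem hue).resolve_left huA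
    have hsep : IsSep G D A (insert v B) := by
      refine (hAB'.symm.insert_left v hvD fun w hw hvw => ?_).symm
      by_contra hwB
      have hne : w ≠ u := fun h => huA (h ▸ hw)
      exact hAB.2 w hw u huB hwB huA ⟨hne, Or.inr (Or.inr ⟨rfl, hvw⟩)⟩
    have hI : A ∩ insert v B = A ∩ B := Finset.inter_insert_of_notMem hvA
    refine linked_of_rigid hXs hm ih _ _ _ rfl hsep hXA
      (by rw [hI]; exact hc.le) (by omega) ?_
    rw [hI]
    exact hLB.of_absorb huv huB hvB Finset.inter_subset_right

end Reductions

section Universal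

variable {V : Type*} [DecidableEq V] {Λ s : ℕ} {G : SimpleGraph V} {D W X Y : Finset V}

theorem linked_of_short_paths {k : ℕ} (hYW : Y ⊆ W) (hY : Y.card ≤ s)
    (hW : ∀ M ⊆ W, M.card ≤ (k + 1) * s → ∀ x ∈ W, ∀ y ∈ W, ∃ T ⊆ W, Disjoint T M ∧ T.card ≤ k ∧
      ReflTransGen (Step G (insert x (insert y T)) fun _ => ()) x y) : Linked G W Y := by
  classical
  intro c
  rcases Y.eq_empty_or_nonempty with rfl | hne
  · exact ⟨c, by simp, by simp⟩
  have hr : ∀ n : ℕ, ∃ z : V, ∀ y ∈ Y, c y = n → z ∈ Y ∧ c z = n := by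
    intro n
    by_cases h : ∃ y ∈ Y, c y = n
    · obtain ⟨y, hy⟩ := h
      exact ⟨y, fun _ _ _ => hy⟩
    · exact ⟨hne.choose, fun y' h1 h2 => absurd ⟨y', h1, h2⟩ h⟩
  choose r hr using hr
  have key : ∀ S ⊆ Y, ∃ (U : Finset V) (f : V → ℕ), Y ⊆ U ∧ U ⊆ W ∧ U.card ≤ Y.card + k * S.card ∧
      (∀ y ∈ Y, f y = c y) ∧ ∀ y ∈ S, ReflTransGen (Step G U f) y (r (c y)) := by
    intro S
    induction S using Finset.induction_on with
    | empty => exact fun _ => ⟨Y, c, subset_rfl, hYW, by simp, fun _ _ => rfl, by simp⟩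
    | @insert y S hyS ih =>
      intro hS
      obtain ⟨U, f, h1, h2, h3, h4, h5⟩ := ih ((Finset.subset_insert _ _).trans hS)
      have hyY : y ∈ Y := hS (Finset.mem_insert_self _ _)
      have hryY := (hr (c y) y hyY rfl)
      have hSc : S.card ≤ s :=
        (Finset.card_le_card ((Finset.subset_insert _ _).trans hS)).trans hY
      obtain ⟨T, hTW, hTU, hTc, hp⟩ := hW U h2 (by
        have := Nat.mul_le_mul_left k hSc
        rw [add_mul, one_mul]; omega) y (hYW hyY) _ (hYW hryY.1)
      let f' : V → ℕ := fun v => if v ∈ T then c y else f v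
      have hfU : ∀ v ∈ U, f' v = f v := fun v hv => by
        have : v ∉ T := fun h => Finset.disjoint_left.1 hTU h hv
        simp [f', this]
      have hfT : ∀ v ∈ insert y (insert (r (c y)) T), f' v = c y := fun v hv => by
        rcases Finset.mem_insert.1 hv with rfl | hv
        · rw [hfU _ (h1 hyY), h4 _ hyY]
        · rcases Finset.mem_insert.1 hv with rfl | hv
          · rw [hfU _ (h1 hryY.1), h4 _ hryY.1, hryY.2]
          · simp [f', hv]
      refine ⟨U ∪ T, f', h1.trans Finset.subset_union_left, Finset.union_subset h2 hTW, ?_, ?_, ?_⟩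
      · rw [Finset.card_insert_of_notMem hyS]
        have := Finset.card_union_le U T
        rw [mul_add, mul_one]; omega
      · exact fun v hv => by rw [hfU v (h1 hv), h4 v hv]
      · intro v hv
        rcases Finset.mem_insert.1 hv with rfl | hv
        · have hsub : insert v (insert (r (c v)) T) ⊆ U ∪ T := by
            refine Finset.insert_subset (Finset.mem_union_left _ (h1 hyY)) ?_
            exact Finset.insert_subset (Finset.mem_union_left _ (h1 hryY.1))
              Finset.subset_union_right
          refine ReflTransGen.mono ?_ _ _ hp
          intro a b hab
          exact ⟨hab.1, hsub hab.2.1, hsub hab.2.2.1, by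
            rw [hfT a hab.2.1, hfT b hab.2.2.1]⟩
        · refine ReflTransGen.mono ?_ _ _ (h5 v hv)
          intro a b hab
          exact ⟨hab.1, Finset.mem_union_left _ hab.2.1, Finset.mem_union_left _ hab.2.2.1, by
            rw [hfU a hab.2.1, hfU b hab.2.2.1, hab.2.2.2]⟩
  obtain ⟨U, f, h1, h2, -, h4, h5⟩ := key Y subset_rfl
  refine ⟨f, h4, fun x hx y hy hxy => ?_⟩
  have hl : ∀ a b, ReflTransGen (Step G U f) a b → ReflTransGen (Step G W f) a b :=
    fun a b h => ReflTransGen.mono (fun p q hpq => hpq.mono le_rfl h2 id) _ _ h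
  refine (hl _ _ (h5 x hx)).trans ?_
  rw [hxy]
  exact reach_symm (hl _ _ (h5 y hy))

theorem exists_common_neighbor {C M : Finset V} {d : ℕ} (x y : V) (N : V → Finset V)
    (hN : ∀ v, N v ⊆ C) (hx : d ≤ (N x).card) (hy : d ≤ (N y).card)
    (hC : C.card + M.card < 2 * d) : ∃ z ∈ C, z ∉ M ∧ z ∈ N x ∧ z ∈ N y := by
  have h1 := Finset.card_union_add_card_inter (N x) (N y)
  have h2 := Finset.card_le_card (Finset.union_subset (hN x) (hN y))
  have h3 : ¬ N x ∩ N y ⊆ M := fun h => by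
    have := Finset.card_le_card h
    omega
  obtain ⟨z, hz, hzM⟩ := Finset.not_subset.1 h3
  have := Finset.mem_inter.1 hz
  exact ⟨z, hN x this.1, hzM, this.1, this.2⟩

theorem reach_of_five_steps {x a p q b y : V} (h1 : x = a ∨ G.Adj x a) (h2 : a = p ∨ G.Adj a p)
    (h3 : p = q ∨ G.Adj p q) (h4 : q = b ∨ G.Adj q b) (h5 : b = y ∨ G.Adj b y) :
    ReflTransGen (Step G (insert x (insert y (({a, p, q, b} : Finset V) \ {x, y}))) fun _ => ())
      x y := by
  generalize hU : insert x (insert y (({a, p, q, b} : Finset V) \ {x, y})) = U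
  have hmem : ∀ w, w = x ∨ w = y ∨ w = a ∨ w = p ∨ w = q ∨ w = b → w ∈ U := by
    intro w hw
    rw [← hU]
    by_cases h1 : w = x
    · simp [h1]
    by_cases h2 : w = y
    · simp [h2]
    simpa [h1, h2] using hw
  have hst : ∀ v w, v ∈ U → w ∈ U → (v = w ∨ G.Adj v w) →
      ReflTransGen (Step G U fun _ => ()) v w := by
    intro v w hv hw hvw
    rcases hvw with h | h
    · rw [h]
    · exact .single ⟨h, hv, hw, rfl⟩
  have hx := hmem x (by simp)
  have hy := hmem y (by simp)
  have ha := hmem a (by simp)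
  have hp := hmem p (by simp)
  have hq := hmem q (by simp)
  have hb := hmem b (by simp)
  exact ((((hst x a hx ha h1).trans (hst a p ha hp h2)).trans (hst p q hp hq h3)).trans
    (hst q b hq hb h4)).trans (hst b y hb hy h5)

theorem exists_universal {δ : ℕ} (H : Finset V) (hs : 1 ≤ s) (hδ : 100 * s ≤ δ)
    (hcard : H.card ≤ 2 * δ + 2 * s + 1) (hne : H.Nonempty) (N : V → Finset V)
    (hN : ∀ x w, w ∈ N x ↔ w ∈ H ∧ G.Adj x w) (hdeg : ∀ x ∈ H, δ ≤ (N x).card) :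
    ∃ W ⊆ H, s ≤ W.card ∧ ∀ Y ⊆ W, Y.card ≤ s → Linked G W Y := by
  classical
  have hNH : ∀ x, N x ⊆ H := fun x w hw => ((hN x w).1 hw).1
  by_cases hcase : ∃ C C' : Finset V, C ⊆ H ∧ C' ⊆ H ∧ Disjoint C C' ∧ C.Nonempty ∧ C'.Nonempty ∧
      (H \ (C ∪ C')).card ≤ 5 * s ∧ ∀ a ∈ C, ∀ b ∈ C', ¬ G.Adj a b
  · obtain ⟨C, C', hC, hC', hdis, ⟨c, hc⟩, -, hQ, hadj, hle⟩ : ∃ C C' : Finset V, C ⊆ H ∧ C' ⊆ H ∧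
        Disjoint C C' ∧ C.Nonempty ∧ C'.Nonempty ∧
        (H \ (C ∪ C')).card ≤ 5 * s ∧ (∀ a ∈ C, ∀ b ∈ C', ¬ G.Adj a b) ∧ C.card ≤ C'.card := by
      obtain ⟨C, C', h1, h2, h3, h4, h5, h6, h7⟩ := hcase
      rcases le_total C.card C'.card with h | h
      · exact ⟨C, C', h1, h2, h3, h4, h5, h6, h7, h⟩
      · exact ⟨C', C, h2, h1, h3.symm, h5, h4, by rwa [Finset.union_comm],
          fun a ha b hb hab => h7 b hb a ha hab.symm, h⟩
    have hCc : 2 * C.card ≤ H.card := by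
      have h1 := Finset.card_union_of_disjoint hdis
      have h2 := Finset.card_le_card (Finset.union_subset hC hC')
      omega
    have hNC : ∀ x ∈ C, δ - 5 * s ≤ (N x ∩ C).card := by
      intro x hx
      have h1 := hdeg x (hC hx)
      have h2 : N x ⊆ (N x ∩ C) ∪ (H \ (C ∪ C')) := by
        intro w hw
        have h3 := (hN x w).1 hw
        have h4 := hadj x hx w
        simp only [Finset.mem_union, Finset.mem_inter, Finset.mem_sdiff]
        tauto
      have h3 := (Finset.card_le_card h2).trans (Finset.card_union_le _ _)
      omega
    refine ⟨C, hC, ?_, fun Y hY hYs => linked_of_short_paths (k := 4) hY hYs ?_⟩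
    · have := hNC c hc
      have := Finset.card_le_card (Finset.inter_subset_right : N c ∩ C ⊆ C)
      omega
    · intro M _ hM x hx y hy
      obtain ⟨z, hz, hzM, hzx, hzy⟩ := exists_common_neighbor (C := C) (M := M) (d := δ - 5 * s) x y
        (fun v => N v ∩ C) (fun v => Finset.inter_subset_right) (hNC x hx) (hNC y hy) (by omega)
      have hxz := ((hN x z).1 (Finset.mem_inter.1 hzx).1).2
      have hyz := ((hN y z).1 (Finset.mem_inter.1 hzy).1).2
      refine ⟨{z}, by simpa using hz, by simpa using hzM, by simp, ?_⟩
      refine .head (b := z) ⟨hxz, ?_, ?_, rfl⟩ (.single ⟨hyz.symm, ?_, ?_, rfl⟩) <;> simp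
  · refine ⟨H, subset_rfl, ?_, fun Y hY hYs => linked_of_short_paths (k := 4) hY hYs ?_⟩
    · obtain ⟨x, hx⟩ := hne
      have := hdeg x hx
      have := Finset.card_le_card (hNH x)
      omega
    intro M hMH hM x hx y hy
    set H' := H \ (M \ {x, y}) with hH'
    have hxH' : x ∈ H' := by simp [hH', hx]
    have hyH' : y ∈ H' := by simp [hH', hy]
    have hH'H : H' ⊆ H := Finset.sdiff_subset
    have hdeg' : ∀ z ∈ H, δ - 5 * s ≤ (N z ∩ H').card := by
      intro z hz
      have h1 := hdeg z hz
      have h2 : N z ⊆ (N z ∩ H') ∪ M := by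
        intro w hw
        have h3 := (hN z w).1 hw
        simp only [hH', Finset.mem_union, Finset.mem_inter, Finset.mem_sdiff]
        tauto
      have h3 := (Finset.card_le_card h2).trans (Finset.card_union_le _ _)
      omega
    have main : ∃ a p q b : V, a ∈ H' ∧ p ∈ H' ∧ q ∈ H' ∧ b ∈ H' ∧ (x = a ∨ G.Adj x a) ∧
        (a = p ∨ G.Adj a p) ∧ (p = q ∨ G.Adj p q) ∧ (q = b ∨ G.Adj q b) ∧ (b = y ∨ G.Adj b y) := by
      by_contra! hno
      set A2 := H'.filter fun p => ∃ a ∈ H', (x = a ∨ G.Adj x a) ∧ (a = p ∨ G.Adj a p) with hA2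
      set B2 := H'.filter fun q => ∃ b ∈ H', (q = b ∨ G.Adj q b) ∧ (b = y ∨ G.Adj b y) with hB2
      have hAB : ∀ p ∈ A2, ∀ q ∈ B2, ¬ (p = q ∨ G.Adj p q) := by
        intro p hp q hq hpq
        obtain ⟨hp', a, ha, h1, h2⟩ := Finset.mem_filter.1 hp
        obtain ⟨hq', b, hb, h3, h4⟩ := Finset.mem_filter.1 hq
        have := hno a p q b ha hp' hq' hb h1 h2 hpq h3
        tauto
      refine hcase ⟨A2, B2, (Finset.filter_subset _ _).trans hH'H,
        (Finset.filter_subset _ _).trans hH'H, ?_, ?_, ?_, ?_, ?_⟩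
      · exact Finset.disjoint_left.2 fun p hp hq => hAB p hp p hq (Or.inl rfl)
      · exact ⟨x, Finset.mem_filter.2 ⟨hxH', x, hxH', Or.inl rfl, Or.inl rfl⟩⟩
      · exact ⟨y, Finset.mem_filter.2 ⟨hyH', y, hyH', Or.inl rfl, Or.inl rfl⟩⟩
      · have hcov : H \ (A2 ∪ B2) ⊆ M := by
          intro w hw
          by_contra hwM
          simp only [Finset.mem_sdiff, Finset.mem_union, not_or] at hw
          have hwH' : w ∈ H' := by simp [hH', hw.1, hwM]
          have d1 : Disjoint (N w ∩ H') (N x ∩ H') := Finset.disjoint_left.2 fun z h1 h2 => by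
            rw [Finset.mem_inter, hN] at h1 h2
            exact hw.2.1 (Finset.mem_filter.2 ⟨hwH', z, h1.2, Or.inr h2.1.2, Or.inr h1.1.2.symm⟩)
          have d2 : Disjoint (N w ∩ H') (N y ∩ H') := Finset.disjoint_left.2 fun z h1 h2 => by
            rw [Finset.mem_inter, hN] at h1 h2
            exact hw.2.2 (Finset.mem_filter.2 ⟨hwH', z, h1.2, Or.inr h1.1.2, Or.inr h2.1.2.symm⟩)
          have d3 : Disjoint (N x ∩ H') (N y ∩ H') := Finset.disjoint_left.2 fun z h1 h2 => by
            rw [Finset.mem_inter, hN] at h1 h2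
            exact hAB z (Finset.mem_filter.2 ⟨h1.2, x, hxH', Or.inl rfl, Or.inr h1.1.2⟩)
              z (Finset.mem_filter.2 ⟨h1.2, y, hyH', Or.inr h2.1.2.symm, Or.inl rfl⟩) (Or.inl rfl)
          have h1 := Finset.card_union_of_disjoint d1
          have h2 := Finset.card_union_of_disjoint (Finset.disjoint_union_left.2 ⟨d2, d3⟩)
          have h3 : (N w ∩ H') ∪ (N x ∩ H') ∪ (N y ∩ H') ⊆ H := by
            intro z hz
            simp only [Finset.mem_union, Finset.mem_inter] at hz
            exact hH'H (by tauto)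
          have h4 := Finset.card_le_card h3
          have := hdeg' w hw.1
          have := hdeg' x hx
          have := hdeg' y hy
          omega
        exact (Finset.card_le_card hcov).trans hM
      · exact fun p hp q hq hpq => hAB p hp q hq (Or.inr hpq)
    obtain ⟨a, p, q, b, ha, hp, hq, hb, h1, h2, h3, h4, h5⟩ := main
    have hsub : ({a, p, q, b} : Finset V) ⊆ H' := by
      intro w hw
      simp only [Finset.mem_insert, Finset.mem_singleton] at hw
      rcases hw with rfl | rfl | rfl | rfl <;> assumption
    refine ⟨({a, p, q, b} : Finset V) \ {x, y}, ?_, ?_, ?_, reach_of_five_steps h1 h2 h3 h4 h5⟩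
    · exact (Finset.sdiff_subset.trans hsub).trans hH'H
    · refine Finset.disjoint_left.2 fun w hw hwM => ?_
      rw [Finset.mem_sdiff] at hw
      have := (Finset.mem_sdiff.1 (hsub hw.1)).2
      rw [Finset.mem_sdiff] at this
      tauto
    · exact (Finset.card_le_card Finset.sdiff_subset).trans Finset.card_le_four

end Universal

section Linkedness

variable {V : Type*} [DecidableEq V] {Λ s : ℕ} {G : SimpleGraph V} {D W X Y : Finset V}

theorem rho_le_erase {v : V} {N : Finset V} (hN : ∀ w, w ∈ N ↔ w ∈ D ∧ G.Adj v w) :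
    rho G D X ≤ rho G (D.erase v) X + 2 * N.card := by
  classical
  unfold rho
  have h1 := Finset.card_image_le (s := N) (f := fun w => (v, w))
  have h2 := Finset.card_image_le (s := N) (f := fun w => (w, v))
  have h3 := Finset.card_union_le (N.image (fun w => (v, w))) (N.image (fun w => (w, v)))
  set R := (D.erase v ×ˢ D.erase v).filter fun p => G.Adj p.1 p.2 ∧ ¬ (p.1 ∈ X ∧ p.2 ∈ X) with hR
  have h4 := Finset.card_union_le R
    (N.image (fun w => (v, w)) ∪ N.image (fun w => (w, v)))
  refine (Finset.card_le_card ?_).trans (h4.trans (by omega))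
  rintro ⟨a, b⟩ hp
  simp only [hR, Finset.mem_filter, Finset.mem_product, Finset.mem_union, Finset.mem_image,
    Prod.mk.injEq, Finset.mem_erase, hN] at hp ⊢
  by_cases ha : a = v
  · subst ha; exact Or.inr (Or.inl ⟨b, ⟨hp.1.2, hp.2.1⟩, rfl, rfl⟩)
  · by_cases hb : b = v
    · subst hb; exact Or.inr (Or.inr ⟨a, ⟨hp.1.1, hp.2.1.symm⟩, rfl, rfl⟩)
    · tauto

theorem sum_degree_le_rho {N : V → Finset V} (hN : ∀ v w, w ∈ N v ↔ w ∈ D ∧ G.Adj v w) :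
    ∑ v ∈ D \ X, (N v).card ≤ rho G D X := by
  classical
  rw [← Finset.card_sigma]
  unfold rho
  refine Finset.card_le_card_of_injOn (fun p => (p.1, p.2)) ?_ ?_
  · rintro ⟨v, w⟩ hp
    simp only [Finset.coe_sigma, Set.mem_sigma_iff, Finset.mem_coe, Finset.mem_sdiff, hN,
      Finset.mem_filter, Finset.mem_product] at hp ⊢
    tauto
  · rintro ⟨v, w⟩ - ⟨v', w'⟩ - h
    simp only [Prod.mk.injEq] at h
    obtain ⟨rfl, rfl⟩ := h
    rfl

/-- A massed graph that can be reduced neither by deleting a vertex nor by contracting an edge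
contains a small dense, hence universally linked, subgraph. -/
theorem exists_universal_of_irreducible (hs : 1 ≤ s) (hXs : X.card ≤ s)
    (hd : Dense (300 * s) G D X)
    (hdel : ∀ v ∈ D, v ∉ X → ¬ Dense (300 * s) G (D.erase v) X)
    (hcon : ∀ u ∈ D, ∀ v ∈ D, u ∉ X → v ∉ X → G.Adj u v →
      ¬ Dense (300 * s) (absorb G u v) (D.erase v) X) :
    ∃ W ⊆ D, s ≤ W.card ∧ ∀ Y ⊆ W, Y.card ≤ s → Linked G W Y := by
  classical
  let N : V → Finset V := fun v => D.filter (G.Adj v)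
  have hN : ∀ v w, w ∈ N v ↔ w ∈ D ∧ G.Adj v w := fun v w => by simp [N]
  have hne : (D \ X).Nonempty := by
    rw [Finset.sdiff_nonempty]
    exact fun h => not_dense_of_subset h hd
  obtain ⟨n, hn⟩ : ∃ n, (D \ X).card = n + 1 :=
    Nat.exists_eq_succ_of_ne_zero (Finset.card_pos.2 hne).ne'
  have hera : ∀ v ∈ D, v ∉ X → (D.erase v \ X).card = n := by
    intro v hv hvX
    have h1 : D.erase v \ X = (D \ X).erase v := by
      ext w; simp only [Finset.mem_sdiff, Finset.mem_erase]; tauto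
    rw [h1, Finset.card_erase_of_mem (Finset.mem_sdiff.2 ⟨hv, hvX⟩), hn]; rfl
  unfold Dense at hd
  rw [hn] at hd
  obtain ⟨Λ', hΛ'⟩ : ∃ Λ', rho G D X = 300 * s * n + Λ' :=
    ⟨rho G D X - 300 * s * n, by rw [mul_add] at hd; omega⟩
  have hΛ : 300 * s < Λ' := by rw [mul_add] at hd; omega
  have hdeg : ∀ v ∈ D, v ∉ X → Λ' ≤ 2 * (N v).card := by
    intro v hv hvX
    have h1 := hdel v hv hvX
    have h2 := rho_le_erase (X := X) (hN v)
    unfold Dense at h1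
    rw [hera v hv hvX] at h1
    omega
  have hcom : ∀ u ∈ D, ∀ v ∈ D, u ∉ X → v ∉ X → G.Adj u v → Λ' ≤ 2 + 2 * (N u ∩ N v).card := by
    intro u hu v hv huX hvX huv
    have h1 := hcon u hu v hv huX hvX huv
    have h2 := rho_le_absorb (t := (N u ∩ N v).card) huv hu huX hvX (fun T hT =>
      Finset.card_le_card fun w hw => by
        have := hT w hw
        rw [Finset.mem_inter, hN, hN]; tauto)
    unfold Dense at h1
    rw [hera v hv hvX] at h1
    omega
  obtain ⟨v, hv, hvdeg⟩ : ∃ v ∈ D \ X, (N v).card ≤ Λ' := by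
    by_contra! hcon'
    have h1 := Finset.card_nsmul_le_sum (D \ X) (fun v => (N v).card) (Λ' + 1) hcon'
    have h2 := sum_degree_le_rho (X := X) hN
    rw [hn, smul_eq_mul] at h1
    have h3 : n * (300 * s) ≤ n * Λ' := Nat.mul_le_mul_left _ hΛ.le
    have h4 : (n + 1) * (Λ' + 1) = n * Λ' + n + Λ' + 1 := by ring
    have h5 : 300 * s * n = n * (300 * s) := by ring
    omega
  obtain ⟨hvD, hvX⟩ := Finset.mem_sdiff.1 hv
  set H := insert v (N v) \ X with hH
  have hHD : H ⊆ D := by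
    intro w hw
    rcases Finset.mem_insert.1 (Finset.mem_sdiff.1 hw).1 with rfl | h
    exacts [hvD, ((hN _ _).1 h).1]
  have hvH : v ∈ H := Finset.mem_sdiff.2 ⟨Finset.mem_insert_self _ _, hvX⟩
  have hHc : H.card ≤ Λ' + 1 := by
    have h1 : H.card ≤ (insert v (N v)).card := Finset.card_le_card Finset.sdiff_subset
    have h2 := Finset.card_insert_le v (N v)
    omega
  have hT : ∀ w ∈ N v, w ∉ X → Λ' ≤ 2 * (((N v ∩ N w) \ X).card + 1) + 2 * s := by
    intro w hw hwX
    obtain ⟨hwD, hvw⟩ := (hN _ _).1 hw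
    have h1 := hcom v hvD w hwD hvX hwX hvw
    have h2 := Finset.le_card_sdiff X (N v ∩ N w)
    omega
  have hins : ∀ w ∈ N v, w ∉ X → ∀ a b : V, a ∈ H → (a = v ∧ b = w ∨ a = w ∧ b = v) →
      Λ' ≤ 2 * (H.filter (G.Adj b)).card + 2 * s := by
    intro w hw hwX a b ha hab
    have h1 := hT w hw hwX
    have hvw := ((hN _ _).1 hw).2
    have h2 : a ∉ (N v ∩ N w) \ X := by
      intro h
      simp only [Finset.mem_sdiff, Finset.mem_inter, hN] at h
      rcases hab with ⟨rfl, -⟩ | ⟨rfl, -⟩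
      exacts [h.1.1.2.ne rfl, h.1.2.2.ne rfl]
    have h3 : insert a ((N v ∩ N w) \ X) ⊆ H.filter (G.Adj b) := by
      intro z hz
      rcases Finset.mem_insert.1 hz with rfl | hz
      · refine Finset.mem_filter.2 ⟨ha, ?_⟩
        rcases hab with ⟨rfl, rfl⟩ | ⟨rfl, rfl⟩
        exacts [hvw.symm, hvw]
      · simp only [Finset.mem_sdiff, Finset.mem_inter] at hz
        refine Finset.mem_filter.2 ⟨Finset.mem_sdiff.2 ⟨Finset.mem_insert_of_mem hz.1.1, hz.2⟩, ?_⟩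
        rcases hab with ⟨rfl, rfl⟩ | ⟨rfl, rfl⟩
        exacts [((hN _ _).1 hz.1.2).2, ((hN _ _).1 hz.1.1).2]
    have h4 := Finset.card_le_card h3
    rw [Finset.card_insert_of_notMem h2] at h4
    omega
  obtain ⟨W, hWH, hW⟩ := exists_universal (G := G) (δ := (Λ' + 1) / 2 - s) H hs (by omega) (by omega)
    ⟨v, hvH⟩ (fun x => H.filter (G.Adj x)) (fun x w => by simp) (by
      intro x hx
      obtain ⟨hx1, hxX⟩ := Finset.mem_sdiff.1 hx
      rcases Finset.mem_insert.1 hx1 with rfl | hxv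
      · have h1 := hdeg x hvD hvX
        have h2 := Finset.le_card_sdiff X (N x)
        obtain ⟨w, hw⟩ : (N x \ X).Nonempty := Finset.card_pos.1 (by omega)
        obtain ⟨hw, hwX⟩ := Finset.mem_sdiff.1 hw
        have := hins w hw hwX w x (Finset.mem_sdiff.2 ⟨Finset.mem_insert_of_mem hw, hwX⟩) (by simp)
        omega
      · have := hins x hxv hxX v x hvH (by simp)
        omega)
  exact ⟨W, hWH.trans hHD, hW⟩

/-- Massed graphs are linked. -/
theorem Massed.linked (hs : 1 ≤ s) : ∀ (n : ℕ) (G : SimpleGraph V) (D X : Finset V), D.card = n →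
    X ⊆ D → X.card ≤ s → Massed (300 * s) G D X → Linked G D X := by
  intro n
  induction n using Nat.strong_induction_on with
  | _ n IH =>
  intro G D X hn hXD hXs hm
  have ih : ∀ (G' : SimpleGraph V) (D' X' : Finset V), D'.card < D.card → X' ⊆ D' →
      X'.card ≤ s → Massed (300 * s) G' D' X' → Linked G' D' X' :=
    fun G' D' X' h1 h2 h3 h4 => IH _ (hn ▸ h1) G' D' X' rfl h2 h3 h4
  by_cases hdel : ∃ v ∈ D, v ∉ X ∧ Dense (300 * s) G (D.erase v) X
  · obtain ⟨v, hv, hvX, h⟩ := hdel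
    exact linked_of_delete hXs hXD hm ih hv hvX h
  by_cases hcon : ∃ u ∈ D, ∃ v ∈ D, u ∉ X ∧ v ∉ X ∧ G.Adj u v ∧
      Dense (300 * s) (absorb G u v) (D.erase v) X
  · obtain ⟨u, hu, v, hv, -, hvX, huv, h⟩ := hcon
    exact linked_of_contract hXs hXD hm ih huv hu hv hvX h
  push Not at hdel hcon
  obtain ⟨W, hWD, hWs, hW⟩ := exists_universal_of_irreducible hs hXs hm.1 hdel hcon
  rcases exists_min_sep G D X W X.card with h | ⟨A, B, h1, h2, h3, h4, h5⟩
  · obtain ⟨g, hg, hp⟩ := menger G _ D X W rfl hXD hWD h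
    exact Linked.of_paths_subset hWD hg hp fun Y hY hYc => hW Y hY (hYc.trans hXs)
  · obtain ⟨g, hg, hp⟩ := exists_paths_of_min h1 h2 h3 h5
    refine linked_of_rigid hXs hm ih _ A B rfl h1 h2 h4.le ?_
      (Linked.of_paths_subset h3 hg hp fun Y hY hYc => hW Y hY (by omega))
    refine Finset.card_lt_card (h1.left_subset.ssubset_of_ne ?_)
    rintro rfl
    have := Finset.card_le_card (Finset.subset_inter hWD h3)
    omega

end Linkedness

section TopologicalClique

variable {V κ : Type*}

/-- `b` and `I` are the branch vertices and the interiors of the branch paths of a subdivided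
clique in `G`. -/
structure IsTK (G : SimpleGraph V) (b : κ → V) (I : Sym2 κ → Set V) : Prop where
  inj : Function.Injective b
  avoid : ∀ e i, b i ∉ I e
  disj : ∀ e e', e ≠ e' → Disjoint (I e) (I e')
  diag : ∀ i, I s(i, i) = ∅
  path : ∀ i j, i ≠ j → ∃ p : G.Walk (b i) (b j), p.IsPath ∧
    ∀ v, v ∈ p.support ↔ v = b i ∨ v = b j ∨ v ∈ I s(i, j)

/-- The vertices of a subdivided clique. -/
def tkVerts (b : κ → V) (I : Sym2 κ → Set V) : Set V := Set.range b ∪ ⋃ e, I e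

theorem exists_walk_of_reach {γ : Type*} {G : SimpleGraph V} {D : Finset V} {f : V → γ} {x y : V}
    (h : ReflTransGen (Step G D f) x y) :
    ∃ p : G.Walk x y, ∀ v ∈ p.support, (v = x ∨ v ∈ D) ∧ f v = f x := by
  induction h using ReflTransGen.head_induction_on with
  | refl => exact ⟨.nil, by simp⟩
  | @head a c hac _ ih =>
    obtain ⟨p, hp⟩ := ih
    refine ⟨.cons hac.1 p, fun v hv => ?_⟩
    rw [Walk.support_cons, List.mem_cons] at hv
    rcases hv with rfl | hv
    · exact ⟨Or.inl rfl, rfl⟩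
    · obtain ⟨h1, h2⟩ := hp v hv
      refine ⟨Or.inr ?_, h2.trans hac.2.2.2.symm⟩
      rcases h1 with rfl | h1
      exacts [hac.2.2.1, h1]

variable [DecidableEq V] {G : SimpleGraph V} {D : Finset V}

theorem IsSep.union_both {A B S : Finset V} (h : IsSep G (D \ S) A B) (hS : S ⊆ D) :
    IsSep G D (A ∪ S) (B ∪ S) := by
  refine ⟨?_, ?_⟩
  · ext w
    have h1 : w ∈ A ∪ B ↔ w ∈ D \ S := by rw [h.1]
    simp only [Finset.mem_union, Finset.mem_sdiff] at *
    have := @hS w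
    tauto
  · intro a ha b hb h1 h2
    simp only [Finset.mem_union, not_or] at *
    exact h.2 a (by tauto) b (by tauto) h1.1 h2.1

/-- Mader's theorem, with the order of the separations under control. -/
theorem exists_dense_unseparated (G : SimpleGraph V) (a L : ℕ) (U : Finset V) (hL : 4 * a ≤ L)
    (hU : L * U.card < rho G U ∅) :
    ∃ D : Finset V, 2 * a ≤ D.card ∧
      (∀ v ∈ D, ∀ N : Finset V, (∀ w, w ∈ N ↔ w ∈ D ∧ G.Adj v w) → L < 2 * N.card) ∧
      ∀ A B, IsSep G D A B → (A ∩ B).card ≤ a → A = D ∨ B = D := by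
  classical
  have hrho : ∀ D : Finset V, rho G D ∅ ≤ D.card * D.card := fun D => by
    rw [← Finset.card_product]
    exact Finset.card_filter_le _ _
  let P : Finset V → Prop := fun D => 2 * a ≤ D.card ∧ L * D.card < rho G D ∅ + L * a
  have hPU : P U := by
    have h1 := hrho U
    have h2 : L < U.card := by
      by_contra! h
      have := Nat.mul_le_mul_right U.card h
      omega
    exact ⟨by omega, by omega⟩
  obtain ⟨D, hPD, hmin⟩ : ∃ D, P D ∧ ∀ D', P D' → D.card ≤ D'.card := by
    have hex : ∃ n, ∃ D, P D ∧ D.card = n := ⟨_, U, hPU, rfl⟩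
    obtain ⟨D, hD, hc⟩ := Nat.find_spec hex
    exact ⟨D, hD, fun D' hD' => hc ▸ Nat.find_min' hex ⟨D', hD', rfl⟩⟩
  have hgt : 2 * a < D.card := by
    refine lt_of_le_of_ne hPD.1 fun h => ?_
    have h1 := hPD.2
    have h2 := hrho D
    rw [← h] at h1 h2
    have h3 : 2 * a * (2 * a) = 4 * a * a := by ring
    have h4 := Nat.mul_le_mul_right a hL
    have h5 : L * (2 * a) = L * a + L * a := by ring
    omega
  have hdeg : ∀ v ∈ D, ∀ N : Finset V, (∀ w, w ∈ N ↔ w ∈ D ∧ G.Adj v w) → L < 2 * N.card := by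
    intro v hv N hN
    by_contra! hle
    have h1 := rho_le_erase (X := ∅) hN
    have h2 := Finset.card_erase_add_one hv
    have h3 := hPD.2
    have := hmin (D.erase v) ⟨by omega, by
      rw [← h2, mul_add, mul_one] at h3
      omega⟩
    omega
  have hside : ∀ A B, IsSep G D A B → B ≠ D → 2 * a ≤ A.card := by
    intro A B hAB hB
    obtain ⟨v, hvD, hvB⟩ := Finset.not_subset.1 fun h => hB (subset_antisymm hAB.right_subset h)
    have hvA := (hAB.mem hvD).resolve_right hvB
    have h1 := hdeg v hvD (D.filter (G.Adj v)) (fun w => by simp)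
    have h2 : D.filter (G.Adj v) ⊆ A := by
      intro w hw
      obtain ⟨hwD, hvw⟩ := Finset.mem_filter.1 hw
      by_contra hwA
      exact hAB.2 v hvA w ((hAB.mem hwD).resolve_left hwA) hvB hwA hvw
    have := Finset.card_le_card h2
    omega
  refine ⟨D, hPD.1, hdeg, fun A B hAB hc => ?_⟩
  by_contra! hcon
  have hA := Finset.card_lt_card (hAB.left_subset.ssubset_of_ne hcon.1)
  have hB := Finset.card_lt_card (hAB.right_subset.ssubset_of_ne hcon.2)
  have hPA : ¬ P A := fun h => by have := hmin A h; omega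
  have hPB : ¬ P B := fun h => by have := hmin B h; omega
  have h1 : rho G A ∅ + L * a ≤ L * A.card := by
    by_contra! h; exact hPA ⟨hside A B hAB hcon.2, h⟩
  have h2 : rho G B ∅ + L * a ≤ L * B.card := by
    by_contra! h; exact hPB ⟨hside B A hAB.symm hcon.1, h⟩
  have h3 := rho_le_of_sep hAB ∅
  have h4 : rho G B (A ∩ B) ≤ rho G B ∅ := by
    unfold rho
    refine Finset.card_le_card fun p hp => ?_
    simp only [Finset.mem_filter, Finset.notMem_empty, false_and, not_false_iff, and_true] at hp ⊢
    exact ⟨hp.1, hp.2.1⟩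
  have h5 := hAB.card
  have h6 : L * (A ∩ B).card + L * D.card = L * A.card + L * B.card := by
    rw [← mul_add, ← mul_add, h5]
  have h7 := Nat.mul_le_mul_left L hc
  have h8 := hPD.2
  omega

omit [DecidableEq V] in
theorem exists_isTK_of_linked {b : κ → V} {x : κ × κ → V} {c : Sym2 κ → ℕ}
    (hc : Function.Injective c) {f : V → ℕ} (hb : Function.Injective b) (hbD : ∀ i, b i ∉ D)
    (hxD : ∀ p, x p ∈ D) (hbx : ∀ i j, G.Adj (b i) (x (i, j)))
    (hfx : ∀ i j, f (x (i, j)) = c s(i, j))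
    (hr : ∀ i j, i ≠ j → ReflTransGen (Step G D f) (x (i, j)) (x (j, i))) :
    ∃ I : Sym2 κ → Set V, IsTK G b I := by
  classical
  have key : ∀ e : Sym2 κ, ∃ J : Set V, (∀ v ∈ J, v ∈ D ∧ f v = c e) ∧
      (∀ i, e = s(i, i) → J = ∅) ∧ ∀ i j, i ≠ j → e = s(i, j) →
      ∃ p : G.Walk (b i) (b j), p.IsPath ∧ ∀ v, v ∈ p.support ↔ v = b i ∨ v = b j ∨ v ∈ J := by
    intro e
    induction e using Sym2.ind with
    | _ i j =>
    by_cases hij : i = j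
    · refine ⟨∅, by simp, by simp, fun i' j' h1 h2 => ?_⟩
      rw [Sym2.eq_iff] at h2
      exfalso
      rcases h2 with ⟨h3, h4⟩ | ⟨h3, h4⟩
      · exact h1 (by rw [← h3, ← h4, hij])
      · exact h1 (by rw [← h3, ← h4, hij])
    obtain ⟨q, hq⟩ := exists_walk_of_reach (hr i j hij)
    let q' : G.Walk (b i) (b j) := ((Walk.cons (hbx i j) q).concat (hbx j i).symm)
    have hq' : ∀ v ∈ q'.support, v = b i ∨ v = b j ∨ v ∈ D ∧ f v = c s(i, j) := by
      intro v hv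
      simp only [q', Walk.support_concat, Walk.support_cons, List.mem_append,
        List.mem_cons, List.not_mem_nil, or_false] at hv
      rcases hv with (rfl | hv) | rfl
      · exact Or.inl rfl
      · obtain ⟨h1, h2⟩ := hq v hv
        refine Or.inr (Or.inr ⟨?_, h2.trans (hfx i j)⟩)
        rcases h1 with rfl | h1
        exacts [hxD _, h1]
      · exact Or.inr (Or.inl rfl)
    have hsub := Walk.support_bypass_subset_support q'
    refine ⟨{v | v ∈ q'.bypass.support ∧ v ≠ b i ∧ v ≠ b j}, ?_, ?_, ?_⟩
    · rintro v ⟨h1, h2, h3⟩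
      have := hq' v (hsub h1)
      tauto
    · intro i' h
      rw [Sym2.eq_iff] at h
      exact absurd (by rcases h with h | h <;> exact h.1.trans h.2.symm) hij
    · intro i' j' _ h2
      have hmem : ∀ v, v ∈ q'.bypass.support ↔ v = b i ∨ v = b j ∨
          v ∈ {v | v ∈ q'.bypass.support ∧ v ≠ b i ∧ v ≠ b j} := by
        intro v
        constructor
        · intro h
          by_cases h3 : v = b i
          · exact Or.inl h3
          · by_cases h4 : v = b j
            · exact Or.inr (Or.inl h4)
            · exact Or.inr (Or.inr ⟨h, h3, h4⟩)
        · rintro (rfl | rfl | h)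
          exacts [Walk.start_mem_support _, Walk.end_mem_support _, h.1]
      rw [Sym2.eq_iff] at h2
      rcases h2 with ⟨rfl, rfl⟩ | ⟨rfl, rfl⟩
      · exact ⟨q'.bypass, q'.bypass_isPath, hmem⟩
      · refine ⟨q'.bypass.reverse, q'.bypass_isPath.reverse, fun v => ?_⟩
        rw [Walk.support_reverse, List.mem_reverse, hmem v]
        tauto
  choose J h1 h2 h3 using key
  refine ⟨J, hb, fun e i h => hbD i (h1 e _ h).1, fun e e' hne => ?_, fun i => h2 _ i rfl,
    fun i j hij => h3 _ i j hij rfl⟩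
  refine Set.disjoint_left.2 fun v hv hv' => hne (hc ?_)
  rw [← (h1 e v hv).2, (h1 e' v hv').2]

theorem exists_isTK [Fintype V] [Fintype κ] [Nonempty κ]
    (h : 1000 * Fintype.card κ ^ 2 * Fintype.card V < rho G Finset.univ ∅) :
    ∃ (b : κ → V) (I : Sym2 κ → Set V), IsTK G b I := by
  classical
  set t := Fintype.card κ with ht
  have ht1 : 1 ≤ t := Fintype.card_pos
  have htt : t ≤ t ^ 2 := by nlinarith
  obtain ⟨D, hDc, hdeg, hsep⟩ := exists_dense_unseparated G (t ^ 2 + t) (1000 * t ^ 2) Finset.univ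
    (by omega) h
  obtain ⟨b⟩ : Nonempty (κ ↪ D) := Function.Embedding.nonempty_of_card_le (by
    rw [Fintype.card_coe]; omega)
  set S : Finset V := Finset.univ.image fun i => (b i : V) with hS
  have hSc : S.card ≤ t := Finset.card_image_le
  have hSD : S ⊆ D := by
    intro v hv
    obtain ⟨i, -, rfl⟩ := Finset.mem_image.1 hv
    exact (b i).2
  have hdeg' : ∀ v ∈ D, 499 * t ^ 2 < ((D \ S).filter (G.Adj v)).card := by
    intro v hv
    have h1 := hdeg v hv (D.filter (G.Adj v)) (fun w => by simp)
    have h2 : (D \ S).filter (G.Adj v) = D.filter (G.Adj v) \ S := by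
      ext w; simp only [Finset.mem_filter, Finset.mem_sdiff]; tauto
    have h3 := Finset.le_card_sdiff S (D.filter (G.Adj v))
    rw [h2]
    omega
  obtain ⟨x, hxinj, hx⟩ := (Finset.all_card_le_biUnion_card_iff_exists_injective
    (fun p : κ × κ => (D \ S).filter (G.Adj (b p.1)))).1 (by
      intro P
      rcases P.eq_empty_or_nonempty with rfl | ⟨p, hp⟩
      · simp
      · have h1 := Finset.card_le_univ P
        rw [Fintype.card_prod, ← ht, ← pow_two] at h1
        have h2 := hdeg' _ (b p.1).2
        have h3 := Finset.card_le_card (Finset.subset_biUnion_of_mem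
          (fun p : κ × κ => (D \ S).filter (G.Adj (b p.1))) hp)
        omega)
  set X : Finset V := Finset.univ.image x with hX
  have hXc : X.card = t ^ 2 := by
    rw [hX, Finset.card_image_of_injective _ hxinj, Finset.card_univ, Fintype.card_prod, pow_two]
  have hXD : X ⊆ D \ S := by
    intro v hv
    obtain ⟨p, -, rfl⟩ := Finset.mem_image.1 hv
    exact (Finset.mem_filter.1 (hx p)).1
  have hm : Massed (300 * t ^ 2) G (D \ S) X := by
    constructor
    · have h1 := sum_degree_le_rho (G := G) (D := D \ S) (X := X)
        (N := fun v => (D \ S).filter (G.Adj v)) (fun v w => by simp)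
      have h2 := Finset.card_nsmul_le_sum ((D \ S) \ X)
        (fun v => ((D \ S).filter (G.Adj v)).card) (300 * t ^ 2 + 1) (by
          intro v hv
          have := hdeg' v (Finset.mem_sdiff.1 (Finset.mem_sdiff.1 hv).1).1
          omega)
      have h3 : 0 < ((D \ S) \ X).card := by
        have h4 := Finset.le_card_sdiff X (D \ S)
        have h5 := Finset.le_card_sdiff S D
        omega
      unfold Dense
      rw [smul_eq_mul, mul_add, mul_one, mul_comm] at h2
      omega
    · intro A B hAB hXA hc hd
      have hsep' := hAB.union_both hSD
      have hcard : ((A ∪ S) ∩ (B ∪ S)).card ≤ t ^ 2 + t := by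
        rw [← Finset.inter_union_distrib_right]
        have := Finset.card_union_le (A ∩ B) S
        omega
      have hS' : ∀ C ⊆ D \ S, C ∪ S = D → D \ S ⊆ C := by
        intro C _ hC v hv
        rw [← hC] at hv
        simp only [Finset.mem_sdiff, Finset.mem_union] at hv
        tauto
      rcases hsep _ _ hsep' hcard with h | h
      · have := hS' A hAB.left_subset h
        refine not_dense_of_subset ?_ hd
        exact Finset.subset_inter (hAB.right_subset.trans this) subset_rfl
      · have := hS' B hAB.right_subset h
        have := Finset.card_le_card (Finset.subset_inter hXA (hXD.trans this))
        omega
  obtain ⟨c, hc⟩ : ∃ c : Sym2 κ → ℕ, Function.Injective c := Countable.exists_injective_nat _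
  let g : V → ℕ := fun v => if h : ∃ p, x p = v then c s(h.choose.1, h.choose.2) else 0
  have hg : ∀ p, g (x p) = c s(p.1, p.2) := by
    intro p
    have hex : ∃ p', x p' = x p := ⟨p, rfl⟩
    have h1 : hex.choose = p := hxinj hex.choose_spec
    simp only [g, dif_pos hex, h1]
  obtain ⟨f, hf, hf'⟩ := hm.linked (by nlinarith) _ G (D \ S) X rfl hXD hXc.le g
  have hxX : ∀ p, x p ∈ X := fun p => Finset.mem_image_of_mem _ (Finset.mem_univ p)
  obtain ⟨I, hI⟩ := exists_isTK_of_linked (G := G) (D := D \ S) (b := fun i => (b i : V)) (x := x)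
    hc (f := f) (fun i j hij => b.injective (Subtype.ext hij))
    (fun i hi => (Finset.mem_sdiff.1 hi).2 (Finset.mem_image_of_mem _ (Finset.mem_univ i)))
    (fun p => hXD (hxX p)) (fun i j => (Finset.mem_filter.1 (hx (i, j))).2)
    (fun i j => by rw [hf _ (hxX _), hg]) (fun i j _ => hf' _ (hxX _) _ (hxX _) (by
      rw [hg, hg]; exact congrArg c Sym2.eq_swap))
  exact ⟨_, I, hI⟩

omit [DecidableEq V] in
theorem IsTK.comap {κ' : Type*} {b : κ → V} {I : Sym2 κ → Set V} (h : IsTK G b I) {ι : κ' → κ}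
    (hι : Function.Injective ι) : IsTK G (b ∘ ι) (I ∘ Sym2.map ι) where
  inj := h.inj.comp hι
  avoid _ _ := h.avoid _ _
  disj _ _ hne := h.disj _ _ fun h => hne (Sym2.map.injective hι h)
  diag _ := h.diag _
  path _ _ hij := h.path _ _ fun h => hij (hι h)

end TopologicalClique

section Paths

variable {V : Type*} {G : SimpleGraph V}

theorem isPath_append_iff {u v w : V} {p : G.Walk u v} {q : G.Walk v w} :
    (p.append q).IsPath ↔ p.IsPath ∧ q.IsPath ∧ ∀ x ∈ p.support, x ∈ q.support → x = v := by
  constructor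
  · intro h
    refine ⟨h.of_append_left, h.of_append_right, fun x hx hx' => ?_⟩
    by_contra hxv
    exact h.ne_of_mem_support_of_append hxv hx hx' rfl
  · rintro ⟨h1, h2, h3⟩
    rw [Walk.isPath_def, Walk.support_append, List.nodup_append]
    have h4 := h2.support_nodup
    rw [← Walk.cons_tail_support, List.nodup_cons] at h4
    refine ⟨h1.support_nodup, h4.2, fun x hx y hy hxy => ?_⟩
    subst hxy
    have := h3 x hx (List.mem_of_mem_tail hy)
    subst this
    exact h4.1 hy

theorem mem_support_append {u v w x : V} {p : G.Walk u v} {q : G.Walk v w} :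
    x ∈ (p.append q).support ↔ x ∈ p.support ∨ x ∈ q.support :=
  Walk.mem_support_append_iff p q

theorem mem_edges_append {u v w : V} {p : G.Walk u v} {q : G.Walk v w} {e : Sym2 V} :
    e ∈ (p.append q).edges ↔ e ∈ p.edges ∨ e ∈ q.edges := by
  rw [Walk.edges_append, List.mem_append]

theorem exists_coe_walk {A : G.Subgraph} {u v : V} (p : G.Walk u v)
    (h : ∀ e ∈ p.edges, e ∈ A.edgeSet) (hu : u ∈ A.verts) (hv : v ∈ A.verts) :
    ∃ q : A.coe.Walk ⟨u, hu⟩ ⟨v, hv⟩, q.support.map Subtype.val = p.support ∧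
      q.edges.map (Sym2.map Subtype.val) = p.edges := by
  induction p with
  | nil => exact ⟨.nil, by simp⟩
  | @cons a b c hab p ih =>
    have hA : A.Adj a b := h s(a, b) (by simp)
    obtain ⟨q, h1, h2⟩ := ih (fun e he => h e (by simp [he])) hA.snd_mem hv
    have hA' : A.coe.Adj ⟨a, hu⟩ ⟨b, hA.snd_mem⟩ := hA
    exact ⟨.cons hA' q, by simp [h1], by simp [h2]⟩

/-- A system of internally disjoint paths spans a subdivision. -/
theorem exists_isSubdivision_of_paths {α : Type*} {H : SimpleGraph α} {f : α → V}
    (hf : Function.Injective f) {D : Sym2 α → Set V} (havoid : ∀ e i, f i ∉ D e)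
    (hdisj : ∀ e e', e ≠ e' → Disjoint (D e) (D e')) {Φ : Sym2 α → Set (Sym2 V) → Prop}
    (hp : ∀ x y, H.Adj x y → ∃ p : G.Walk (f x) (f y), p.IsPath ∧
      (∀ v ∈ p.support, v = f x ∨ v = f y ∨ v ∈ D s(x, y)) ∧ Φ s(x, y) {e | e ∈ p.edges}) :
    ∃ A : G.Subgraph, IsSubdivision H A.coe ∧
      (∀ e ∈ H.edgeSet, ∃ E, Φ e E ∧ E ⊆ A.edgeSet) ∧
      ∀ e ∈ A.edgeSet, ∃ e' ∈ H.edgeSet, ∃ E, Φ e' E ∧ e ∈ E := by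
  classical
  let _ : LinearOrder α := linearOrderOfSTO (WellOrderingRel (α := α))
  choose p hpp hps hpe using hp
  let A : G.Subgraph :=
    { verts := {v | v ∈ Set.range f ∨ ∃ x y, ∃ h : H.Adj x y, x < y ∧ v ∈ (p x y h).support}
      Adj := fun v w => ∃ x y, ∃ h : H.Adj x y, x < y ∧ s(v, w) ∈ (p x y h).edges
      adj_sub := by
        rintro v w ⟨x, y, h, -, he⟩
        exact (p x y h).adj_of_mem_edges he
      edge_vert := by
        rintro v w ⟨x, y, h, hxy, he⟩
        exact Or.inr ⟨x, y, h, hxy, (p x y h).fst_mem_support_of_mem_edges he⟩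
      symm := ⟨by
        rintro v w ⟨x, y, h, hxy, he⟩
        exact ⟨x, y, h, hxy, by rwa [Sym2.eq_swap]⟩⟩ }
  have hAe : ∀ e, e ∈ A.edgeSet ↔ ∃ x y, ∃ h : H.Adj x y, x < y ∧ e ∈ (p x y h).edges := by
    intro e
    induction e using Sym2.ind with
    | _ v w => exact Iff.rfl
  have hfA : ∀ x, f x ∈ A.verts := fun x => Or.inl ⟨x, rfl⟩
  have hq : ∀ x y (h : H.Adj x y), x < y → ∃ q : A.coe.Walk ⟨f x, hfA x⟩ ⟨f y, hfA y⟩,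
      q.support.map Subtype.val = (p x y h).support ∧
      q.edges.map (Sym2.map Subtype.val) = (p x y h).edges := fun x y h hxy =>
    exists_coe_walk (p x y h) (fun e he => (hAe e).2 ⟨x, y, h, hxy, he⟩) _ _
  choose q hqs hqe using hq
  have hqm : ∀ x y (h : H.Adj x y) (hxy : x < y) v,
      v ∈ (q x y h hxy).support ↔ (v : V) ∈ (p x y h).support := by
    intro x y h hxy v
    rw [← hqs x y h hxy, List.mem_map]
    exact ⟨fun hv => ⟨v, hv, rfl⟩, fun ⟨w, hw, hwv⟩ => Subtype.ext hwv ▸ hw⟩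
  have hqme : ∀ x y (h : H.Adj x y) (hxy : x < y) e,
      e ∈ (q x y h hxy).edges ↔ Sym2.map Subtype.val e ∈ (p x y h).edges := by
    intro x y h hxy e
    rw [← hqe x y h hxy, List.mem_map]
    exact ⟨fun hv => ⟨e, hv, rfl⟩,
      fun ⟨w, hw, hwv⟩ => Sym2.map.injective Subtype.val_injective hwv ▸ hw⟩
  let P : ∀ ⦃x y⦄, H.Adj x y → A.coe.Walk ⟨f x, hfA x⟩ ⟨f y, hfA y⟩ := fun x y h =>
    if hxy : x < y then q x y h hxy
    else (q y x h.symm (lt_of_le_of_ne (not_lt.1 hxy) h.ne')).reverse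
  have hP : ∀ ⦃x y⦄ (h : H.Adj x y) (hxy : x < y), P h = q x y h hxy := fun x y h hxy => by
    simp only [P, dif_pos hxy]
  have hP' : ∀ ⦃x y⦄ (h : H.Adj x y) (hxy : x < y), P h.symm = (q x y h hxy).reverse :=
    fun x y h hxy => by simp only [P, dif_neg hxy.asymm]
  have hcases : ∀ {Ψ : ∀ x y, H.Adj x y → Prop}, (∀ x y h, x < y → Ψ x y h) →
      (∀ x y (h : H.Adj x y), x < y → Ψ y x h.symm) →
      ∀ ⦃x y⦄ (h : H.Adj x y), Ψ x y h := by
    intro Ψ h1 h2 x y h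
    rcases lt_or_gt_of_ne h.ne with hxy | hxy
    exacts [h1 x y h hxy, h2 y x h.symm hxy]
  have hPs : ∀ ⦃x y⦄ (h : H.Adj x y), ∀ v ∈ (P h).support,
      (v : V) = f x ∨ (v : V) = f y ∨ (v : V) ∈ D s(x, y) := by
    refine hcases (fun x y h hxy v hv => ?_) fun x y h hxy v hv => ?_
    · rw [hP h hxy, hqm] at hv
      exact hps x y h _ hv
    · rw [hP' h hxy, Walk.support_reverse, List.mem_reverse, hqm] at hv
      have := hps x y h _ hv
      rw [Sym2.eq_swap]
      tauto
  have hext : ∀ ⦃x y⦄ (h : H.Adj x y), x < y → ∀ e ∈ (p x y h).edges, e ∈ A.edgeSet :=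
    fun x y h hxy e he => (hAe e).2 ⟨x, y, h, hxy, he⟩
  refine ⟨A, ⟨fun x => ⟨f x, hfA x⟩, P, fun x y hxy => hf (congrArg Subtype.val hxy), ?_, ?_, ?_,
    ?_, ?_, ?_⟩, ?_, ?_⟩
  · have h1 : ∀ x y h (hxy : x < y), (q x y h hxy).IsPath := by
      intro x y h hxy
      rw [Walk.isPath_def]
      refine List.Nodup.of_map Subtype.val ?_
      rw [hqs]
      exact (hpp x y h).support_nodup
    refine hcases (fun x y h hxy => ?_) fun x y h hxy => ?_
    · rw [hP h hxy]; exact h1 x y h hxy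
    · rw [hP' h hxy]; exact (h1 x y h hxy).reverse
  · refine hcases (fun x y h hxy => ?_) fun x y h hxy => ?_
    · rw [hP h hxy, hP' h hxy]
    · rw [hP' h hxy, hP h hxy, Walk.reverse_reverse]
  · rintro x y h v hv ⟨z, rfl⟩
    rcases hPs h _ hv with h1 | h1 | h1
    · exact Or.inl (Subtype.ext h1)
    · exact Or.inr (Subtype.ext h1)
    · exact absurd h1 (havoid _ _)
  · intro x y x' y' h h' hne v hv hv'
    have h1 := hPs h v hv
    have h2 := hPs h' v hv'
    have h3 : ∀ z, (v : V) = f z → v ∈ Set.range fun x => (⟨f x, hfA x⟩ : A.verts) :=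
      fun z hz => ⟨z, Subtype.ext hz.symm⟩
    rcases h1 with h1 | h1 | h1
    · exact h3 _ h1
    · exact h3 _ h1
    · rcases h2 with h2 | h2 | h2
      · exact h3 _ h2
      · exact h3 _ h2
      · exact absurd h2 (Set.disjoint_left.1 (hdisj _ _ hne) h1)
  · rintro ⟨v, ⟨x, rfl⟩ | ⟨x, y, h, hxy, hv⟩⟩
    · exact Or.inl ⟨x, rfl⟩
    · refine Or.inr ⟨x, y, h, ?_⟩
      rw [hP h hxy, hqm]
      exact hv
  · intro e he
    have h1 : Sym2.map Subtype.val e ∈ A.edgeSet := by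
      induction e using Sym2.ind with
      | _ v w => exact he
    obtain ⟨x, y, h, hxy, h2⟩ := (hAe _).1 h1
    refine ⟨x, y, h, ?_⟩
    rw [hP h hxy, hqme]
    exact h2
  · intro e
    induction e using Sym2.ind with
    | _ x y =>
    intro h
    rcases lt_or_gt_of_ne (H.ne_of_adj h) with hxy | hxy
    · exact ⟨_, hpe x y h, hext h hxy⟩
    · exact ⟨_, Sym2.eq_swap ▸ hpe y x h.symm, hext h.symm hxy⟩
  · intro e he
    obtain ⟨x, y, h, hxy, h1⟩ := (hAe e).1 he
    exact ⟨s(x, y), h, _, hpe x y h, h1⟩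

end Paths

section Ear

variable {V κ : Type*} {G : SimpleGraph V} {b : κ → V} {I : Sym2 κ → Set V}

theorem IsTK.exists_leg (h : IsTK G b I) {u : V} (hu : u ∈ tkVerts b I) :
    ∃ i j, ∀ k, k = i ∨ k = j → ∃ p : G.Walk (b k) u, p.IsPath ∧
      ∀ v ∈ p.support, v = b k ∨ v ∈ I s(i, j) := by
  rcases hu with ⟨i, rfl⟩ | hu
  · exact ⟨i, i, fun k hk => ⟨Walk.nil.copy (by rw [or_self_iff.1 hk]) rfl, by
      obtain rfl := or_self_iff.1 hk
      simp⟩⟩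
  obtain ⟨e, he⟩ := Set.mem_iUnion.1 hu
  induction e using Sym2.ind with
  | _ i j =>
  refine ⟨i, j, ?_⟩
  have hij : i ≠ j := by
    rintro rfl
    rw [h.diag] at he
    exact he
  have key : ∀ i j, i ≠ j → u ∈ I s(i, j) → ∃ p : G.Walk (b i) u, p.IsPath ∧
      ∀ v ∈ p.support, v = b i ∨ v ∈ I s(i, j) := by
    intro i j hij hu
    obtain ⟨p, hp, hps⟩ := h.path i j hij
    obtain ⟨q, r, rfl⟩ := Walk.mem_support_iff_exists_append.1
      ((hps u).2 (Or.inr (Or.inr hu)))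
    obtain ⟨hq, -, hqr⟩ := isPath_append_iff.1 hp
    refine ⟨q, hq, fun v hv => ?_⟩
    rcases (hps v).1 (mem_support_append.2 (Or.inl hv)) with h1 | rfl | h1
    · exact Or.inl h1
    · have := hqr _ hv (Walk.end_mem_support _)
      exact absurd (this ▸ hu) (h.avoid _ _)
    · exact Or.inr h1
  rintro k (rfl | rfl)
  · exact key _ _ hij he
  · rw [Sym2.eq_swap] at he ⊢
    exact key _ _ hij.symm he

theorem IsTK.exists_legs (h : IsTK G b I) {u u' : V} (hu : u ∈ tkVerts b I)
    (hu' : u' ∈ tkVerts b I) (hne : u ≠ u') :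
    ∃ (p q : κ) (E : Finset κ) (L : G.Walk (b p) u) (L' : G.Walk (b q) u'),
      p ≠ q ∧ E.card ≤ 4 ∧ p ∈ E ∧ q ∈ E ∧ L.IsPath ∧ L'.IsPath ∧
      (∀ v ∈ L.support, v = b p ∨ ∃ e, (∀ i ∈ e, i ∈ E) ∧ v ∈ I e) ∧
      (∀ v ∈ L'.support, v = b q ∨ ∃ e, (∀ i ∈ e, i ∈ E) ∧ v ∈ I e) ∧
      ∀ v ∈ L.support, v ∉ L'.support := by
  classical
  obtain ⟨i, j, hij⟩ := h.exists_leg hu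
  obtain ⟨i', j', hij'⟩ := h.exists_leg hu'
  by_cases heq : s(i, j) = s(i', j')
  · rw [← heq] at hij'
    obtain ⟨l, -, hl⟩ := hij i (Or.inl rfl)
    have hul := hl u (Walk.end_mem_support _)
    obtain ⟨k, hk⟩ : ∃ k, k = i ∧ (k = i' ∨ k = j') := by
      rcases Sym2.eq_iff.1 heq with ⟨h1, h2⟩ | ⟨h1, h2⟩ <;> exact ⟨i, rfl, by simp [h1]⟩
    obtain ⟨l', -, hl'⟩ := hij' i (hk.1 ▸ hk.2)
    have hul' := hl' u' (Walk.end_mem_support _)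
    by_cases hd : i = j
    · subst hd
      rw [h.diag] at hul hul'
      simp only [Set.mem_empty_iff_false, or_false] at hul hul'
      exact absurd (hul.trans hul'.symm) hne
    obtain ⟨P, hP, hPs⟩ := h.path i j hd
    have hmem : ∀ v, v = b i ∨ v ∈ I s(i, j) → v ∈ P.support := fun v hv => (hPs v).2 (by tauto)
    have hE : ∀ v, v ∈ I s(i, j) → ∃ e, (∀ k ∈ e, k ∈ ({i, j} : Finset κ)) ∧ v ∈ I e :=
      fun v hv => ⟨_, by simp, hv⟩
    have hcard : ({i, j} : Finset κ).card ≤ 4 := Finset.card_le_two.trans (by omega)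
    have key : ∀ {x y : V}, x ≠ y → ∀ (A : G.Walk (b i) x)
        (B : G.Walk x y) (C : G.Walk y (b j)), P = A.append (B.append C) →
        A.IsPath ∧ C.reverse.IsPath ∧
        (∀ v ∈ A.support, v = b i ∨ ∃ e, (∀ k ∈ e, k ∈ ({i, j} : Finset κ)) ∧ v ∈ I e) ∧
        (∀ v ∈ C.reverse.support,
          v = b j ∨ ∃ e, (∀ k ∈ e, k ∈ ({i, j} : Finset κ)) ∧ v ∈ I e) ∧
        ∀ v ∈ A.support, v ∉ C.reverse.support := by
      rintro x y hxy A B C rfl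
      obtain ⟨hA, hBC, h1⟩ := isPath_append_iff.1 hP
      obtain ⟨hB, hC, h2⟩ := isPath_append_iff.1 hBC
      have hdj : ∀ v ∈ A.support, v ∉ C.support := by
        intro v hv hv'
        have h3 := h1 v hv (mem_support_append.2 (Or.inr hv'))
        subst h3
        exact hxy (h2 _ (Walk.start_mem_support _) hv')
      refine ⟨hA, hC.reverse, fun v hv => ?_, fun v hv => ?_, fun v hv hv' => ?_⟩
      · rcases (hPs v).1 (mem_support_append.2 (Or.inl hv)) with h3 | rfl | h3
        · exact Or.inl h3
        · exact absurd (Walk.end_mem_support _) (hdj _ hv)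
        · exact Or.inr (hE v h3)
      · rw [Walk.support_reverse, List.mem_reverse] at hv
        rcases (hPs v).1 (mem_support_append.2 (Or.inr
          (mem_support_append.2 (Or.inr hv)))) with rfl | h3 | h3
        · exact absurd hv (hdj _ (Walk.start_mem_support _))
        · exact Or.inl h3
        · exact Or.inr (hE v h3)
      · rw [Walk.support_reverse, List.mem_reverse] at hv'
        exact hdj v hv hv'
    obtain ⟨A, R, rfl⟩ := Walk.mem_support_iff_exists_append.1 (hmem u hul)
    rcases mem_support_append.1 (hmem u' hul') with h1 | h1
    · obtain ⟨A', B, rfl⟩ := Walk.mem_support_iff_exists_append.1 h1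
      obtain ⟨h2, h3, h4, h5, h6⟩ := key hne.symm A' B R (Walk.append_assoc _ _ _).symm
      exact ⟨j, i, {i, j}, R.reverse, A', Ne.symm hd, hcard, by simp, by simp, h3, h2, h5, h4,
        fun v hv hv' => h6 v hv' hv⟩
    · obtain ⟨B, C, rfl⟩ := Walk.mem_support_iff_exists_append.1 h1
      obtain ⟨h2, h3, h4, h5, h6⟩ := key hne A B C rfl
      exact ⟨i, j, {i, j}, A, C.reverse, hd, hcard, by simp, by simp, h2, h3, h4, h5, h6⟩
  · obtain ⟨p, q, hp, hq, hpq⟩ : ∃ p q, (p = i ∨ p = j) ∧ (q = i' ∨ q = j') ∧ p ≠ q := by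
      by_contra! hcon
      have h1 := hcon i i' (by simp) (by simp)
      have h2 := hcon i j' (by simp) (by simp)
      have h3 := hcon j i' (by simp) (by simp)
      exact heq (by rw [← h1, ← h2, h3, h1])
    obtain ⟨L, hL, hLs⟩ := hij p hp
    obtain ⟨L', hL', hLs'⟩ := hij' q hq
    refine ⟨p, q, {i, j, i', j'}, L, L', hpq, Finset.card_le_four, by simp; tauto,
      by simp; tauto, hL, hL', fun v hv => ?_, fun v hv => ?_, fun v hv hv' => ?_⟩
    · exact (hLs v hv).imp_right fun h1 => ⟨_, by simp, h1⟩
    · exact (hLs' v hv).imp_right fun h1 => ⟨_, by simp, h1⟩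
    · rcases hLs v hv with rfl | h1
      · rcases hLs' _ hv' with h2 | h2
        · exact hpq (h.inj h2)
        · exact h.avoid _ _ h2
      · rcases hLs' _ hv' with rfl | h2
        · exact h.avoid _ _ h1
        · exact Set.disjoint_left.1 (h.disj _ _ heq) h1 h2

/-- An ear attached to a subdivided clique lies in a subdivision of `H`. -/
theorem IsTK.exists_isSubdivision_of_ear {α : Type*} [Fintype α] [Fintype κ]
    (h : IsTK G b I) {H : SimpleGraph α} (hH : H.edgeSet.Nonempty)
    (hcard : Fintype.card α + 2 ≤ Fintype.card κ) {u u' : V} (hu : u ∈ tkVerts b I)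
    (hu' : u' ∈ tkVerts b I) (hne : u ≠ u') {Q : G.Walk u u'} (hQ : Q.IsPath)
    (hQW : ∀ v ∈ Q.support, v ∈ tkVerts b I → v = u ∨ v = u') :
    ∃ A : G.Subgraph, IsSubdivision H A.coe ∧ (∀ e ∈ Q.edges, e ∈ A.edgeSet) ∧
      ∀ e ∈ A.edgeSet, e ∈ Q.edges ∨ ∀ v ∈ e, v ∈ tkVerts b I := by
  classical
  obtain ⟨p, q, E, L, L', hpq, hE, hpE, hqE, hL, hL', hLs, hLs', hLL⟩ := h.exists_legs hu hu' hne
  obtain ⟨e₀, he₀⟩ := hH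
  induction e₀ using Sym2.ind with
  | _ x₀ y₀ =>
  have hxy : x₀ ≠ y₀ := H.ne_of_adj he₀
  obtain ⟨g⟩ : Nonempty ((({x₀, y₀} : Finset α)ᶜ : Finset α) ↪ (Eᶜ : Finset κ)) := by
    refine Function.Embedding.nonempty_of_card_le ?_
    rw [Fintype.card_coe, Fintype.card_coe, Finset.card_compl, Finset.card_compl,
      Finset.card_pair hxy]
    omega
  let f : α → κ := fun x => if h1 : x ∈ (({x₀, y₀} : Finset α)ᶜ : Finset α) then g ⟨x, h1⟩
    else if x = x₀ then p else q
  have hfx : f x₀ = p := by simp [f]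
  have hfy : f y₀ = q := by simp [f, hxy.symm]
  have hfo : ∀ x, x ≠ x₀ → x ≠ y₀ → f x ∉ E := by
    intro x h1 h2
    have h3 : x ∈ (({x₀, y₀} : Finset α)ᶜ : Finset α) := by simp [h1, h2]
    simp only [f, dif_pos h3]
    exact Finset.mem_compl.1 (g ⟨x, h3⟩).2
  have hf : Function.Injective f := by
    intro x y hf
    by_cases hx : x ∈ (({x₀, y₀} : Finset α)ᶜ : Finset α)
    · by_cases hy : y ∈ (({x₀, y₀} : Finset α)ᶜ : Finset α)
      · simp only [f, dif_pos hx, dif_pos hy] at hf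
        exact congrArg Subtype.val (g.injective (Subtype.ext hf))
      · have h1 := hfo x (by simp at hx; tauto) (by simp at hx; tauto)
        have h2 : y = x₀ ∨ y = y₀ := by simp at hy; tauto
        rcases h2 with rfl | rfl
        · rw [hf, hfx] at h1; exact absurd hpE h1
        · rw [hf, hfy] at h1; exact absurd hqE h1
    · have h2 : x = x₀ ∨ x = y₀ := by simp at hx; tauto
      by_cases hy : y = x₀ ∨ y = y₀
      · rcases h2 with rfl | rfl <;> rcases hy with rfl | rfl
        · rfl
        · exact absurd (hfx.symm.trans (hf.trans hfy)) hpq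
        · exact absurd (hfx.symm.trans (hf.symm.trans hfy)) hpq
        · rfl
      · have h1 := hfo y (by tauto) (by tauto)
        rcases h2 with rfl | rfl
        · rw [← hf, hfx] at h1; exact absurd hpE h1
        · rw [← hf, hfy] at h1; exact absurd hqE h1
  set R : Set V := {v | v ∈ L.support ∨ v ∈ Q.support ∨ v ∈ L'.support} with hR
  have hRW : ∀ v ∈ R, v ∈ tkVerts b I →
      v = b p ∨ v = b q ∨ ∃ e, (∀ i ∈ e, i ∈ E) ∧ v ∈ I e := by
    rintro v (hv | hv | hv) hvW
    · have := hLs v hv; tauto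
    · rcases hQW v hv hvW with rfl | rfl
      · have := hLs v (Walk.end_mem_support _); tauto
      · have := hLs' v (Walk.end_mem_support _); tauto
    · have := hLs' v hv; tauto
  let D : Sym2 α → Set V := fun e => if e = s(x₀, y₀) then {v | v ∈ R ∧ v ≠ b p ∧ v ≠ b q}
    else I (e.map f)
  have hbW : ∀ i, b i ∈ tkVerts b I := fun i => Or.inl ⟨i, rfl⟩
  have hIW : ∀ e, I e ⊆ tkVerts b I := fun e v hv => Or.inr (Set.mem_iUnion.2 ⟨e, hv⟩)
  have hdis : ∀ e, e ≠ s(x₀, y₀) → ∀ v ∈ I (e.map f), v ∉ R := by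
    intro e
    induction e using Sym2.ind with
    | _ x y =>
    intro hexy v hv hvR
    rw [Sym2.map_mk] at hv
    rcases hRW v hvR (hIW _ hv) with rfl | rfl | ⟨e', he', hve'⟩
    · exact h.avoid _ _ hv
    · exact h.avoid _ _ hv
    · by_cases hd : s(f x, f y) = e'
      · subst hd
        have h1 : x = x₀ ∨ x = y₀ := by
          by_contra! hc; exact hfo x hc.1 hc.2 (he' _ (Sym2.mem_mk_left _ _))
        have h2 : y = x₀ ∨ y = y₀ := by
          by_contra! hc; exact hfo y hc.1 hc.2 (he' _ (Sym2.mem_mk_right _ _))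
        rcases h1 with rfl | rfl <;> rcases h2 with rfl | rfl
        · rw [h.diag] at hv; exact hv
        · exact hexy rfl
        · exact hexy Sym2.eq_swap
        · rw [h.diag] at hv; exact hv
      · exact Set.disjoint_left.1 (h.disj _ _ hd) hv hve'
  have hfbR : ∀ x, b (f x) ∈ R → b (f x) = b p ∨ b (f x) = b q := by
    intro x hx
    rcases hRW _ hx (hbW _) with h1 | h1 | ⟨e, -, h1⟩
    · exact Or.inl h1
    · exact Or.inr h1
    · exact absurd h1 (h.avoid _ _)
  have hpath : (L.append (Q.append L'.reverse)).IsPath := by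
    refine isPath_append_iff.2 ⟨hL, isPath_append_iff.2 ⟨hQ, hL'.reverse, ?_⟩, ?_⟩
    · intro v hv hv'
      rw [Walk.support_reverse, List.mem_reverse] at hv'
      have hvW : v ∈ tkVerts b I := by
        rcases hLs' v hv' with rfl | ⟨e, -, h1⟩
        exacts [hbW _, hIW _ h1]
      rcases hQW v hv hvW with rfl | rfl
      · exact absurd hv' (hLL _ (Walk.end_mem_support _))
      · rfl
    · intro v hv hv'
      rw [mem_support_append, Walk.support_reverse, List.mem_reverse] at hv'
      rcases hv' with hv' | hv'
      · have hvW : v ∈ tkVerts b I := by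
          rcases hLs v hv with rfl | ⟨e, -, h1⟩
          exacts [hbW _, hIW _ h1]
        rcases hQW v hv' hvW with rfl | rfl
        · rfl
        · exact absurd (Walk.end_mem_support _) (hLL _ hv)
      · exact absurd hv' (hLL v hv)
  have hLW : ∀ v, v ∈ L.support ∨ v ∈ L'.support → v ∈ tkVerts b I := by
    rintro v (hv | hv)
    · rcases hLs v hv with rfl | ⟨e, -, h1⟩
      exacts [hbW _, hIW _ h1]
    · rcases hLs' v hv with rfl | ⟨e, -, h1⟩
      exacts [hbW _, hIW _ h1]
  have hed : ∀ {x y : V} (P : G.Walk x y), ∀ e ∈ P.edges, ∀ v ∈ e, v ∈ P.support := by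
    intro x y P e he v hv
    obtain ⟨w, rfl⟩ := Sym2.mem_iff_exists.1 hv
    exact P.fst_mem_support_of_mem_edges he
  let Φ : Sym2 α → Set (Sym2 V) → Prop := fun e X =>
    (e = s(x₀, y₀) → ∀ e' ∈ Q.edges, e' ∈ X) ∧ ∀ e' ∈ X, e' ∈ Q.edges ∨ ∀ v ∈ e', v ∈ tkVerts b I
  have hΦ : ∀ e' ∈ (L.append (Q.append L'.reverse)).edges,
      e' ∈ Q.edges ∨ ∀ v ∈ e', v ∈ tkVerts b I := by
    intro e' he'
    rw [mem_edges_append, mem_edges_append, Walk.edges_reverse, List.mem_reverse] at he'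
    rcases he' with he' | he' | he'
    · exact Or.inr fun v hv => hLW v (Or.inl (hed _ _ he' v hv))
    · exact Or.inl he'
    · exact Or.inr fun v hv => hLW v (Or.inr (hed _ _ he' v hv))
  have hΦ' : ∀ e' ∈ Q.edges, e' ∈ (L.append (Q.append L'.reverse)).edges := by
    intro e' he'
    rw [mem_edges_append, mem_edges_append]
    tauto
  have hsup : ∀ v ∈ (L.append (Q.append L'.reverse)).support, v ∈ R := by
    intro v hv
    rw [mem_support_append, mem_support_append, Walk.support_reverse,
      List.mem_reverse] at hv
    exact hv
  obtain ⟨A, hA, hA1, hA2⟩ := exists_isSubdivision_of_paths (G := G) (H := H) (f := b ∘ f)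
    (h.inj.comp hf) (D := D) (by
      intro e x hx
      by_cases he : e = s(x₀, y₀)
      · simp only [D, if_pos he] at hx
        rcases hfbR x hx.1 with h1 | h1
        exacts [hx.2.1 h1, hx.2.2 h1]
      · simp only [D, if_neg he] at hx
        exact h.avoid _ _ hx) (by
      intro e e' hee
      rw [Set.disjoint_left]
      intro v hv hv'
      by_cases he : e = s(x₀, y₀)
      · have he' : e' ≠ s(x₀, y₀) := fun h1 => hee (he.trans h1.symm)
        simp only [D, if_pos he] at hv
        simp only [D, if_neg he'] at hv'
        exact hdis _ he' v hv' hv.1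
      · simp only [D, if_neg he] at hv
        by_cases he' : e' = s(x₀, y₀)
        · simp only [D, if_pos he'] at hv'
          exact hdis _ he v hv hv'.1
        · simp only [D, if_neg he'] at hv'
          exact Set.disjoint_left.1 (h.disj _ _ fun h1 => hee (Sym2.map.injective hf h1)) hv hv')
    (Φ := Φ) (by
      intro x y hadj
      by_cases hexy : s(x, y) = s(x₀, y₀)
      · have hD : D s(x, y) = {v | v ∈ R ∧ v ≠ b p ∧ v ≠ b q} := by simp only [D, if_pos hexy]
        rw [hD]
        rcases Sym2.eq_iff.1 hexy with ⟨rfl, rfl⟩ | ⟨rfl, rfl⟩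
        · refine ⟨(L.append (Q.append L'.reverse)).copy (congrArg b hfx.symm)
            (congrArg b hfy.symm), by simpa using hpath, fun v hv => ?_, fun _ e' he' => ?_,
            fun e' he' => hΦ e' (by simpa using he')⟩
          · rw [Walk.support_copy] at hv
            have := hsup v hv
            simp only [Function.comp, hfx, hfy, Set.mem_ofPred_eq]
            tauto
          · simpa using hΦ' e' he'
        · refine ⟨(L.append (Q.append L'.reverse)).reverse.copy (congrArg b hfy.symm)
            (congrArg b hfx.symm), by simpa using hpath.reverse, fun v hv => ?_, fun _ e' he' => ?_,
            fun e' he' => hΦ e' ?_⟩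
          · rw [Walk.support_copy, Walk.support_reverse, List.mem_reverse] at hv
            have := hsup v hv
            simp only [Function.comp, hfx, hfy, Set.mem_ofPred_eq]
            tauto
          · rw [Set.mem_ofPred_eq, Walk.edges_copy, Walk.edges_reverse, List.mem_reverse]
            exact hΦ' e' he'
          · rwa [Set.mem_ofPred_eq, Walk.edges_copy, Walk.edges_reverse, List.mem_reverse] at he'
      · have hD : D s(x, y) = I s(f x, f y) := by simp only [D, if_neg hexy, Sym2.map_mk]
        rw [hD]
        obtain ⟨P, hP, hPs⟩ := h.path (f x) (f y) fun h1 => hadj.ne (hf h1)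
        refine ⟨P, hP, fun v => (hPs v).1, fun h1 => absurd h1 hexy, fun e' he' => Or.inr ?_⟩
        intro v hv
        rcases (hPs v).1 (hed _ _ he' v hv) with rfl | rfl | h1
        exacts [hbW _, hbW _, hIW _ h1])
  refine ⟨A, hA, fun e he => ?_, fun e he => ?_⟩
  · obtain ⟨X, hX, hXA⟩ := hA1 _ he₀
    exact hXA (hX.1 rfl e he)
  · obtain ⟨e', -, X, hX, heX⟩ := hA2 e he
    exact hX.2 e heX

end Ear

section Rail

variable {V ι : Type*} {G : SimpleGraph V} {g g' : ℕ → V} {a b c : ℕ}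

/-- `g` traces a path of `G` on the interval `[a, b]`. -/
structure IsRail (G : SimpleGraph V) (g : ℕ → V) (a b : ℕ) : Prop where
  inj : ∀ i j, a ≤ i → i ≤ b → a ≤ j → j ≤ b → g i = g j → i = j
  adj : ∀ i, a ≤ i → i < b → G.Adj (g i) (g (i + 1))

theorem IsRail.mono (h : IsRail G g a b) {a' b' : ℕ} (ha : a ≤ a') (hb : b' ≤ b) :
    IsRail G g a' b' :=
  ⟨fun i j h1 h2 h3 h4 => h.inj i j (ha.trans h1) (h2.trans hb) (ha.trans h3) (h4.trans hb),
    fun i h1 h2 => h.adj i (ha.trans h1) (h2.trans_le hb)⟩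

/-- Some path from `g a` to `g b` stays on the rail `g` and uses all edges in `T`. -/
def RailPath (G : SimpleGraph V) (g : ℕ → V) (a b : ℕ) (T : Set (Sym2 V)) : Prop :=
  ∃ Q : G.Walk (g a) (g b), Q.IsPath ∧ (∀ v ∈ Q.support, ∃ i, a ≤ i ∧ i ≤ b ∧ g i = v) ∧
    ∀ e ∈ T, e ∈ Q.edges

theorem RailPath.append {T T' : Set (Sym2 V)} (h : RailPath G g a c T) (h' : RailPath G g c b T')
    (hg : IsRail G g a b) (hac : a ≤ c) (hcb : c ≤ b) : RailPath G g a b (T ∪ T') := by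
  obtain ⟨Q, h1, h2, h3⟩ := h
  obtain ⟨Q', h1', h2', h3'⟩ := h'
  refine ⟨Q.append Q', isPath_append_iff.2 ⟨h1, h1', fun v hv hv' => ?_⟩, fun v hv => ?_,
    fun e he => ?_⟩
  · obtain ⟨i, hi1, hi2, rfl⟩ := h2 v hv
    obtain ⟨j, hj1, hj2, hij⟩ := h2' _ hv'
    have := hg.inj j i (by omega) (by omega) (by omega) (by omega) hij
    rw [show i = c by omega]
  · rcases mem_support_append.1 hv with hv | hv
    · obtain ⟨i, hi1, hi2, rfl⟩ := h2 v hv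
      exact ⟨i, hi1, hi2.trans hcb, rfl⟩
    · obtain ⟨i, hi1, hi2, rfl⟩ := h2' v hv
      exact ⟨i, hac.trans hi1, hi2, rfl⟩
  · exact mem_edges_append.2 (he.imp (h3 e) (h3' e))

theorem IsRail.railPath (hg : IsRail G g a b) (hab : a ≤ b) : RailPath G g a b ∅ := by
  induction b, hab using Nat.le_induction with
  | base =>
    exact ⟨.nil, by simp, fun v hv => ⟨a, le_rfl, le_rfl, by simpa [eq_comm] using hv⟩, by simp⟩
  | succ b hab ih =>
    have h := hg.adj b hab (by omega)
    have := (ih (hg.mono le_rfl (by omega))).append (b := b + 1) (T' := ∅) (c := b)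
      ⟨h.toWalk, Walk.IsPath.of_adj h, fun v hv => by
        simp only [Adj.toWalk, Walk.support_cons, Walk.support_nil, List.mem_cons,
          List.not_mem_nil, or_false] at hv
        rcases hv with rfl | rfl
        exacts [⟨b, le_rfl, by omega, rfl⟩, ⟨b + 1, by omega, le_rfl, rfl⟩], by simp⟩ hg hab
      (by omega)
    simpa using this

/-- A family of chords whose ends are ordered consistently. -/
def IsMonotoneFamily (S : Finset ι) (x y : ι → ℕ) : Prop :=
  ∀ k ∈ S, ∀ l ∈ S, k ≠ l → x k < x l ∧ y k < y l ∨ x l < x k ∧ y l < y k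

theorem IsMonotoneFamily.subset {S T : Finset ι} {x y : ι → ℕ} (h : IsMonotoneFamily S x y)
    (hT : T ⊆ S) : IsMonotoneFamily T x y := fun k hk l hl => h k (hT hk) l (hT hl)

theorem IsMonotoneFamily.swap {S : Finset ι} {x y : ι → ℕ} (h : IsMonotoneFamily S x y) :
    IsMonotoneFamily S y x := fun k hk l hl hkl => by
  have := h k hk l hl hkl
  tauto

theorem IsMonotoneFamily.exists_first {S : Finset ι} {x y : ι → ℕ} (h : IsMonotoneFamily S x y)
    (hS : S.Nonempty) : ∃ k ∈ S, ∀ l ∈ S, l ≠ k → x k < x l ∧ y k < y l := by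
  obtain ⟨k, hk, hmin⟩ := S.exists_min_image x hS
  refine ⟨k, hk, fun l hl hlk => ?_⟩
  have h1 := hmin l hl
  have := h k hk l hl hlk.symm
  omega

/-- Crossing from rail to rail along each of the rungs. -/
theorem exists_ladder [DecidableEq ι] : ∀ (n : ℕ) (S : Finset ι) (g g' : ℕ → V) (x y : ι → ℕ)
    (a b a' b' : ℕ), S.card = n → a ≤ b → IsRail G g a b → IsRail G g' a' b' →
    (∀ i j, a ≤ i → i ≤ b → a' ≤ j → j ≤ b' → g i ≠ g' j) → IsMonotoneFamily S x y →
    (∀ k ∈ S, a ≤ x k ∧ x k ≤ b ∧ a' ≤ y k ∧ y k ≤ b' ∧ G.Adj (g (x k)) (g' (y k))) →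
    ∃ w, (w = if Even n then g b else g' b') ∧ ∃ Q : G.Walk (g a) w, Q.IsPath ∧
      (∀ v ∈ Q.support, (∃ i, a ≤ i ∧ i ≤ b ∧ g i = v) ∨ ∃ i, a' ≤ i ∧ i ≤ b' ∧ g' i = v) ∧
      ∀ k ∈ S, s(g (x k), g' (y k)) ∈ Q.edges := by
  intro n
  induction n with
  | zero =>
    intro S g g' x y a b a' b' hS hab hg hg' hd hm hk
    rw [Finset.card_eq_zero] at hS
    subst hS
    obtain ⟨Q, h1, h2, -⟩ := hg.railPath hab
    exact ⟨g b, by simp, Q, h1, fun v hv => Or.inl (h2 v hv), by simp⟩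
  | succ n ih =>
    intro S g g' x y a b a' b' hS hab hg hg' hd hm hk
    obtain ⟨k, hkS, hmin⟩ := hm.exists_first (Finset.card_pos.1 (by omega))
    obtain ⟨k1, k2, k3, k4, k5⟩ := hk k hkS
    obtain ⟨P, hP, hPs, -⟩ := (hg.mono le_rfl k2).railPath k1
    obtain ⟨w, hw, R, hR, hRs, hRe⟩ := ih (S.erase k) g' g y x (y k) b' (x k + 1) b
      (by rw [Finset.card_erase_of_mem hkS]; omega) k4 (hg'.mono k3 le_rfl)
      (hg.mono (by omega) le_rfl)
      (fun i j h1 h2 h3 h4 => (hd j i (by omega) h4 (by omega) h2).symm)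
      (hm.subset (Finset.erase_subset _ _)).swap (by
        intro l hl
        obtain ⟨hlk, hlS⟩ := Finset.mem_erase.1 hl
        obtain ⟨l1, l2, l3, l4, l5⟩ := hk l hlS
        have := hmin l hlS hlk
        exact ⟨by omega, l4, by omega, l2, l5.symm⟩)
    refine ⟨w, ?_, P.append (.cons k5 R), isPath_append_iff.2 ⟨hP, ?_, ?_⟩, ?_, ?_⟩
    · rw [hw]
      by_cases he : Even n
      · rw [if_pos he, if_neg (Nat.not_even_iff_odd.2 he.add_one)]
      · rw [if_neg he, if_pos (Nat.not_even_iff_odd.1 he).add_one]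
    · rw [Walk.cons_isPath_iff]
      refine ⟨hR, fun hv => ?_⟩
      rcases hRs _ hv with ⟨i, h1, h2, h3⟩ | ⟨i, h1, h2, h3⟩
      · exact hd (x k) i k1 k2 (by omega) h2 h3.symm
      · have := hg.inj i (x k) (by omega) h2 k1 k2 h3
        omega
    · intro v hv hv'
      rw [Walk.support_cons, List.mem_cons] at hv'
      rcases hv' with rfl | hv'
      · rfl
      obtain ⟨j, j1, j2, rfl⟩ := hPs v hv
      rcases hRs _ hv' with ⟨i, h1, h2, h3⟩ | ⟨i, h1, h2, h3⟩
      · exact absurd h3.symm (hd j i j1 (by omega) (by omega) h2)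
      · have := hg.inj i j (by omega) h2 j1 (by omega) h3
        omega
    · intro v hv
      rw [mem_support_append, Walk.support_cons, List.mem_cons] at hv
      rcases hv with hv | rfl | hv
      · obtain ⟨j, j1, j2, rfl⟩ := hPs v hv
        exact Or.inl ⟨j, j1, by omega, rfl⟩
      · exact Or.inl ⟨x k, k1, k2, rfl⟩
      · rcases hRs _ hv with ⟨i, h1, h2, h3⟩ | ⟨i, h1, h2, h3⟩
        · exact Or.inr ⟨i, by omega, h2, h3⟩
        · exact Or.inl ⟨i, by omega, h2, h3⟩
    · intro l hl
      rw [mem_edges_append, Walk.edges_cons, List.mem_cons]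
      by_cases hlk : l = k
      · subst hlk
        exact Or.inr (Or.inl rfl)
      · have := hRe l (Finset.mem_erase.2 ⟨hlk, hl⟩)
        rw [Sym2.eq_swap]
        exact Or.inr (Or.inr this)

/-- The chords of `g` indexed by `S` can be covered by two paths along `g`. -/
def RailCover (G : SimpleGraph V) (g : ℕ → V) (a b : ℕ) (x y : ι → ℕ) (S : Finset ι) : Prop :=
  ∃ T₁ T₂ : Set (Sym2 V), RailPath G g a b T₁ ∧ RailPath G g a b T₂ ∧
    ∀ k ∈ S, s(g (x k), g (y k)) ∈ T₁ ∪ T₂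

theorem RailCover.prepend {x y : ι → ℕ} {S : Finset ι} (h : RailCover G g c b x y S)
    (hg : IsRail G g a b) (hac : a ≤ c) (hcb : c ≤ b) : RailCover G g a b x y S := by
  obtain ⟨T₁, T₂, h1, h2, h3⟩ := h
  have h4 := (hg.mono le_rfl hcb).railPath hac
  refine ⟨_, _, h4.append h1 hg hac hcb, h4.append h2 hg hac hcb, fun k hk => ?_⟩
  have := h3 k hk
  simpa using this

theorem railPath_of_crossing [DecidableEq ι] {x y : ι → ℕ} {S : Finset ι} {d : ℕ}
    (hg : IsRail G g a b) (hS : Odd S.card) (hm : IsMonotoneFamily S x y)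
    (hk : ∀ k ∈ S, a ≤ x k ∧ x k < d ∧ d ≤ y k ∧ y k ≤ b ∧ G.Adj (g (x k)) (g (y k))) :
    RailPath G g a b {e | ∃ k ∈ S, e = s(g (x k), g (y k))} := by
  obtain ⟨k₀, hk₀⟩ := Finset.card_pos.1 hS.pos
  obtain ⟨h1, h2, h3, h4, -⟩ := hk k₀ hk₀
  obtain ⟨w, hw, Q, hQ, hQs, hQe⟩ := exists_ladder S.card S g g x y a (d - 1) d b rfl (by omega)
    (hg.mono le_rfl (by omega)) (hg.mono (by omega) le_rfl)
    (fun i j i1 i2 j1 j2 hij => by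
      have := hg.inj i j i1 (by omega) (by omega) j2 hij
      omega) hm (fun k hkS => by
      obtain ⟨l1, l2, l3, l4, l5⟩ := hk k hkS
      exact ⟨l1, by omega, l3, l4, l5⟩)
  rw [if_neg (Nat.not_even_iff_odd.2 hS)] at hw
  subst hw
  refine ⟨Q, hQ, fun v hv => ?_, ?_⟩
  · rcases hQs v hv with ⟨i, i1, i2, i3⟩ | ⟨i, i1, i2, i3⟩
    exacts [⟨i, i1, by omega, i3⟩, ⟨i, by omega, i2, i3⟩]
  · rintro e ⟨k, hkS, rfl⟩
    exact hQe k hkS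

theorem railCover_of_crossing [DecidableEq ι] {x y : ι → ℕ} {S : Finset ι} {d : ℕ}
    (hg : IsRail G g a b) (hS : S.Nonempty) (hm : IsMonotoneFamily S x y)
    (hk : ∀ k ∈ S, a ≤ x k ∧ x k < d ∧ d ≤ y k ∧ y k ≤ b ∧ G.Adj (g (x k)) (g (y k))) :
    RailCover G g a b x y S := by
  obtain ⟨k₀, hk₀⟩ := hS
  have hsub : ∀ T : Finset ι, T ⊆ S → Odd T.card →
      RailPath G g a b {e | ∃ k ∈ T, e = s(g (x k), g (y k))} := fun T hT hodd =>
    railPath_of_crossing hg hodd (hm.subset hT) fun k hkT => hk k (hT hkT)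
  rcases Nat.even_or_odd S.card with he | ho
  · refine ⟨_, _, hsub {k₀} (by simpa using hk₀) (by simp),
      hsub (S.erase k₀) (Finset.erase_subset _ _) ?_, fun k hkS => ?_⟩
    · rw [Finset.card_erase_of_mem hk₀]
      have := Finset.card_pos.2 ⟨k₀, hk₀⟩
      exact Nat.Even.sub_odd (by omega) he odd_one
    · by_cases hkk : k = k₀
      · exact Or.inl ⟨k, by simp [hkk], rfl⟩
      · exact Or.inr ⟨k, Finset.mem_erase.2 ⟨hkk, hkS⟩, rfl⟩
  · exact ⟨_, _, hsub S subset_rfl ho, hsub S subset_rfl ho, fun k hkS => Or.inl ⟨k, hkS, rfl⟩⟩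

theorem exists_railCovers_aux [DecidableEq ι] {x y : ι → ℕ} (n : ℕ) : ∀ (S : Finset ι) (a : ℕ),
    S.card = n → a ≤ b → IsRail G g a b → IsMonotoneFamily S x y →
    (∀ k ∈ S, a ≤ x k ∧ x k < y k ∧ y k ≤ b ∧ G.Adj (g (x k)) (g (y k))) →
    ∃ S₁ S₂ : Finset ι, S ⊆ S₁ ∪ S₂ ∧ RailCover G g a b x y S₁ ∧
      ∀ c, a ≤ c → c ≤ b → (∀ k ∈ S, c ≤ y k) → RailCover G g c b x y S₂ := by
  induction n using Nat.strong_induction_on with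
  | _ n ih =>
  intro S a hn hab hg hm hk
  have hempty : ∀ c, a ≤ c → c ≤ b → RailCover G g c b x y ∅ := fun c h1 h2 =>
    ⟨∅, ∅, (hg.mono h1 le_rfl).railPath h2, (hg.mono h1 le_rfl).railPath h2, by simp⟩
  rcases S.eq_empty_or_nonempty with rfl | hne
  · exact ⟨∅, ∅, by simp, hempty a le_rfl hab, fun c h1 h2 _ => hempty c h1 h2⟩
  obtain ⟨k₀, hk₀, hmin⟩ := hm.exists_first hne
  obtain ⟨p1, p2, p3, -⟩ := hk k₀ hk₀
  set B := S.filter fun k => x k < y k₀ with hB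
  set S' := S.filter fun k => ¬ x k < y k₀ with hS'
  have hcard : B.card + S'.card = S.card := Finset.card_filter_add_card_filter_not _
  have hBk : k₀ ∈ B := Finset.mem_filter.2 ⟨hk₀, p2⟩
  have hBpos := Finset.card_pos.2 ⟨k₀, hBk⟩
  have hmem' : ∀ k ∈ S', k ∈ S ∧ y k₀ ≤ x k := fun k h => by
    simpa [hS'] using h
  obtain ⟨S₁, S₂, h12, h1, h2⟩ := ih S'.card (by omega) S' (y k₀) rfl p3
    (hg.mono (by omega) le_rfl) (hm.subset (Finset.filter_subset _ _)) (fun k hkS => by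
      obtain ⟨hkS, hkx⟩ := hmem' k hkS
      obtain ⟨l1, l2, l3, l4⟩ := hk k hkS
      exact ⟨hkx, l2, l3, l4⟩)
  obtain ⟨c', c1, c2, c3, c4⟩ : ∃ c', y k₀ ≤ c' ∧ c' ≤ b ∧ (∀ k ∈ S', c' ≤ y k) ∧
      ∀ k ∈ B, y k ≤ c' := by
    rcases S'.eq_empty_or_nonempty with he | hne'
    · exact ⟨b, p3, le_rfl, by simp [he], fun k hkB => (hk k (Finset.mem_filter.1 hkB).1).2.2.1⟩
    · obtain ⟨k₁, hk₁, hmin₁⟩ := (hm.subset (Finset.filter_subset _ _)).exists_first hne'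
      obtain ⟨q1, q2⟩ := hmem' k₁ hk₁
      obtain ⟨l1, l2, l3, -⟩ := hk k₁ q1
      refine ⟨y k₁, by omega, l3, fun k hkS => ?_, fun k hkB => ?_⟩
      · by_cases hkk : k = k₁
        · rw [hkk]
        · exact (hmin₁ k hkS hkk).2.le
      · obtain ⟨hkS, hkx⟩ := Finset.mem_filter.1 hkB
        have := hm k hkS k₁ q1 (by rintro rfl; omega)
        omega
  refine ⟨B ∪ S₂, S₁, ?_, ?_, fun c h3 h4 h5 => ?_⟩
  · intro k hkS
    by_cases hx : x k < y k₀
    · exact Finset.mem_union_left _ (Finset.mem_union_left _ (Finset.mem_filter.2 ⟨hkS, hx⟩))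
    · have := h12 (Finset.mem_filter.2 ⟨hkS, hx⟩)
      simp only [Finset.mem_union] at this ⊢
      tauto
  · obtain ⟨T₁, T₂, t1, t2, t3⟩ := railCover_of_crossing (S := B) (d := y k₀)
      (hg.mono le_rfl c2) ⟨k₀, hBk⟩ (hm.subset (Finset.filter_subset _ _)) (fun k hkB => by
        obtain ⟨hkS, hkx⟩ := Finset.mem_filter.1 hkB
        obtain ⟨l1, l2, l3, l4⟩ := hk k hkS
        refine ⟨l1, hkx, ?_, c4 k hkB, l4⟩
        by_cases hkk : k = k₀
        · rw [hkk]
        · exact (hmin k hkS hkk).2.le)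
    obtain ⟨T₁', T₂', t1', t2', t3'⟩ := h2 c' c1 c2 c3
    refine ⟨_, _, t1.append t1' hg (by omega) c2, t2.append t2' hg (by omega) c2, fun k hkS => ?_⟩
    rcases Finset.mem_union.1 hkS with h | h
    · have := t3 k h
      simp only [Set.mem_union] at this ⊢
      tauto
    · have := t3' k h
      simp only [Set.mem_union] at this ⊢
      tauto
  · exact h1.prepend (hg.mono h3 le_rfl) (h5 k₀ hk₀) p3

theorem exists_railCovers [DecidableEq ι] {x y : ι → ℕ} {S : Finset ι} (hab : a ≤ b)
    (hg : IsRail G g a b) (hm : IsMonotoneFamily S x y)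
    (hk : ∀ k ∈ S, a ≤ x k ∧ x k < y k ∧ y k ≤ b ∧ G.Adj (g (x k)) (g (y k))) :
    ∃ S₁ S₂ : Finset ι, S ⊆ S₁ ∪ S₂ ∧ RailCover G g a b x y S₁ ∧ RailCover G g a b x y S₂ := by
  obtain ⟨S₁, S₂, h1, h2, h3⟩ := exists_railCovers_aux (G := G) _ S a rfl hab hg hm hk
  refine ⟨S₁, S₂, h1, h2, h3 a le_rfl hab fun k hkS => ?_⟩
  have := hk k hkS
  omega

end Rail

section Theta

variable {V ι : Type*} {G : SimpleGraph V}

theorem exists_list_union {X : Type*} (s : Finset ι) (L : ι → List X) {t : ℕ}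
    (h : ∀ c ∈ s, (L c).length ≤ t) :
    ∃ L' : List X, L'.length ≤ s.card * t ∧ ∀ x, x ∈ L' ↔ ∃ c ∈ s, x ∈ L c := by
  classical
  induction s using Finset.induction_on with
  | empty => exact ⟨[], by simp, by simp⟩
  | insert a s ha ih =>
    obtain ⟨L', h1, h2⟩ := ih fun c hc => h c (Finset.mem_insert_of_mem hc)
    refine ⟨L a ++ L', ?_, fun x => ?_⟩
    · rw [List.length_append, Finset.card_insert_of_notMem ha, add_mul, one_mul, add_comm]
      exact Nat.add_le_add h1 (h a (Finset.mem_insert_self _ _))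
    · simp [h2]

/-- Members of a doubly ranked family can be singled out by few objects, provided that monotone
subfamilies can be covered by `t` objects each. -/
theorem exists_separating_list {X : Type*} {F : Finset ι} {ρ₁ ρ₂ : ι → ℕ} {m t : ℕ}
    (h₁ : ∀ k ∈ F, ρ₁ k ≤ m) (h₂ : ∀ k ∈ F, ρ₂ k ≤ m)
    (hinj : ∀ k ∈ F, ∀ l ∈ F, ρ₁ k = ρ₁ l → ρ₂ k = ρ₂ l → k = l) {enc : ι → Sym2 V}
    (henc : ∀ k ∈ F, ∀ l ∈ F, enc k = enc l → k = l) {con : X → Sym2 V → Prop}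
    {E : Set (Sym2 V)} {Good : X → Prop}
    (h : ∀ S ⊆ F, IsMonotoneFamily S ρ₁ ρ₂ → ∃ L : List X, L.length ≤ t ∧
      (∀ Q ∈ L, Good Q ∧ ∀ e, con Q e → e ∈ E ∨ ∃ k ∈ S, e = enc k) ∧
      ∀ k ∈ S, ∃ Q ∈ L, con Q (enc k)) :
    ∃ L : List X, L.length ≤ 2 * (3 * m + 1) * t ∧ (∀ Q ∈ L, Good Q) ∧
      ∀ k ∈ F, ∀ e, e ∉ E → e ≠ enc k → ∃ Q ∈ L, con Q (enc k) ∧ ¬ con Q e := by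
  classical
  let S : ℕ × ℕ → Finset ι := fun c => F.filter fun k => ρ₂ k + 2 * m = c.1 * ρ₁ k + c.2
  have hSF : ∀ c, S c ⊆ F := fun c => Finset.filter_subset _ _
  have hS : ∀ c ∈ ({1, 2} : Finset ℕ) ×ˢ Finset.range (3 * m + 1),
      IsMonotoneFamily (S c) ρ₁ ρ₂ := by
    intro c hc k hk l hl hkl
    rw [Finset.mem_product] at hc
    obtain ⟨hkF, hk'⟩ := Finset.mem_filter.1 hk
    obtain ⟨hlF, hl'⟩ := Finset.mem_filter.1 hl
    have h3 : ¬ (ρ₁ k = ρ₁ l ∧ ρ₂ k = ρ₂ l) := fun h3 => hkl (hinj k hkF l hlF h3.1 h3.2)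
    have h4 : c.1 = 1 ∨ c.1 = 2 := by simpa using hc.1
    rcases h4 with h4 | h4 <;> rw [h4] at hk' hl' <;> omega
  have h' : ∀ c, ∃ L : List X, c ∈ ({1, 2} : Finset ℕ) ×ˢ Finset.range (3 * m + 1) →
      L.length ≤ t ∧ (∀ Q ∈ L, Good Q ∧ ∀ e, con Q e → e ∈ E ∨ ∃ k ∈ S c, e = enc k) ∧
      ∀ k ∈ S c, ∃ Q ∈ L, con Q (enc k) := by
    intro c
    by_cases hc : c ∈ ({1, 2} : Finset ℕ) ×ˢ Finset.range (3 * m + 1)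
    · obtain ⟨L, hL⟩ := h (S c) (hSF c) (hS c hc)
      exact ⟨L, fun _ => hL⟩
    · exact ⟨[], fun h => absurd h hc⟩
  choose L hL using h'
  obtain ⟨L', h3, h4⟩ := exists_list_union (({1, 2} : Finset ℕ) ×ˢ Finset.range (3 * m + 1)) L
    fun c hc => (hL c hc).1
  refine ⟨L', ?_, fun Q hQ => ?_, fun k hk e he hek => ?_⟩
  · rw [Finset.card_product, Finset.card_range] at h3
    exact h3
  · obtain ⟨c, hc, hQc⟩ := (h4 Q).1 hQ
    exact ((hL c hc).2.1 Q hQc).1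
  · have b1 := h₁ k hk
    have b2 := h₂ k hk
    have key : ∀ w, w = 1 ∨ w = 2 → ∃ d, (w, d) ∈ ({1, 2} : Finset ℕ) ×ˢ Finset.range (3 * m + 1) ∧
        k ∈ S (w, d) := by
      intro w hw
      refine ⟨ρ₂ k + 2 * m - w * ρ₁ k, ?_, Finset.mem_filter.2 ⟨hk, ?_⟩⟩
      · simp only [Finset.mem_product, Finset.mem_insert, Finset.mem_singleton, Finset.mem_range]
        rcases hw with rfl | rfl <;> omega
      · rcases hw with rfl | rfl <;> simp only <;> omega
    obtain ⟨d₁, hd₁, hk₁⟩ := key 1 (Or.inl rfl)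
    obtain ⟨d₂, hd₂, hk₂⟩ := key 2 (Or.inr rfl)
    obtain ⟨Q₁, hQ₁, hc₁⟩ := (hL _ hd₁).2.2 k hk₁
    obtain ⟨Q₂, hQ₂, hc₂⟩ := (hL _ hd₂).2.2 k hk₂
    by_cases hn₁ : con Q₁ e
    · by_cases hn₂ : con Q₂ e
      · exfalso
        obtain ⟨k₁, hk₁', rfl⟩ := (((hL _ hd₁).2.1 Q₁ hQ₁).2 e hn₁).resolve_left he
        obtain ⟨k₂, hk₂', heq⟩ := (((hL _ hd₂).2.1 Q₂ hQ₂).2 _ hn₂).resolve_left he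
        obtain rfl := henc _ (hSF _ hk₁') _ (hSF _ hk₂') heq
        have e1 := (Finset.mem_filter.1 hk₁).2
        have e2 := (Finset.mem_filter.1 hk₂).2
        have e3 := (Finset.mem_filter.1 hk₁').2
        have e4 := (Finset.mem_filter.1 hk₂').2
        simp only at e1 e2 e3 e4
        refine hek (congrArg enc (hinj _ (hSF _ hk₁') _ hk ?_ ?_)) <;> omega
      · exact ⟨Q₂, (h4 _).2 ⟨_, hd₂, hQ₂⟩, hc₂, hn₂⟩
    · exact ⟨Q₁, (h4 _).2 ⟨_, hd₁, hQ₁⟩, hc₁, hn₁⟩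

/-- The number of positions before `i` at which `g` lies in `U`. -/
def rank [DecidableEq V] (g : ℕ → V) (U : Finset V) (i : ℕ) : ℕ :=
  ((Finset.range i).filter fun j => g j ∈ U).card

variable [DecidableEq V] {g g' : ℕ → V} {U : Finset V} {n n' m : ℕ}

theorem rank_mono {i j : ℕ} (h : i ≤ j) : rank g U i ≤ rank g U j :=
  Finset.card_le_card (Finset.filter_subset_filter _ (Finset.range_subset_range.2 h))

theorem lt_of_rank_lt {i j : ℕ} (h : rank g U i < rank g U j) : i < j := by
  by_contra! hc
  exact absurd (rank_mono (g := g) (U := U) hc) (by omega)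

theorem rank_lt {i j : ℕ} (h : i < j) (hi : g i ∈ U) : rank g U i < rank g U j := by
  refine Finset.card_lt_card ⟨Finset.filter_subset_filter _ (Finset.range_subset_range.2 h.le),
    fun hsub => ?_⟩
  have := hsub (Finset.mem_filter.2 ⟨Finset.mem_range.2 h, hi⟩)
  simp at this

theorem rank_inj {i j : ℕ} (h : rank g U i = rank g U j) (hi : g i ∈ U) (hj : g j ∈ U) :
    i = j := by
  rcases lt_trichotomy i j with h1 | h1 | h1
  · exact absurd (rank_lt h1 hi) (by omega)
  · exact h1
  · exact absurd (rank_lt h1 hj) (by omega)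

theorem IsRail.rank_le (hg : IsRail G g 0 n) (hU : U.card ≤ m) {i : ℕ} (hi : i ≤ n) :
    rank g U i ≤ m := by
  refine le_trans ?_ hU
  refine Finset.card_le_card_of_injOn g (fun j hj => (Finset.mem_filter.1 hj).2) ?_
  intro j hj k hk hjk
  rw [Finset.mem_coe, Finset.mem_filter, Finset.mem_range] at hj hk
  exact hg.inj j k (by omega) (by omega) (by omega) (by omega) hjk

omit [DecidableEq V] in
theorem exists_mapLe {G' : SimpleGraph V} (hle : G' ≤ G) {u v : V} {Q : G'.Walk u v}
    (hQ : Q.IsPath) : ∃ R : G.Walk u v, R.IsPath ∧ R.support = Q.support ∧ R.edges = Q.edges :=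
  ⟨Q.mapLe hle, (Walk.isPath_mapLe hle).2 hQ, by simp, by simp⟩

theorem exists_list_same_rail {p q : V} (hp : g 0 = p) (hq : g n = q) (hg : IsRail G g 0 n)
    (hU : U.card ≤ m) {E : Set (Sym2 V)} (hE : ∀ i, i < n → s(g i, g (i + 1)) ∈ E) :
    ∃ L : List (G.Walk p q), L.length ≤ 2 * (3 * m + 1) * 4 ∧
      (∀ Q ∈ L, Q.IsPath ∧ ∀ v ∈ Q.support, ∃ i, i ≤ n ∧ g i = v) ∧
      ∀ i j, i < j → j ≤ n → G.Adj (g i) (g j) → g i ∈ U → g j ∈ U → ∀ e, e ∉ E →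
        e ≠ s(g i, g j) → ∃ Q ∈ L, s(g i, g j) ∈ Q.edges ∧ e ∉ Q.edges := by
  classical
  subst hp hq
  let F : Finset (ℕ × ℕ) := (Finset.range (n + 1) ×ˢ Finset.range (n + 1)).filter fun k =>
    k.1 < k.2 ∧ G.Adj (g k.1) (g k.2) ∧ g k.1 ∈ U ∧ g k.2 ∈ U
  have hF : ∀ k, k ∈ F ↔ k.1 < k.2 ∧ k.2 ≤ n ∧ G.Adj (g k.1) (g k.2) ∧ g k.1 ∈ U ∧ g k.2 ∈ U := by
    intro k
    simp only [F, Finset.mem_filter, Finset.mem_product, Finset.mem_range]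
    constructor
    · rintro ⟨⟨h1, h2⟩, h3, h4⟩; exact ⟨h3, by omega, h4⟩
    · rintro ⟨h1, h2, h3⟩; exact ⟨⟨by omega, by omega⟩, h1, h3⟩
  obtain ⟨L, h1, h2, h3⟩ := exists_separating_list (F := F) (ρ₁ := fun k => rank g U k.1)
    (ρ₂ := fun k => rank g U k.2) (m := m) (t := 4) (enc := fun k => s(g k.1, g k.2))
    (con := fun (Q : G.Walk (g 0) (g n)) e => e ∈ Q.edges) (E := E)
    (Good := fun Q => Q.IsPath ∧ ∀ v ∈ Q.support, ∃ i, i ≤ n ∧ g i = v)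
    (fun k hk => hg.rank_le hU (by have := (hF k).1 hk; omega))
    (fun k hk => hg.rank_le hU ((hF k).1 hk).2.1)
    (fun k hk l hl e1 e2 => by
      obtain ⟨-, -, -, k1, k2⟩ := (hF k).1 hk
      obtain ⟨-, -, -, l1, l2⟩ := (hF l).1 hl
      exact Prod.ext (rank_inj e1 k1 l1) (rank_inj e2 k2 l2))
    (fun k hk l hl hkl => by
      obtain ⟨k1, k2, -⟩ := (hF k).1 hk
      obtain ⟨l1, l2, -⟩ := (hF l).1 hl
      rcases Sym2.eq_iff.1 hkl with ⟨e1, e2⟩ | ⟨e1, e2⟩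
      · exact Prod.ext (hg.inj _ _ (by omega) (by omega) (by omega) (by omega) e1)
          (hg.inj _ _ (by omega) (by omega) (by omega) (by omega) e2)
      · have := hg.inj _ _ (by omega) (by omega) (by omega) (by omega) e1
        have := hg.inj _ _ (by omega) (by omega) (by omega) (by omega) e2
        omega) (by
      intro S hSF hS
      let G' : SimpleGraph V := SimpleGraph.fromEdgeSet
        ({e | ∃ i, i < n ∧ e = s(g i, g (i + 1))} ∪ {e | ∃ k ∈ S, e = s(g k.1, g k.2)})
      have hle : G' ≤ G := by
        intro v w hvw
        rw [SimpleGraph.fromEdgeSet_adj] at hvw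
        rw [← SimpleGraph.mem_edgeSet]
        rcases hvw.1 with ⟨i, hi, he⟩ | ⟨k, hk, he⟩ <;> rw [he, SimpleGraph.mem_edgeSet]
        exacts [hg.adj i (by omega) hi, ((hF k).1 (hSF hk)).2.2.1]
      have hG'e : ∀ e, e ∈ G'.edgeSet → e ∈ E ∨ ∃ k ∈ S, e = s(g k.1, g k.2) := by
        intro e he
        rw [SimpleGraph.edgeSet_fromEdgeSet] at he
        rcases he.1 with ⟨i, hi, rfl⟩ | h
        exacts [Or.inl (hE i hi), Or.inr h]
      have hg' : IsRail G' g 0 n := ⟨hg.inj, fun i h1 h2 => by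
        rw [SimpleGraph.fromEdgeSet_adj]
        exact ⟨Or.inl ⟨i, h2, rfl⟩, (hg.adj i h1 h2).ne⟩⟩
      obtain ⟨S₁, S₂, hS12, ⟨T₁, T₂, r1, r2, r3⟩, ⟨T₃, T₄, r4, r5, r6⟩⟩ :=
        exists_railCovers (x := Prod.fst) (y := Prod.snd) (S := S) (Nat.zero_le n) hg'
          (fun k hk l hl hkl => (hS k hk l hl hkl).imp
            (fun h => ⟨lt_of_rank_lt h.1, lt_of_rank_lt h.2⟩)
            (fun h => ⟨lt_of_rank_lt h.1, lt_of_rank_lt h.2⟩)) (by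
          intro k hk
          obtain ⟨k1, k2, k3, -⟩ := (hF k).1 (hSF hk)
          refine ⟨by omega, k1, k2, ?_⟩
          rw [SimpleGraph.fromEdgeSet_adj]
          exact ⟨Or.inr ⟨k, hk, rfl⟩, k3.ne⟩)
      have hmap : ∀ T, RailPath G' g 0 n T → ∃ R : G.Walk (g 0) (g n),
          ((R.IsPath ∧ ∀ v ∈ R.support, ∃ i, i ≤ n ∧ g i = v) ∧
            ∀ e, e ∈ R.edges → e ∈ E ∨ ∃ k ∈ S, e = s(g k.1, g k.2)) ∧ ∀ e ∈ T, e ∈ R.edges := by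
        rintro T ⟨Q, hQ, hQs, hQe⟩
        obtain ⟨R, hR, hRs, hRe⟩ := exists_mapLe hle hQ
        refine ⟨R, ⟨⟨hR, fun v hv => ?_⟩, fun e he => hG'e e ?_⟩, fun e he => hRe ▸ hQe e he⟩
        · obtain ⟨i, -, h1, h2⟩ := hQs v (hRs ▸ hv)
          exact ⟨i, h1, h2⟩
        · exact Q.edges_subset_edgeSet (hRe ▸ he)
      obtain ⟨R₁, g1, c1⟩ := hmap _ r1
      obtain ⟨R₂, g2, c2⟩ := hmap _ r2
      obtain ⟨R₃, g3, c3⟩ := hmap _ r4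
      obtain ⟨R₄, g4, c4⟩ := hmap _ r5
      refine ⟨[R₁, R₂, R₃, R₄], by simp, ?_, fun k hk => ?_⟩
      · intro Q hQ
        simp only [List.mem_cons, List.not_mem_nil, or_false] at hQ
        rcases hQ with rfl | rfl | rfl | rfl <;> assumption
      · simp only [List.mem_cons, List.not_mem_nil, or_false, exists_eq_or_imp, exists_eq_left]
        rcases Finset.mem_union.1 (hS12 hk) with h | h
        · rcases r3 k h with h | h
          exacts [Or.inl (c1 _ h), Or.inr (Or.inl (c2 _ h))]
        · rcases r6 k h with h | h
          exacts [Or.inr (Or.inr (Or.inl (c3 _ h))), Or.inr (Or.inr (Or.inr (c4 _ h)))])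
  refine ⟨L, h1, h2, fun i j hij hj hadj hi hj' e he hne => ?_⟩
  exact h3 (i, j) ((hF _).2 ⟨hij, hj, hadj, hi, hj'⟩) e he hne

theorem exists_list_across_rails {p q : V} (hp : g 0 = p) (hq : g n = q) (hq' : g' n' = q)
    (hg : IsRail G g 0 n) (hg' : IsRail G g' 0 n') (hn : 0 < n)
    (hcross : ∀ i j, i ≤ n → j ≤ n' → g i = g' j → i = 0 ∧ j = 0 ∨ i = n ∧ j = n')
    (hU : U.card ≤ m) {E : Set (Sym2 V)} (hE : ∀ i, i < n → s(g i, g (i + 1)) ∈ E)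
    (hE' : ∀ i, i < n' → s(g' i, g' (i + 1)) ∈ E) :
    ∃ L : List (G.Walk p q), L.length ≤ 2 * (3 * m + 1) * 1 ∧
      (∀ Q ∈ L, Q.IsPath ∧ ∀ v ∈ Q.support, (∃ i, i ≤ n ∧ g i = v) ∨ ∃ i, i ≤ n' ∧ g' i = v) ∧
      ∀ i j, 0 < i → i < n → 0 < j → j < n' → G.Adj (g i) (g' j) → g i ∈ U → g' j ∈ U →
        ∀ e, e ∉ E → e ≠ s(g i, g' j) → ∃ Q ∈ L, s(g i, g' j) ∈ Q.edges ∧ e ∉ Q.edges := by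
  classical
  subst hp
  let F : Finset (ℕ × ℕ) := (Finset.Ioo 0 n ×ˢ Finset.Ioo 0 n').filter fun k =>
    G.Adj (g k.1) (g' k.2) ∧ g k.1 ∈ U ∧ g' k.2 ∈ U
  have hF : ∀ k, k ∈ F ↔ ((0 < k.1 ∧ k.1 < n) ∧ 0 < k.2 ∧ k.2 < n') ∧
      G.Adj (g k.1) (g' k.2) ∧ g k.1 ∈ U ∧ g' k.2 ∈ U := by
    intro k
    simp only [F, Finset.mem_filter, Finset.mem_product, Finset.mem_Ioo]
  obtain ⟨L, h1, h2, h3⟩ := exists_separating_list (F := F) (ρ₁ := fun k => rank g U k.1)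
    (ρ₂ := fun k => rank g' U k.2) (m := m) (t := 1) (enc := fun k => s(g k.1, g' k.2))
    (con := fun (Q : G.Walk (g 0) q) e => e ∈ Q.edges) (E := E)
    (Good := fun Q => Q.IsPath ∧
      ∀ v ∈ Q.support, (∃ i, i ≤ n ∧ g i = v) ∨ ∃ i, i ≤ n' ∧ g' i = v)
    (fun k hk => hg.rank_le hU ((hF k).1 hk).1.1.2.le)
    (fun k hk => hg'.rank_le hU ((hF k).1 hk).1.2.2.le)
    (fun k hk l hl e1 e2 => by
      obtain ⟨-, -, k1, k2⟩ := (hF k).1 hk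
      obtain ⟨-, -, l1, l2⟩ := (hF l).1 hl
      exact Prod.ext (rank_inj e1 k1 l1) (rank_inj e2 k2 l2))
    (fun k hk l hl hkl => by
      obtain ⟨k1, -⟩ := (hF k).1 hk
      obtain ⟨l1, -⟩ := (hF l).1 hl
      rcases Sym2.eq_iff.1 hkl with ⟨e1, e2⟩ | ⟨e1, e2⟩
      · exact Prod.ext (hg.inj _ _ (by omega) (by omega) (by omega) (by omega) e1)
          (hg'.inj _ _ (by omega) (by omega) (by omega) (by omega) e2)
      · have := hcross _ _ (by omega) (by omega) e1
        omega) (by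
      intro S hSF hS
      rcases S.eq_empty_or_nonempty with rfl | ⟨k₀, hk₀⟩
      · exact ⟨[], by simp, by simp, by simp⟩
      have hn' := ((hF k₀).1 (hSF hk₀)).1.2
      let G' : SimpleGraph V := SimpleGraph.fromEdgeSet
        ({e | (∃ i, i < n ∧ e = s(g i, g (i + 1))) ∨ ∃ i, i < n' ∧ e = s(g' i, g' (i + 1))} ∪
          {e | ∃ k ∈ S, e = s(g k.1, g' k.2)})
      have hle : G' ≤ G := by
        intro v w hvw
        rw [SimpleGraph.fromEdgeSet_adj] at hvw
        rw [← SimpleGraph.mem_edgeSet]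
        rcases hvw.1 with (⟨i, hi, he⟩ | ⟨i, hi, he⟩) | ⟨k, hk, he⟩ <;>
          rw [he, SimpleGraph.mem_edgeSet]
        exacts [hg.adj i (by omega) hi, hg'.adj i (by omega) hi, ((hF k).1 (hSF hk)).2.1]
      have hG'e : ∀ e, e ∈ G'.edgeSet → e ∈ E ∨ ∃ k ∈ S, e = s(g k.1, g' k.2) := by
        intro e he
        rw [SimpleGraph.edgeSet_fromEdgeSet] at he
        rcases he.1 with (⟨i, hi, rfl⟩ | ⟨i, hi, rfl⟩) | h
        exacts [Or.inl (hE i hi), Or.inl (hE' i hi), Or.inr h]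
      have hr : IsRail G' g 0 n := ⟨hg.inj, fun i h1 h2 => by
        rw [SimpleGraph.fromEdgeSet_adj]
        exact ⟨Or.inl (Or.inl ⟨i, h2, rfl⟩), (hg.adj i h1 h2).ne⟩⟩
      have hr' : IsRail G' g' 0 n' := ⟨hg'.inj, fun i h1 h2 => by
        rw [SimpleGraph.fromEdgeSet_adj]
        exact ⟨Or.inl (Or.inr ⟨i, h2, rfl⟩), (hg'.adj i h1 h2).ne⟩⟩
      obtain ⟨w, hw, Q, hQ, hQs, hQe⟩ := exists_ladder (G := G') S.card S g g' Prod.fst Prod.snd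
        0 (n - 1) 1 (n' - 1) rfl (by omega) (hr.mono le_rfl (by omega))
        (hr'.mono (by omega) (by omega)) (fun i j h1 h2 h3 h4 h5 => by
          have := hcross i j (by omega) (by omega) h5
          omega)
        (fun k hk l hl hkl => (hS k hk l hl hkl).imp
            (fun h => ⟨lt_of_rank_lt h.1, lt_of_rank_lt h.2⟩)
            (fun h => ⟨lt_of_rank_lt h.1, lt_of_rank_lt h.2⟩)) (by
          intro k hk
          obtain ⟨k1, k2, -⟩ := (hF k).1 (hSF hk)
          refine ⟨by omega, by omega, by omega, by omega, ?_⟩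
          rw [SimpleGraph.fromEdgeSet_adj]
          exact ⟨Or.inr ⟨k, hk, rfl⟩, k2.ne⟩)
      have hwq : G'.Adj w q := by
        split_ifs at hw with he
        · have := hr.adj (n - 1) (by omega) (by omega)
          rw [Nat.sub_add_cancel hn, hq] at this
          rwa [hw]
        · have := hr'.adj (n' - 1) (by omega) (by omega)
          rw [Nat.sub_add_cancel (by omega), hq'] at this
          rwa [hw]
      have hqQ : q ∉ Q.support := by
        intro hmem
        rcases hQs q hmem with ⟨i, i1, i2, i3⟩ | ⟨i, i1, i2, i3⟩
        · have := hg.inj i n (by omega) (by omega) (by omega) (by omega) (i3.trans hq.symm)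
          omega
        · have := hg'.inj i n' (by omega) (by omega) (by omega) (by omega) (i3.trans hq'.symm)
          omega
      obtain ⟨R, hR, hRs, hRe⟩ := exists_mapLe hle (hQ.concat hqQ hwq)
      refine ⟨[R], by simp, ?_, fun k hk => ⟨R, by simp, ?_⟩⟩
      · intro Q' hQ'
        rw [List.mem_singleton] at hQ'
        subst hQ'
        refine ⟨⟨hR, fun v hv => ?_⟩, fun e he => hG'e e ?_⟩
        · rw [hRs, Walk.support_concat, List.mem_append, List.mem_singleton] at hv
          rcases hv with hv | rfl
          · rcases hQs v hv with ⟨i, i1, i2, i3⟩ | ⟨i, i1, i2, i3⟩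
            exacts [Or.inl ⟨i, by omega, i3⟩, Or.inr ⟨i, by omega, i3⟩]
          · exact Or.inl ⟨n, le_rfl, hq⟩
        · exact Walk.edges_subset_edgeSet _ (hRe ▸ he)
      · rw [hRe, Walk.edges_concat, List.concat_eq_append, List.mem_append]
        exact Or.inl (hQe k hk))
  refine ⟨L, h1, h2, fun i j hi hi' hj hj' hadj hiU hjU e he hne => ?_⟩
  exact h3 (i, j) ((hF _).2 ⟨⟨⟨hi, hi'⟩, hj, hj'⟩, hadj, hiU, hjU⟩) e he hne

theorem exists_list_theta {p q : V} (hp : g 0 = p) (hp' : g' 0 = p) (hq : g n = q) (hq' : g' n' = q)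
    (hg : IsRail G g 0 n) (hg' : IsRail G g' 0 n') (hn : 0 < n)
    (hcross : ∀ i j, i ≤ n → j ≤ n' → g i = g' j → i = 0 ∧ j = 0 ∨ i = n ∧ j = n')
    (hU : U.card ≤ m) (hm : 1 ≤ m) {E : Set (Sym2 V)} (hE : ∀ i, i < n → s(g i, g (i + 1)) ∈ E)
    (hE' : ∀ i, i < n' → s(g' i, g' (i + 1)) ∈ E)
    (hUr : ∀ v ∈ U, (∃ i, i ≤ n ∧ g i = v) ∨ ∃ i, i ≤ n' ∧ g' i = v) :
    ∃ L : List (G.Walk p q), L.length ≤ 100 * m ∧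
      (∀ Q ∈ L, Q.IsPath ∧ ∀ v ∈ Q.support, (∃ i, i ≤ n ∧ g i = v) ∨ ∃ i, i ≤ n' ∧ g' i = v) ∧
      ∀ e ∈ G.edgeSet, (∀ v ∈ e, v ∈ U) → ∀ e', e' ∉ E → e' ≠ e →
        ∃ Q ∈ L, e ∈ Q.edges ∧ e' ∉ Q.edges := by
  obtain ⟨L₁, a1, a2, a3⟩ := exists_list_same_rail hp hq hg hU hE
  obtain ⟨L₂, b1, b2, b3⟩ := exists_list_same_rail hp' hq' hg' hU hE'
  obtain ⟨L₃, c1, c2, c3⟩ := exists_list_across_rails hp hq hq' hg hg' hn hcross hU hE hE'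
  refine ⟨L₁ ++ L₂ ++ L₃, ?_, ?_, ?_⟩
  · simp only [List.length_append]
    omega
  · intro Q hQ
    rw [List.mem_append, List.mem_append] at hQ
    rcases hQ with (hQ | hQ) | hQ
    · exact ⟨(a2 Q hQ).1, fun v hv => Or.inl ((a2 Q hQ).2 v hv)⟩
    · exact ⟨(b2 Q hQ).1, fun v hv => Or.inr ((b2 Q hQ).2 v hv)⟩
    · exact c2 Q hQ
  · have hmem : ∀ e e', ((∃ Q ∈ L₁, e ∈ Q.edges ∧ e' ∉ Q.edges) ∨
        (∃ Q ∈ L₂, e ∈ Q.edges ∧ e' ∉ Q.edges) ∨ ∃ Q ∈ L₃, e ∈ Q.edges ∧ e' ∉ Q.edges) →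
        ∃ Q ∈ L₁ ++ L₂ ++ L₃, e ∈ Q.edges ∧ e' ∉ Q.edges := by
      rintro e e' (⟨Q, h1, h2⟩ | ⟨Q, h1, h2⟩ | ⟨Q, h1, h2⟩) <;> exact ⟨Q, by simp [h1], h2⟩
    have same : ∀ i j, i ≤ n → j ≤ n → G.Adj (g i) (g j) → g i ∈ U → g j ∈ U → ∀ e', e' ∉ E →
        e' ≠ s(g i, g j) → ∃ Q ∈ L₁, s(g i, g j) ∈ Q.edges ∧ e' ∉ Q.edges := by
      intro i j hi hj hadj hiU hjU e' he' hne
      rcases lt_trichotomy i j with h | rfl | h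
      · exact a3 i j h hj hadj hiU hjU e' he' hne
      · exact (hadj.ne rfl).elim
      · rw [Sym2.eq_swap] at hne ⊢
        exact a3 j i h hi hadj.symm hjU hiU e' he' hne
    have same' : ∀ i j, i ≤ n' → j ≤ n' → G.Adj (g' i) (g' j) → g' i ∈ U → g' j ∈ U →
        ∀ e', e' ∉ E → e' ≠ s(g' i, g' j) → ∃ Q ∈ L₂, s(g' i, g' j) ∈ Q.edges ∧ e' ∉ Q.edges := by
      intro i j hi hj hadj hiU hjU e' he' hne
      rcases lt_trichotomy i j with h | rfl | h
      · exact b3 i j h hj hadj hiU hjU e' he' hne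
      · exact (hadj.ne rfl).elim
      · rw [Sym2.eq_swap] at hne ⊢
        exact b3 j i h hi hadj.symm hjU hiU e' he' hne
    have across : ∀ i j, i ≤ n → j ≤ n' → G.Adj (g i) (g' j) → g i ∈ U → g' j ∈ U →
        ∀ e', e' ∉ E → e' ≠ s(g i, g' j) →
        ∃ Q ∈ L₁ ++ L₂ ++ L₃, s(g i, g' j) ∈ Q.edges ∧ e' ∉ Q.edges := by
      intro i j hi hj hadj hiU hjU e' he' hne
      by_cases i0 : i = 0
      · have h : g i = g' 0 := by rw [i0, hp, hp']
        rw [h] at hadj hiU hne ⊢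
        exact hmem _ _ (Or.inr (Or.inl (same' 0 j (by omega) hj hadj hiU hjU e' he' hne)))
      by_cases i1 : i = n
      · have h : g i = g' n' := by rw [i1, hq, hq']
        rw [h] at hadj hiU hne ⊢
        exact hmem _ _ (Or.inr (Or.inl (same' n' j le_rfl hj hadj hiU hjU e' he' hne)))
      by_cases j0 : j = 0
      · have h : g' j = g 0 := by rw [j0, hp, hp']
        rw [h] at hadj hjU hne ⊢
        exact hmem _ _ (Or.inl (same i 0 hi (by omega) hadj hiU hjU e' he' hne))
      by_cases j1 : j = n'
      · have h : g' j = g n := by rw [j1, hq, hq']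
        rw [h] at hadj hjU hne ⊢
        exact hmem _ _ (Or.inl (same i n hi le_rfl hadj hiU hjU e' he' hne))
      exact hmem _ _ (Or.inr (Or.inr (c3 i j (by omega) (by omega) (by omega) (by omega) hadj hiU
        hjU e' he' hne)))
    intro e
    induction e using Sym2.ind with
    | _ v w =>
    intro hvw hvU e' he' hne
    have hv := hvU v (Sym2.mem_mk_left _ _)
    have hw := hvU w (Sym2.mem_mk_right _ _)
    rw [SimpleGraph.mem_edgeSet] at hvw
    rcases hUr v hv with ⟨i, hi, rfl⟩ | ⟨i, hi, rfl⟩ <;>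
      rcases hUr w hw with ⟨j, hj, rfl⟩ | ⟨j, hj, rfl⟩
    · exact hmem _ _ (Or.inl (same i j hi hj hvw hv hw e' he' hne))
    · exact across i j hi hj hvw hv hw e' he' hne
    · rw [Sym2.eq_swap] at hne ⊢
      exact across j i hj hi hvw.symm hw hv e' he' hne
    · exact hmem _ _ (Or.inr (Or.inl (same' i j hi hj hvw hv hw e' he' hne)))

end Theta

section Posa

variable {V : Type*} {G : SimpleGraph V}

/-- `c` runs around a cycle of `G` of length `N`. -/
structure IsCyc (G : SimpleGraph V) (c : ℕ → V) (N : ℕ) : Prop where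
  three : 3 ≤ N
  periodic : ∀ i, c (i + N) = c i
  inj : ∀ i j, i < N → j < N → c i = c j → i = j
  adj : ∀ i, G.Adj (c i) (c (i + 1))

/-- The lists obtained from `t` by rotations. -/
inductive Rotates (G : SimpleGraph V) (t : List V) : List V → Prop
  | refl : Rotates G t t
  | step {m m' : List V} {w x : V} (h : Rotates G t (m ++ w :: (m' ++ [x]))) (hwx : G.Adj w x) :
      Rotates G t (m ++ w :: (m' ++ [x]).reverse)

theorem isChain_rotate {r : V → V → Prop} (hr : ∀ a b, r a b → r b a) {m m' : List V} {w x : V}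
    (h : (m ++ w :: (m' ++ [x])).IsChain r) (hwx : r w x) :
    (m ++ w :: (m' ++ [x]).reverse).IsChain r := by
  have h' : (m' ++ [x]).reverse.IsChain r := by
    rw [List.isChain_reverse]
    rw [List.isChain_append] at h
    exact (h.2.1.tail).imp fun a b => hr a b
  rw [List.isChain_append] at h ⊢
  refine ⟨h.1, ?_, fun a ha b hb => h.2.2 a ha b ?_⟩
  · rw [List.isChain_cons]
    refine ⟨fun y hy => ?_, h'⟩
    rw [List.reverse_append] at hy
    simp only [List.reverse_cons, List.reverse_nil, List.nil_append, List.cons_append,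
      List.head?_cons, Option.mem_some_iff] at hy
    exact hy ▸ hwx
  · simpa using hb

theorem Rotates.perm {t t' : List V} (h : Rotates G t t') : t'.Perm t := by
  induction h with
  | refl => exact .refl _
  | step _ _ ih => exact (((List.reverse_perm _).cons _).append_left _).trans ih

theorem Rotates.head {t t' : List V} (h : Rotates G t t') : t'.head? = t.head? := by
  induction h with
  | refl => rfl
  | @step m m' w x _ _ ih =>
    rw [← ih]
    cases m <;> simp

theorem Rotates.isChain {l t t' : List V} (h : Rotates G t t') (hl : (l ++ t).IsChain G.Adj) :
    (l ++ t').IsChain G.Adj := by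
  induction h with
  | refl => exact hl
  | @step m m' w x _ hwx ih =>
    rw [← List.append_assoc] at ih ⊢
    exact isChain_rotate (fun _ _ h => h.symm) ih hwx

theorem exists_longest [Fintype V] (hG : G ≠ ⊥) : ∃ (l : List V) (v : V) (t : List V) (s : V),
    (l ++ v :: (t ++ [s])).IsChain G.Adj ∧ (l ++ v :: (t ++ [s])).Nodup ∧ G.Adj v s ∧
    ∀ t' x, Rotates G (v :: (t ++ [s])) (t' ++ [x]) → ∀ y, G.Adj x y → y ∈ v :: (t ++ [s]) := by
  classical
  obtain ⟨a, b, hab⟩ := SimpleGraph.ne_bot_iff_exists_adj.1 hG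
  let P : ℕ → Prop := fun n => ∃ l : List V, l.IsChain G.Adj ∧ l.Nodup ∧ l.length = n
  have hP2 : P 2 := ⟨[a, b], by simp [hab], by simp [hab.ne], rfl⟩
  have hb : ∀ n, P n → n ≤ Fintype.card V := by
    rintro n ⟨l, -, h, rfl⟩
    exact h.length_le_card
  set n := Nat.findGreatest P (Fintype.card V) with hn
  have hPn : P n := Nat.findGreatest_spec (hb 2 hP2) hP2
  have hmax : ∀ m, P m → m ≤ n := fun m hm => Nat.le_findGreatest (hb m hm) hm
  have hn2 : 2 ≤ n := hmax 2 hP2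
  let P' : ℕ → Prop := fun k => ∃ (l : List V) (v : V) (t : List V) (s : V),
    (l ++ v :: (t ++ [s])).IsChain G.Adj ∧ (l ++ v :: (t ++ [s])).Nodup ∧ G.Adj v s ∧
    (l ++ v :: (t ++ [s])).length = n ∧ t.length = k
  have hb' : ∀ k, P' k → k ≤ n := by
    rintro k ⟨l, v, t, s, -, -, -, h, h'⟩
    simp at h
    omega
  have hP0 : P' 0 := by
    obtain ⟨l, h1, h2, h3⟩ := hPn
    rcases List.eq_nil_or_concat l with rfl | ⟨l', s, rfl⟩
    · simp at h3; omega
    rcases List.eq_nil_or_concat l' with rfl | ⟨l, v, rfl⟩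
    · simp at h3; omega
    refine ⟨l, v, [], s, by simpa using h1, by simpa using h2, ?_, by simpa using h3, rfl⟩
    simp only [List.concat_eq_append, List.append_assoc, List.cons_append, List.nil_append] at h1
    rw [List.isChain_append] at h1
    simpa using h1.2.1
  obtain ⟨l, v, t, s, h1, h2, h3, h4, h5⟩ : P' (Nat.findGreatest P' n) :=
    Nat.findGreatest_spec (Nat.zero_le _) hP0
  have hmax' : ∀ m, P' m → m ≤ t.length := fun m hm =>
    h5 ▸ Nat.le_findGreatest (hb' m hm) hm
  refine ⟨l, v, t, s, h1, h2, h3, fun t' x hR y hxy => ?_⟩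
  have hc := hR.isChain h1
  have hp := hR.perm
  have hd : (l ++ (t' ++ [x])).Nodup := ((hp.append_left l).nodup_iff).2 h2
  have hlen : (l ++ (t' ++ [x])).length = n := by rw [(hp.append_left l).length_eq, h4]
  by_contra hy
  by_cases hyl : y ∈ l
  · obtain ⟨l₁, l₂, rfl⟩ := List.append_of_mem hyl
    have e : l₁ ++ y :: l₂ ++ (t' ++ [x]) = l₁ ++ y :: ((l₂ ++ t') ++ [x]) := by simp
    rw [e] at hc hd hlen
    have := hmax' _ ⟨l₁, y, l₂ ++ t', x, hc, hd, hxy.symm, hlen, rfl⟩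
    have hl := hp.length_eq
    simp at this hl
    omega
  · have : P (n + 1) := by
      refine ⟨l ++ (t' ++ [x]) ++ [y], ?_, ?_, by rw [List.length_append, hlen]; rfl⟩
      · rw [List.isChain_append]
        refine ⟨hc, by simp, fun a ha b hb => ?_⟩
        rw [← List.append_assoc, List.getLast?_concat] at ha
        simp only [Option.mem_some_iff, List.head?_cons] at ha hb
        exact ha ▸ hb ▸ hxy
      · rw [List.nodup_append]
        refine ⟨hd, by simp, fun a ha b hb => ?_⟩
        rintro rfl
        rw [List.mem_singleton] at hb
        subst hb
        rcases List.mem_append.1 ha with h | h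
        · exact hyl h
        · exact hy (hp.mem_iff.1 h)
    have := hmax _ this
    omega

/-- `b` comes right after `a` on `t`. -/
def Next (t : List V) (a b : V) : Prop := ∃ p q, t = p ++ a :: b :: q

theorem Next.unique {t : List V} (ht : t.Nodup) {a b b' : V} (h : Next t a b) (h' : Next t a b') :
    b = b' := by
  obtain ⟨p, q, rfl⟩ := h
  obtain ⟨p', q', h⟩ := h'
  rw [List.nodup_append, List.nodup_cons] at ht
  have := (List.append_cons_inj_of_notMem (fun h => ht.2.2 a h a (by simp) rfl) ht.2.1.1).1 h
  exact (List.cons.inj this.2.2).1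

theorem Next.unique' {t : List V} (ht : t.Nodup) {a a' b : V} (h : Next t a b) (h' : Next t a' b) :
    a = a' := by
  have key : ∀ {a : V}, Next t a b → Next t.reverse b a := by
    rintro a ⟨p, q, rfl⟩
    exact ⟨q.reverse, p.reverse, by simp⟩
  exact Next.unique (List.nodup_reverse.2 ht) (key h) (key h')

/-- The vertices at the ends of rotations of `t`. -/
def ends (G : SimpleGraph V) (t : List V) : Set V := {x | ∃ t', Rotates G t (t' ++ [x])}

theorem Rotates.isChain_next {t t' : List V} (h : Rotates G t t') :
    t'.IsChain fun a b => ∀ c, c = a ∨ c = b →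
      (∀ x ∈ ends G t, c ≠ x ∧ ¬ Next t c x ∧ ¬ Next t x c) → Next t a b ∨ Next t b a := by
  induction h with
  | refl =>
    rw [List.isChain_iff_forall_rel_of_append_cons_cons]
    intro a b p q h c _ _
    exact Or.inl ⟨p, q, h⟩
  | @step m m' w x hR hwx ih =>
    refine isChain_rotate (fun a b h c hc h' => Or.symm (h c hc.symm h')) ih ?_
    rintro c (rfl | rfl) hc
    · exfalso
      have hstep := hR.step hwx
      obtain ⟨z, m'', hz⟩ : ∃ z m'', m' ++ [x] = z :: m'' := by
        cases m' with
        | nil => exact ⟨x, [], rfl⟩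
        | cons z m' => exact ⟨z, m' ++ [x], rfl⟩
      rw [hz] at hstep ih
      have hz' : z ∈ ends G t := ⟨m ++ c :: m''.reverse, by simpa using hstep⟩
      rw [List.isChain_iff_forall_rel_of_append_cons_cons] at ih
      have := ih rfl c (Or.inl rfl) hc
      have h' := hc z hz'
      tauto
    · exact ((hc c ⟨m ++ w :: m', by simpa using hR⟩).1 rfl).elim

theorem exists_posa [Fintype V] [DecidableEq V] (hG : G ≠ ⊥) : ∃ S : Finset V, S.Nonempty ∧
    ((∃ x y, S = {x} ∧ G.Adj x y ∧ ∀ z, G.Adj x z → z = y) ∨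
      ∃ (N : ℕ) (c : ℕ → V) (U : Finset V), IsCyc G c N ∧ S ⊆ U ∧
        (∀ x ∈ S, ∀ y, G.Adj x y → y ∈ U) ∧ U.card ≤ 3 * S.card ∧ ∀ u ∈ U, ∃ i, c i = u) := by
  classical
  obtain ⟨l, v, t₀, s, hc, hd, hvs, hmem⟩ := exists_longest hG
  set t := v :: (t₀ ++ [s]) with ht
  have htd : t.Nodup := (List.nodup_append.1 hd).2.1
  have htc : t.IsChain G.Adj := (List.isChain_append.1 hc).2.1
  rcases Nat.eq_zero_or_pos t₀.length with h0 | h0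
  · rw [List.length_eq_zero_iff] at h0
    subst h0
    refine ⟨{s}, by simp, Or.inl ⟨s, v, rfl, hvs.symm, fun z hz => ?_⟩⟩
    have := hmem [v] s (by simpa [ht] using Rotates.refl) z hz
    simp only [ht, List.nil_append, List.mem_cons, List.not_mem_nil, or_false] at this
    exact this.resolve_right hz.ne'
  have hlen : t.length = t₀.length + 2 := by simp [ht]
  have hsub : ∀ x ∈ ends G t, x ∈ t := by
    rintro x ⟨t', h⟩
    exact h.perm.mem_iff.1 (by simp)
  set S : Finset V := t.toFinset.filter (· ∈ ends G t) with hS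
  have hSm : ∀ x, x ∈ S ↔ x ∈ ends G t := by
    intro x
    simp only [hS, Finset.mem_filter, List.mem_toFinset]
    exact ⟨fun h => h.2, fun h => ⟨hsub x h, h⟩⟩
  have hnext : ∀ z, ∃ w, ∀ w', Next t z w' → w' = w := by
    intro z
    by_cases h : ∃ w, Next t z w
    · exact h.imp fun w h w' h' => Next.unique htd h' h
    · exact ⟨z, fun w' h' => (h ⟨w', h'⟩).elim⟩
  have hprev : ∀ z, ∃ w, ∀ w', Next t w' z → w' = w := by
    intro z
    by_cases h : ∃ w, Next t w z
    · exact h.imp fun w h w' h' => Next.unique' htd h' h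
    · exact ⟨z, fun w' h' => (h ⟨w', h'⟩).elim⟩
  choose f hf using hnext
  choose f' hf' using hprev
  have hvend : ∀ x ∈ S, ∀ y, G.Adj x y → y ∈ t := fun x hx y hxy => by
    obtain ⟨t', h⟩ := (hSm x).1 hx
    exact hmem t' x h y hxy
  refine ⟨S, ⟨s, (hSm s).2 ⟨v :: t₀, by simpa [ht] using Rotates.refl⟩⟩, Or.inr
    ⟨t.length, fun i => t.getD (i % t.length) v, (S ∪ S.image f ∪ S.image f').filter (· ∈ t),
      ⟨by omega, fun i => by simp, fun i j hi hj h => ?_, fun i => ?_⟩, fun x hx => ?_,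
      fun x hx y hxy => ?_, ?_, fun u hu => ?_⟩⟩
  · simp only [Nat.mod_eq_of_lt hi, Nat.mod_eq_of_lt hj, List.getD_eq_getElem, hi, hj] at h
    exact (List.Nodup.getElem_inj_iff htd).1 h
  · have hpos : 0 < t.length := by omega
    have h1 := Nat.mod_lt i hpos
    rcases Nat.lt_or_ge (i % t.length + 1) t.length with h2 | h2
    · have e : (i + 1) % t.length = i % t.length + 1 := by
        rw [Nat.add_mod, Nat.mod_eq_of_lt (by omega : 1 < t.length), Nat.mod_eq_of_lt h2]
      simp only [e]
      rw [List.getD_eq_getElem _ _ h1, List.getD_eq_getElem _ _ h2]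
      exact (List.isChain_iff_getElem.1 htc) _ h2
    · have e : (i + 1) % t.length = 0 := by
        rw [Nat.add_mod, Nat.mod_eq_of_lt (by omega : 1 < t.length),
          show i % t.length + 1 = t.length by omega, Nat.mod_self]
      have e' : i % t.length = t₀.length + 1 := by omega
      simp only [e, e']
      simpa [ht] using hvs.symm
  · simp only [Finset.mem_filter, Finset.mem_union]
    exact ⟨Or.inl (Or.inl hx), hsub x ((hSm x).1 hx)⟩
  · simp only [Finset.mem_filter, Finset.mem_union, Finset.mem_image]
    refine ⟨?_, hvend x hx y hxy⟩
    by_contra hcon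
    obtain ⟨t', h⟩ := (hSm x).1 hx
    have hy : y ∈ t' := by
      have := h.perm.mem_iff.2 (hvend x hx y hxy)
      rw [List.mem_append, List.mem_singleton] at this
      exact this.resolve_right hxy.ne'
    obtain ⟨m, m', rfl⟩ := List.append_of_mem hy
    have hbad : ∀ x ∈ ends G t, y ≠ x ∧ ¬ Next t y x ∧ ¬ Next t x y := by
      intro z hz
      rw [← hSm] at hz
      refine ⟨fun h => hcon (Or.inl (Or.inl (h ▸ hz))), fun h => ?_, fun h => ?_⟩
      · exact hcon (Or.inr ⟨z, hz, (hf' z y h).symm⟩)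
      · exact hcon (Or.inl (Or.inr ⟨z, hz, (hf z y h).symm⟩))
    have hR : Rotates G t (m ++ y :: (m' ++ [x])) := by simpa using h
    have hstep := hR.step hxy.symm
    have hch := hR.isChain_next
    obtain ⟨z, m'', hz⟩ : ∃ z m'', m' ++ [x] = z :: m'' := by
      cases m' with
      | nil => exact ⟨x, [], rfl⟩
      | cons z m' => exact ⟨z, m' ++ [x], rfl⟩
    rw [hz] at hstep hch
    have hz' : z ∈ ends G t := ⟨m ++ y :: m''.reverse, by simpa using hstep⟩
    rw [List.isChain_iff_forall_rel_of_append_cons_cons] at hch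
    have := hch rfl y (Or.inl rfl) hbad
    have h' := hbad z hz'
    tauto
  · refine (Finset.card_filter_le _ _).trans ((Finset.card_union_le _ _).trans ?_)
    have h1 := Finset.card_union_le S (S.image f)
    have h2 := Finset.card_image_le (s := S) (f := f)
    have h3 := Finset.card_image_le (s := S) (f := f')
    omega
  · obtain ⟨i, hi, rfl⟩ := List.getElem_of_mem (Finset.mem_filter.1 hu).2
    exact ⟨i, by simp [Nat.mod_eq_of_lt hi, hi]⟩

end Posa

section Connect

variable {V : Type*} [Fintype V] {G : SimpleGraph V} {C W : Set V}

theorem three_le_card_inter [DecidableEq V] (hG : ThreeConnected G) {A B : Finset V}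
    (h : IsSep G Finset.univ A B) {y w : Fin 3 → V} (hy : Function.Injective y)
    (hw : Function.Injective w) (hyA : ∀ k, y k ∈ A) (hwB : ∀ k, w k ∈ B) : 3 ≤ (A ∩ B).card := by
  by_contra hlt
  push Not at hlt
  have key : ∀ {x : Fin 3 → V}, Function.Injective x → ∃ k, x k ∉ A ∩ B := by
    intro x hx
    by_contra hcon
    push Not at hcon
    have := Finset.card_le_card_of_injOn (s := Finset.univ) (t := A ∩ B) x
      (fun k _ => hcon k) hx.injOn
    simp at this
    omega
  obtain ⟨i, hi⟩ := key hy
  obtain ⟨j, hj⟩ := key hw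
  have hcon := hG.2 (A ∩ B : Finset V) (by rw [Set.ncard_coe_finset]; exact hlt)
  obtain ⟨p⟩ := hcon.preconnected ⟨y i, by simpa using hi⟩ ⟨w j, by simpa using hj⟩
  have hiB : y i ∉ B := fun h => hi (Finset.mem_inter.2 ⟨hyA i, h⟩)
  obtain ⟨d, -, h1, h2⟩ := p.exists_boundary_dart {v | (v : V) ∉ B} hiB (fun h => h (hwB j))
  have hadj : G.Adj d.fst.1 d.snd.1 := d.adj
  have h1' : d.fst.1 ∉ B := h1
  have h2' : d.snd.1 ∈ B := not_not.1 h2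
  have h3 : d.snd.1 ∉ A := fun h => d.snd.2 (by simpa using ⟨h, h2'⟩)
  exact h.2 _ ((h.mem (Finset.mem_univ _)).resolve_right h1') _ h2' h1' h3 hadj

theorem exists_trimmed_path {γ : Type*} {f : V → γ} {y z : V}
    (h : ReflTransGen (Step G Finset.univ f) y z) (hy : y ∈ C) (hz : z ∈ W) :
    ∃ (p u : V) (R : G.Walk p u), R.IsPath ∧ p ∈ C ∧ u ∈ W ∧
      (∀ v ∈ R.support, v ∈ C → v = p) ∧ (∀ v ∈ R.support, v ∈ W → v = u) ∧
      ∀ v ∈ R.support, f v = f y := by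
  classical
  let P : ℕ → Prop := fun n => ∃ (p u : V) (R : G.Walk p u), p ∈ C ∧ u ∈ W ∧
    (∀ v ∈ R.support, f v = f y) ∧ R.length = n
  have hP : ∃ n, P n := by
    obtain ⟨R, hR⟩ := exists_walk_of_reach h
    exact ⟨_, y, z, R, hy, hz, fun v hv => (hR v hv).2, rfl⟩
  obtain ⟨p, u, R, hp, hu, hf, hl⟩ := Nat.find_spec hP
  have hmin : ∀ m, P m → R.length ≤ m := fun m hm => hl ▸ Nat.find_min' hP hm
  have hsub := R.support_bypass_subset_support
  refine ⟨p, u, R.bypass, R.bypass_isPath, hp, hu, fun v hv hvC => ?_, fun v hv hvW => ?_,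
    fun v hv => hf v (hsub hv)⟩
  · obtain ⟨q, r, rfl⟩ := Walk.mem_support_iff_exists_append.1 (hsub hv)
    have := hmin _ ⟨v, u, r, hvC, hu, fun x hx => hf x (mem_support_append.2 (Or.inr hx)), rfl⟩
    rw [Walk.length_append] at this
    exact (Walk.eq_of_length_eq_zero (p := q) (by omega)).symm
  · obtain ⟨q, r, rfl⟩ := Walk.mem_support_iff_exists_append.1 (hsub hv)
    have := hmin _ ⟨p, v, q, hp, hvW, fun x hx => hf x (mem_support_append.2 (Or.inl hx)), rfl⟩
    rw [Walk.length_append] at this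
    exact Walk.eq_of_length_eq_zero (p := r) (by omega)

theorem exists_three_paths (hG : ThreeConnected G) {y w : Fin 3 → V} (hy : Function.Injective y)
    (hw : Function.Injective w) (hyC : ∀ k, y k ∈ C) (hwW : ∀ k, w k ∈ W) :
    ∃ (p u : Fin 3 → V) (R : ∀ k, G.Walk (p k) (u k)), (∀ k, (R k).IsPath) ∧
      (∀ k, p k ∈ C) ∧ (∀ k, u k ∈ W) ∧ (∀ k, ∀ v ∈ (R k).support, v ∈ C → v = p k) ∧
      (∀ k, ∀ v ∈ (R k).support, v ∈ W → v = u k) ∧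
      ∀ k k' v, v ∈ (R k).support → v ∈ (R k').support → k = k' := by
  classical
  obtain ⟨g, hg, hp⟩ := menger G _ Finset.univ (Finset.univ.image y)
    (Finset.univ.filter (· ∈ W)) rfl (Finset.subset_univ _) (Finset.subset_univ _)
    (fun A B h hA hB => by
      rw [Finset.card_image_of_injective _ hy, Finset.card_univ, Fintype.card_fin]
      exact three_le_card_inter hG h hy hw (fun k => hA (by simp)) (fun k => hB (by simp [hwW])))
  have key : ∀ k, ∃ (p u : V) (R : G.Walk p u), R.IsPath ∧ p ∈ C ∧ u ∈ W ∧
      (∀ v ∈ R.support, v ∈ C → v = p) ∧ (∀ v ∈ R.support, v ∈ W → v = u) ∧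
      ∀ v ∈ R.support, g v = y k := by
    intro k
    obtain ⟨z, hz, -, hr⟩ := hp (y k) (by simp)
    have := exists_trimmed_path hr (hyC k) (by simpa using hz)
    rwa [hg (y k) (by simp)] at this
  choose p u R h1 h2 h3 h4 h5 h6 using key
  exact ⟨p, u, R, h1, h2, h3, h4, h5, fun k k' v hv hv' => hy ((h6 k v hv).symm.trans (h6 k' v hv'))⟩

end Connect

section Cycle

variable {V : Type*} {G : SimpleGraph V} {c : ℕ → V} {N : ℕ}

/-- The edges of the cycle traced by `c`. -/
def cycEdges (c : ℕ → V) : Set (Sym2 V) := {e | ∃ i, e = s(c i, c (i + 1))}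

theorem IsCyc.apply_mod (h : IsCyc G c N) (i : ℕ) : c (i % N) = c i := by
  have key : ∀ k i, c (i + N * k) = c i := by
    intro k
    induction k with
    | zero => intro i; rfl
    | succ k ih => intro i; rw [Nat.mul_succ, ← Nat.add_assoc, h.periodic, ih]
  conv_rhs => rw [← Nat.mod_add_div i N, key]

theorem IsCyc.eq_of_window (h : IsCyc G c N) {a i j : ℕ} (hi : a ≤ i) (hi' : i < a + N) (hj : a ≤ j)
    (hj' : j < a + N) (hij : c i = c j) : i = j := by
  have hN : 0 < N := by have := h.three; omega
  rw [← h.apply_mod i, ← h.apply_mod j] at hij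
  have hm := h.inj _ _ (Nat.mod_lt _ hN) (Nat.mod_lt _ hN) hij
  rcases le_total i j with hle | hle
  · have := Nat.eq_zero_of_dvd_of_lt ((Nat.modEq_iff_dvd' hle).1 hm) (by omega)
    omega
  · have := Nat.eq_zero_of_dvd_of_lt ((Nat.modEq_iff_dvd' hle).1 hm.symm) (by omega)
    omega

theorem IsCyc.exists_shift (h : IsCyc G c N) (a i : ℕ) : ∃ k, k < N ∧ c i = c (a + k) := by
  have hN : 0 < N := by have := h.three; omega
  induction a with
  | zero => exact ⟨i % N, Nat.mod_lt _ hN, by rw [Nat.zero_add, h.apply_mod]⟩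
  | succ a ih =>
    obtain ⟨k, hk, hik⟩ := ih
    rcases Nat.eq_zero_or_pos k with rfl | hk0
    · refine ⟨N - 1, by omega, ?_⟩
      rw [hik, show a + 1 + (N - 1) = a + 0 + N by omega, h.periodic]
    · exact ⟨k - 1, by omega, by rw [hik, show a + 1 + (k - 1) = a + k by omega]⟩

theorem IsCyc.exists_list_paths [DecidableEq V] (h : IsCyc G c N) {a t m : ℕ} (ht : 0 < t)
    (htN : t < N) {U : Finset V} (hUc : ∀ u ∈ U, ∃ i, c i = u) (hU : U.card ≤ m) (hm : 1 ≤ m) :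
    ∃ L : List (G.Walk (c a) (c (a + t))), L.length ≤ 100 * m ∧
      (∀ Q ∈ L, Q.IsPath ∧ ∀ v ∈ Q.support, v ∈ Set.range c) ∧
      ∀ e ∈ G.edgeSet, (∀ v ∈ e, v ∈ U) → ∀ e', e' ∉ cycEdges c → e' ≠ e →
        ∃ Q ∈ L, e ∈ Q.edges ∧ e' ∉ Q.edges := by
  have hg : IsRail G (fun i => c (a + i)) 0 t := by
    refine ⟨fun i j _ hi _ hj hij => ?_, fun i _ _ => h.adj (a + i)⟩
    have := h.eq_of_window (a := a) (by omega) (by omega) (by omega) (by omega) hij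
    omega
  have hstep : ∀ i, i < N - t → a + N - i = a + N - (i + 1) + 1 := fun i hi => by omega
  have hg' : IsRail G (fun i => c (a + N - i)) 0 (N - t) := by
    refine ⟨fun i j _ hi _ hj hij => ?_, fun i _ hi => ?_⟩
    · have := h.eq_of_window (a := a + t) (by omega) (by omega) (by omega) (by omega) hij
      omega
    · rw [hstep i hi]
      exact (h.adj _).symm
  obtain ⟨L, h1, h2, h3⟩ := exists_list_theta (p := c a) (q := c (a + t)) (m := m) (U := U)
    (g := fun i => c (a + i)) (g' := fun i => c (a + N - i)) rfl (by simpa using h.periodic a) rfl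
    (by congr 1; omega) hg hg' ht
    (fun i j hi hj hij => by
      rcases Nat.eq_zero_or_pos j with rfl | hj0
      · rw [Nat.sub_zero, h.periodic] at hij
        have := h.eq_of_window (a := a) (by omega) (by omega) (by omega) (by omega) hij
        omega
      · have := h.eq_of_window (a := a) (by omega) (by omega) (by omega) (by omega) hij
        omega) hU hm (E := cycEdges c) (fun i _ => ⟨a + i, rfl⟩)
    (fun i hi => ⟨a + N - (i + 1), by rw [Sym2.eq_swap, hstep i hi]⟩)
    (fun v hv => by
      obtain ⟨i, rfl⟩ := hUc v hv
      obtain ⟨k, hk, hik⟩ := h.exists_shift a i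
      rcases le_total k t with hkt | hkt
      · exact Or.inl ⟨k, hkt, hik.symm⟩
      · refine Or.inr ⟨N - k, by omega, ?_⟩
        rw [hik, show a + N - (N - k) = a + k by omega])
  refine ⟨L, h1, fun Q hQ => ⟨(h2 Q hQ).1, fun v hv => ?_⟩, h3⟩
  rcases (h2 Q hQ).2 v hv with ⟨i, -, rfl⟩ | ⟨i, -, rfl⟩
  exacts [⟨_, rfl⟩, ⟨_, rfl⟩]

variable {α κ : Type*} [Fintype α] [Fintype κ] {H : SimpleGraph α} {b : κ → V} {I : Sym2 κ → Set V}

theorem IsTK.exists_list_of_cycle_of_paths (h : IsTK G b I) (hH : H.edgeSet.Nonempty)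
    (hcard : Fintype.card α + 2 ≤ Fintype.card κ) (hc : IsCyc G c N)
    (hdisj : Disjoint (Set.range c) (tkVerts b I)) {m : ℕ} {U : Finset V}
    (hUc : ∀ u ∈ U, ∃ i, c i = u) (hU : U.card ≤ m) (hm : 1 ≤ m) {p p' u u' : V} {R : G.Walk p u}
    {R' : G.Walk p' u'} (hR : R.IsPath) (hR' : R'.IsPath) (hp : p ∈ Set.range c)
    (hp' : p' ∈ Set.range c) (hu : u ∈ tkVerts b I) (hu' : u' ∈ tkVerts b I)
    (hRc : ∀ v ∈ R.support, v ∈ Set.range c → v = p)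
    (hRc' : ∀ v ∈ R'.support, v ∈ Set.range c → v = p')
    (hRW : ∀ v ∈ R.support, v ∈ tkVerts b I → v = u)
    (hRW' : ∀ v ∈ R'.support, v ∈ tkVerts b I → v = u')
    (hRR : ∀ v ∈ R.support, v ∉ R'.support) :
    ∃ L : List G.Subgraph, L.length ≤ 100 * m ∧ (∀ A ∈ L, IsSubdivision H A.coe) ∧
      ∀ e ∈ G.edgeSet, (∀ v ∈ e, v ∈ U) → ∀ e', e' ∉ cycEdges c → ¬ (∀ v ∈ e', v ∈ tkVerts b I) →
        e' ≠ e → e' ∉ R.edges → e' ∉ R'.edges → ∃ A ∈ L, e ∈ A.edgeSet ∧ e' ∉ A.edgeSet := by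
  classical
  obtain ⟨a, rfl⟩ := hp
  obtain ⟨a', rfl⟩ := hp'
  obtain ⟨t, htN, hat⟩ := hc.exists_shift a a'
  have ht : 0 < t := by
    rcases Nat.eq_zero_or_pos t with rfl | h0
    · refine (hRR _ R.start_mem_support ?_).elim
      rw [Nat.add_zero] at hat
      exact hat ▸ R'.start_mem_support
    · exact h0
  generalize c a' = q at *
  subst hat
  obtain ⟨L, h1, h2, h3⟩ := hc.exists_list_paths ht htN hUc hU hm (a := a)
  have key : ∀ Q : G.Walk (c a) (c (a + t)), ∃ A : G.Subgraph, Q ∈ L → IsSubdivision H A.coe ∧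
      (∀ e ∈ Q.edges, e ∈ A.edgeSet) ∧ ∀ e ∈ A.edgeSet, e ∈ R.edges ∨ e ∈ Q.edges ∨ e ∈ R'.edges ∨
        ∀ v ∈ e, v ∈ tkVerts b I := by
    intro Q
    by_cases hQ : Q ∈ L
    · have hW : ∀ v ∈ Q.support, v ∉ tkVerts b I := fun v hv hv' =>
        Set.disjoint_left.1 hdisj ((h2 Q hQ).2 v hv) hv'
      obtain ⟨A, hA, hA1, hA2⟩ := h.exists_isSubdivision_of_ear hH hcard hu hu'
        (fun e => hRR u R.end_mem_support (e ▸ R'.end_mem_support))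
        (Q := (R.reverse.append Q).append R')
        (by
          refine isPath_append_iff.2 ⟨isPath_append_iff.2 ⟨hR.reverse, (h2 Q hQ).1, ?_⟩, hR', ?_⟩
          · intro x hx hxQ
            exact hRc x (by simpa using hx) ((h2 Q hQ).2 x hxQ)
          · intro x hx hx'
            rcases mem_support_append.1 hx with hx | hx
            · exact (hRR x (by simpa using hx) hx').elim
            · exact hRc' x hx' ((h2 Q hQ).2 x hx))
        (fun v hv hvW => by
          rcases mem_support_append.1 hv with hv | hv
          · rcases mem_support_append.1 hv with hv | hv
            · exact Or.inl (hRW v (by simpa using hv) hvW)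
            · exact (hW v hv hvW).elim
          · exact Or.inr (hRW' v hv hvW))
      refine ⟨A, fun _ => ⟨hA, fun e he => hA1 e ?_, fun e he => ?_⟩⟩
      · exact mem_edges_append.2 (Or.inl (mem_edges_append.2 (Or.inr he)))
      · rcases hA2 e he with he | he
        · rcases mem_edges_append.1 he with he | he
          · rcases mem_edges_append.1 he with he | he
            · exact Or.inl (by simpa using he)
            · exact Or.inr (Or.inl he)
          · exact Or.inr (Or.inr (Or.inl he))
        · exact Or.inr (Or.inr (Or.inr he))
    · exact ⟨⊥, fun h => (hQ h).elim⟩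
  choose A hA using key
  refine ⟨L.map A, by simpa using h1, fun B hB => ?_, fun e he heU e' he1 he2 he3 he4 he5 => ?_⟩
  · obtain ⟨Q, hQ, rfl⟩ := List.mem_map.1 hB
    exact (hA Q hQ).1
  · obtain ⟨Q, hQ, q1, q2⟩ := h3 e he heU e' he1 he3
    refine ⟨A Q, List.mem_map_of_mem hQ, (hA Q hQ).2.1 e q1, fun hcon => ?_⟩
    rcases (hA Q hQ).2.2 e' hcon with h | h | h | h
    exacts [he4 h, q2 h, he5 h, he2 h]

theorem IsTK.exists_list_of_cycle [Fintype V] (h : IsTK G b I) (hG : ThreeConnected G)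
    (hH : H.edgeSet.Nonempty)
    (hcard : Fintype.card α + 2 ≤ Fintype.card κ) (hc : IsCyc G c N)
    (hdisj : Disjoint (Set.range c) (tkVerts b I)) {m : ℕ} {U : Finset V}
    (hUc : ∀ u ∈ U, ∃ i, c i = u) (hU : U.card ≤ m) (hm : 1 ≤ m) :
    ∃ L : List G.Subgraph, L.length ≤ 300 * m ∧ (∀ A ∈ L, IsSubdivision H A.coe) ∧
      ∀ e ∈ G.edgeSet, (∀ v ∈ e, v ∈ U) → ∀ e', e' ∉ cycEdges c → ¬ (∀ v ∈ e', v ∈ tkVerts b I) →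
        e' ≠ e → ∃ A ∈ L, e ∈ A.edgeSet ∧ e' ∉ A.edgeSet := by
  classical
  have hN := hc.three
  have hα : 1 ≤ Fintype.card α := by
    obtain ⟨e, -⟩ := hH
    induction e with | h x y => exact Fintype.card_pos_iff.2 ⟨x⟩
  obtain ⟨w⟩ : Nonempty (Fin 3 ↪ κ) :=
    Function.Embedding.nonempty_of_card_le (by simp; omega)
  obtain ⟨p, u, R, h1, h2, h3, h4, h5, h6⟩ := exists_three_paths hG (C := Set.range c)
    (W := tkVerts b I) (y := fun k => c k) (w := b ∘ w)
    (fun i j hij => Fin.ext (hc.inj i j (by omega) (by omega) hij))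
    (h.inj.comp w.injective) (fun k => ⟨_, rfl⟩) (fun k => Or.inl ⟨_, rfl⟩)
  have key : ∀ k k', k ≠ k' → ∃ L : List G.Subgraph, L.length ≤ 100 * m ∧
      (∀ A ∈ L, IsSubdivision H A.coe) ∧
      ∀ e ∈ G.edgeSet, (∀ v ∈ e, v ∈ U) → ∀ e', e' ∉ cycEdges c → ¬ (∀ v ∈ e', v ∈ tkVerts b I) →
        e' ≠ e → e' ∉ (R k).edges → e' ∉ (R k').edges → ∃ A ∈ L, e ∈ A.edgeSet ∧ e' ∉ A.edgeSet :=
    fun k k' hk => h.exists_list_of_cycle_of_paths hH hcard hc hdisj hUc hU hm (h1 k) (h1 k')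
      (h2 k) (h2 k') (h3 k) (h3 k') (h4 k) (h4 k') (h5 k) (h5 k')
      (fun v hv hv' => hk (h6 k k' v hv hv'))
  have hone : ∀ e' k k', e' ∈ (R k).edges → e' ∈ (R k').edges → k = k' := by
    intro e' k k' he he'
    induction e' with
    | h x y =>
      exact h6 k k' x (Walk.fst_mem_support_of_mem_edges _ he)
        (Walk.fst_mem_support_of_mem_edges _ he')
  obtain ⟨L₁, a1, a2, a3⟩ := key 0 1 (by decide)
  obtain ⟨L₂, b1, b2, b3⟩ := key 0 2 (by decide)
  obtain ⟨L₃, c1, c2, c3⟩ := key 1 2 (by decide)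
  refine ⟨L₁ ++ L₂ ++ L₃, by simp only [List.length_append]; omega, fun A hA => ?_,
    fun e he heU e' q1 q2 q3 => ?_⟩
  · simp only [List.mem_append] at hA
    rcases hA with (hA | hA) | hA
    exacts [a2 A hA, b2 A hA, c2 A hA]
  · simp only [List.mem_append]
    have f01 : ¬ (e' ∈ (R 0).edges ∧ e' ∈ (R 1).edges) := fun h =>
      absurd (hone e' 0 1 h.1 h.2) (by decide)
    have f02 : ¬ (e' ∈ (R 0).edges ∧ e' ∈ (R 2).edges) := fun h =>
      absurd (hone e' 0 2 h.1 h.2) (by decide)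
    by_cases r0 : e' ∈ (R 0).edges
    · obtain ⟨A, hA, hA'⟩ := c3 e he heU e' q1 q2 q3 (fun h => f01 ⟨r0, h⟩) (fun h => f02 ⟨r0, h⟩)
      exact ⟨A, Or.inr hA, hA'⟩
    · by_cases r1 : e' ∈ (R 1).edges
      · obtain ⟨A, hA, hA'⟩ := b3 e he heU e' q1 q2 q3 r0
          (fun h => absurd (hone e' 1 2 r1 h) (by decide))
        exact ⟨A, Or.inl (Or.inr hA), hA'⟩
      · obtain ⟨A, hA, hA'⟩ := a3 e he heU e' q1 q2 q3 r0 r1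
        exact ⟨A, Or.inl (Or.inl hA), hA'⟩

end Cycle

section Induction

variable {V : Type*} {G Γ Γ₀ : SimpleGraph V}

/-- The subgraphs in `L` separate the edges in `E` from those in `T`. -/
def Separates (L : List G.Subgraph) (E T : Set (Sym2 V)) : Prop :=
  ∀ e ∈ E, ∀ e' ∈ T, e' ≠ e → ∃ A ∈ L, e ∈ A.edgeSet ∧ e' ∉ A.edgeSet

theorem Separates.mono {L L' : List G.Subgraph} {E E' T T' : Set (Sym2 V)} (h : Separates L E T)
    (hL : L ⊆ L') (hE : E' ⊆ E) (hT : T' ⊆ T) : Separates L' E' T' :=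
  fun e he e' he' hne => (h e (hE he) e' (hT he') hne).imp fun _ hA => ⟨hL hA.1, hA.2⟩

/-- At cost `k`, the edges in `E` are separated from those in `T` by subgraphs with property `P`,
up to some exceptional edges. -/
def SeparableAtCost (G : SimpleGraph V) (P : G.Subgraph → Prop) (E T : Set (Sym2 V)) (k : ℕ) :
    Prop :=
  ∃ (L : List G.Subgraph) (J : List (Sym2 V)), L.length + J.length ≤ k ∧ (∀ A ∈ L, P A) ∧
    (∀ e ∈ J, e ∈ E) ∧ Separates L {e | e ∈ E ∧ e ∉ J} T

variable {P : G.Subgraph → Prop} {E E' T T' : Set (Sym2 V)} {k k' : ℕ}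

theorem SeparableAtCost.union (h : SeparableAtCost G P E T k) (h' : SeparableAtCost G P E' T k') :
    SeparableAtCost G P (E ∪ E') T (k + k') := by
  obtain ⟨L, J, h1, h2, h3, h4⟩ := h
  obtain ⟨L', J', h1', h2', h3', h4'⟩ := h'
  refine ⟨L ++ L', J ++ J', ?_, fun A hA => ?_, fun e he => ?_, ?_⟩
  · simp only [List.length_append]
    omega
  · exact (List.mem_append.1 hA).elim (h2 A) (h2' A)
  · exact (List.mem_append.1 he).imp (h3 e) (h3' e)
  · rintro e ⟨he, heJ⟩ e' he' hne
    rw [List.mem_append, not_or] at heJ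
    rcases he with he | he
    · obtain ⟨A, hA, hA'⟩ := h4 e ⟨he, heJ.1⟩ e' he' hne
      exact ⟨A, List.mem_append_left _ hA, hA'⟩
    · obtain ⟨A, hA, hA'⟩ := h4' e ⟨he, heJ.2⟩ e' he' hne
      exact ⟨A, List.mem_append_right _ hA, hA'⟩

theorem SeparableAtCost.mono (h : SeparableAtCost G P E T k) (hT : T' ⊆ T) (hk : k ≤ k') :
    SeparableAtCost G P E T' k' := by
  obtain ⟨L, J, h1, h2, h3, h4⟩ := h
  exact ⟨L, J, h1.trans hk, h2, h3, h4.mono (fun _ h => h) subset_rfl hT⟩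

theorem separableAtCost_list (J : List (Sym2 V)) (hJ : ∀ e, e ∈ J ↔ e ∈ E) (hk : J.length ≤ k) :
    SeparableAtCost G P E T k :=
  ⟨[], J, by simpa using hk, by simp, fun e he => (hJ e).1 he,
    fun e he => (he.2 ((hJ e).2 he.1)).elim⟩

/-- The edges of `G` meeting `S`. -/
def incidentEdges (G : SimpleGraph V) (S : Finset V) : Set (Sym2 V) :=
  {e | e ∈ G.edgeSet ∧ ∃ v ∈ e, v ∈ S}

theorem separableAtCost_edgeSet [DecidableEq V] {k : ℕ}
    (hstep : ∀ Γ ≤ Γ₀, Γ ≠ ⊥ → ∃ S : Finset V, S.Nonempty ∧ (∀ x ∈ S, ∃ y, Γ.Adj x y) ∧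
      SeparableAtCost G P (incidentEdges Γ S) T (k * S.card)) :
    ∀ (n : ℕ) (Y : Finset V) (Γ : SimpleGraph V), Y.card = n → Γ ≤ Γ₀ →
      (∀ x y, Γ.Adj x y → x ∈ Y) → SeparableAtCost G P Γ.edgeSet T (k * n) := by
  intro n
  induction n using Nat.strong_induction_on with
  | _ n ih =>
    intro Y Γ hY hΓ hsupp
    by_cases hbot : Γ = ⊥
    · subst hbot
      exact separableAtCost_list [] (by simp) (by simp)
    obtain ⟨S, hS, hSadj, hsep⟩ := hstep Γ hΓ hbot
    have hSY : S ⊆ Y := fun x hx => by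
      obtain ⟨y, hy⟩ := hSadj x hx
      exact hsupp x y hy
    let Γ' : SimpleGraph V :=
      { Adj := fun x y => Γ.Adj x y ∧ x ∉ S ∧ y ∉ S
        symm := ⟨fun x y h => ⟨h.1.symm, h.2.2, h.2.1⟩⟩
        loopless := ⟨fun x h => Γ.loopless.irrefl x h.1⟩ }
    have hle : Γ' ≤ Γ := fun x y h => h.1
    have hcard : (Y \ S).card + S.card = n := by
      rw [Finset.card_sdiff_add_card_eq_card hSY, hY]
    have hpos := hS.card_pos
    have h := hsep.union (ih (Y \ S).card (by omega) (Y \ S) Γ' rfl (hle.trans hΓ)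
      (fun x y h => Finset.mem_sdiff.2 ⟨hsupp x y h.1, h.2.1⟩))
    have hE : incidentEdges Γ S ∪ Γ'.edgeSet = Γ.edgeSet := by
      ext e
      induction e with
      | h x y =>
        simp only [incidentEdges, Set.mem_union, Set.mem_ofPred_eq, SimpleGraph.mem_edgeSet,
          Sym2.mem_iff, exists_eq_or_imp, exists_eq_left, Γ']
        tauto
    rw [hE] at h
    refine h.mono subset_rfl (le_of_eq ?_)
    rw [← hcard]
    ring

end Induction

section Clean

variable {V : Type*} [Fintype V] [DecidableEq V] {G Γ₀ : SimpleGraph V} {α κ : Type*} [Fintype α]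
  [Fintype κ] {H : SimpleGraph α} {b : κ → V} {I : Sym2 κ → Set V}

/-- The edges that are not inside `W`. -/
def outsideEdges (W : Set V) : Set (Sym2 V) := {e | ¬ ∀ v ∈ e, v ∈ W}

omit [Fintype V] [DecidableEq V] in
theorem IsCyc.mono {Γ : SimpleGraph V} {c : ℕ → V} {N : ℕ} (h : IsCyc Γ c N) (hle : Γ ≤ G) :
    IsCyc G c N := ⟨h.three, h.periodic, h.inj, fun i => hle (h.adj i)⟩

omit [Fintype V] [DecidableEq V] in
theorem IsCyc.apply_add {c : ℕ → V} {N : ℕ} (h : IsCyc G c N) {i j : ℕ} (hij : c i = c j) (k : ℕ) :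
    c (i + k) = c (j + k) := by
  have hN : 0 < N := by have := h.three; omega
  rw [← h.apply_mod i, ← h.apply_mod j] at hij
  have hm : i ≡ j [MOD N] := h.inj _ _ (Nat.mod_lt _ hN) (Nat.mod_lt _ hN) hij
  rw [← h.apply_mod (i + k), ← h.apply_mod (j + k)]
  exact congrArg c (hm.add_right k)

/-- One step of the induction: either a vertex of degree one, or a cycle. -/
theorem IsTK.exists_step (h : IsTK G b I) (hG : ThreeConnected G) (hH : H.edgeSet.Nonempty)
    (hcard : Fintype.card α + 2 ≤ Fintype.card κ) (hle : Γ₀ ≤ G)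
    (hW : ∀ x y, Γ₀.Adj x y → x ∉ tkVerts b I) (hbot : Γ₀ ≠ ⊥) :
    ∃ S : Finset V, S.Nonempty ∧ (∀ x ∈ S, ∃ y, Γ₀.Adj x y) ∧
      ((∃ e, incidentEdges Γ₀ S = {e}) ∨ ∃ (c : ℕ → V) (N : ℕ) (U : Finset V), IsCyc Γ₀ c N ∧
        (∀ x ∈ S, ∃ i, c i = x) ∧ U.card ≤ 3 * S.card ∧ (∀ e ∈ incidentEdges Γ₀ S, ∀ v ∈ e, v ∈ U) ∧
        SeparableAtCost G (fun A => IsSubdivision H A.coe) (incidentEdges Γ₀ S)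
          (outsideEdges (tkVerts b I) \ cycEdges c) (900 * S.card)) := by
  obtain ⟨S, hS, ⟨x, y, rfl, hxy, hx⟩ | ⟨N, c, U, hc, hSU, hNU, hU, hUc⟩⟩ := exists_posa hbot
  · refine ⟨{x}, hS, by simpa using ⟨y, hxy⟩, Or.inl ⟨s(x, y), ?_⟩⟩
    ext e
    induction e with
    | h a b =>
      simp only [incidentEdges, Set.mem_ofPred_eq, SimpleGraph.mem_edgeSet, Finset.mem_singleton,
        Set.mem_singleton_iff, exists_eq_right]
      constructor
      · rintro ⟨hab, hxe⟩
        rcases Sym2.mem_iff.1 hxe with rfl | rfl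
        · rw [hx _ hab]
        · rw [hx _ hab.symm, Sym2.eq_swap]
      · intro e
        rw [e]
        exact ⟨by rw [← SimpleGraph.mem_edgeSet, e]; exact hxy, Sym2.mem_mk_left _ _⟩
  · have hpos := hS.card_pos
    obtain ⟨L, h1, h2, h3⟩ := h.exists_list_of_cycle hG hH hcard (hc.mono hle)
      (Set.disjoint_left.2 (by rintro _ ⟨i, rfl⟩; exact hW _ _ (hc.adj i))) hUc hU (by omega)
    have hin : ∀ e ∈ incidentEdges Γ₀ S, ∀ v ∈ e, v ∈ U := by
      intro e
      induction e with
      | h a b =>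
        rintro ⟨hab, v, hv, hvS⟩ w hw
        rw [SimpleGraph.mem_edgeSet] at hab
        rcases Sym2.mem_iff.1 hv with rfl | rfl <;> rcases Sym2.mem_iff.1 hw with rfl | rfl
        exacts [hSU hvS, hNU _ hvS _ hab, hNU _ hvS _ hab.symm, hSU hvS]
    refine ⟨S, hS, fun x hx => ?_, Or.inr ⟨c, N, U, hc,
      fun x hx => hUc x (hSU hx), hU, hin, L, [], ?_, h2, by simp, ?_⟩⟩
    · obtain ⟨i, rfl⟩ := hUc x (hSU hx)
      exact ⟨_, hc.adj i⟩
    · simp only [List.length_nil]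
      omega
    · rintro e ⟨he, -⟩ e' he' hne
      exact h3 e (SimpleGraph.edgeSet_mono hle he.1) (hin e he) e' he'.2 he'.1 hne

omit [Fintype V] [DecidableEq V] in
theorem separableAtCost_of_eq_singleton {P : G.Subgraph → Prop} {E T : Set (Sym2 V)} {k : ℕ}
    (h : ∃ e, E = {e}) (hk : 1 ≤ k) : SeparableAtCost G P E T k := by
  obtain ⟨e, rfl⟩ := h
  exact separableAtCost_list [e] (by simp) (by simpa using hk)

theorem IsTK.separableAtCost_of_notMem (h : IsTK G b I) (hG : ThreeConnected G)
    (hH : H.edgeSet.Nonempty)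
    (hcard : Fintype.card α + 2 ≤ Fintype.card κ) (hle : Γ₀ ≤ G)
    (hW : ∀ x y, Γ₀.Adj x y → x ∉ tkVerts b I) (Y : Finset V) (hY : ∀ x y, Γ₀.Adj x y → x ∈ Y) :
    SeparableAtCost G (fun A => IsSubdivision H A.coe) Γ₀.edgeSet
      (outsideEdges (tkVerts b I) \ Γ₀.edgeSet) (900 * Y.card) := by
  refine separableAtCost_edgeSet (Γ₀ := Γ₀) (fun Γ hΓ hbot => ?_) _ Y Γ₀ rfl le_rfl hY
  obtain ⟨S, hS, hS', hS''⟩ := h.exists_step hG hH hcard (hΓ.trans hle)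
    (fun x y h => hW x y (hΓ h)) hbot
  refine ⟨S, hS, hS', ?_⟩
  rcases hS'' with hS'' | ⟨c, N, U, hc, -, -, -, hsep⟩
  · have := hS.card_pos
    exact separableAtCost_of_eq_singleton hS'' (by omega)
  · refine hsep.mono (Set.sdiff_subset_sdiff_right ?_) le_rfl
    rintro _ ⟨i, rfl⟩
    exact hΓ (hc.adj i)

theorem IsTK.separableAtCost (h : IsTK G b I) (hG : ThreeConnected G)
    (hH : H.edgeSet.Nonempty)
    (hcard : Fintype.card α + 2 ≤ Fintype.card κ) (hle : Γ₀ ≤ G)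
    (hW : ∀ x y, Γ₀.Adj x y → x ∉ tkVerts b I) :
    SeparableAtCost G (fun A => IsSubdivision H A.coe) Γ₀.edgeSet
      (outsideEdges (tkVerts b I)) (3602 * Fintype.card V) := by
  refine separableAtCost_edgeSet (Γ₀ := Γ₀) (fun Γ hΓ hbot => ?_) _ Finset.univ Γ₀ rfl le_rfl
    (fun x _ _ => Finset.mem_univ x)
  obtain ⟨S, hS, hS', hS''⟩ := h.exists_step hG hH hcard (hΓ.trans hle)
    (fun x y h => hW x y (hΓ h)) hbot
  refine ⟨S, hS, hS', ?_⟩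
  have hpos := hS.card_pos
  rcases hS'' with hS'' | ⟨c, N, U, hc, hSc, hU, hin, hsep⟩
  · exact separableAtCost_of_eq_singleton hS'' (by omega)
  let Γ' : SimpleGraph V := SimpleGraph.fromEdgeSet (incidentEdges Γ S \ cycEdges c)
  have hΓ' : Γ'.edgeSet = incidentEdges Γ S \ cycEdges c := by
    rw [SimpleGraph.edgeSet_fromEdgeSet]
    refine sdiff_eq_left.2 (Set.disjoint_left.2 fun e he he' => ?_)
    exact Γ.not_isDiag_of_mem_edgeSet he.1.1 he'
  have hle' : Γ' ≤ Γ := by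
    rw [← SimpleGraph.edgeSet_subset_edgeSet, hΓ']
    exact fun e he => he.1.1
  have hchord := h.separableAtCost_of_notMem hG hH hcard ((hle'.trans hΓ).trans hle)
    (fun x y h => hW x y (hΓ (hle' h))) U (fun x y hxy => by
      rw [← SimpleGraph.mem_edgeSet, hΓ'] at hxy
      exact hin _ hxy.1 _ (Sym2.mem_mk_left _ _))
  rw [hΓ'] at hchord
  have hN := hc.three
  have hcyc : ∃ J : List (Sym2 V), J.length ≤ S.card * 2 ∧
      ∀ e, e ∈ J ↔ e ∈ incidentEdges Γ S ∩ cycEdges c := by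
    have hidx : ∀ x, ∃ i, x ∈ S → c i = x := fun x => by
      by_cases hx : x ∈ S
      · exact (hSc x hx).imp fun i hi _ => hi
      · exact ⟨0, fun h => (hx h).elim⟩
    choose i hi using hidx
    obtain ⟨J, hJ, hJ'⟩ := exists_list_union S (t := 2)
      (fun x => [s(c (i x), c (i x + 1)), s(c (i x + (N - 1)), c (i x + (N - 1) + 1))])
      (fun _ _ => le_rfl)
    have hback : ∀ j, c (j + (N - 1) + 1) = c j := fun j => by
      rw [show j + (N - 1) + 1 = j + N by omega, hc.periodic]
    refine ⟨J, hJ, fun e => ?_⟩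
    simp only [hJ', List.mem_cons, List.not_mem_nil, or_false]
    constructor
    · rintro ⟨x, hx, rfl | rfl⟩
      · exact ⟨⟨hc.adj _, x, by simp [hi x hx], hx⟩, _, rfl⟩
      · exact ⟨⟨hc.adj _, x, by simp [hback, hi x hx], hx⟩, _, rfl⟩
    · rintro ⟨⟨-, x, hxe, hx⟩, j, rfl⟩
      refine ⟨x, hx, ?_⟩
      rcases Sym2.mem_iff.1 hxe with hxj | hxj
      · have e := (hi x hx).trans hxj
        exact Or.inl (by rw [e, hc.apply_add e])
      · have e := (hi x hx).trans hxj
        have e' := hc.apply_add e (N - 1)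
        rw [show j + 1 + (N - 1) = j + N by omega, hc.periodic] at e'
        exact Or.inr (by rw [hback, e, e'])
  obtain ⟨J, hJ, hJ'⟩ := hcyc
  obtain ⟨L₁, J₁, a1, a2, a3, a4⟩ := hsep
  obtain ⟨L₂, J₂, b1, b2, b3, b4⟩ := hchord
  refine ⟨L₁ ++ L₂, J₁ ++ J₂ ++ J, ?_, fun A hA => ?_, fun e he => ?_, ?_⟩
  · simp only [List.length_append]
    omega
  · exact (List.mem_append.1 hA).elim (a2 A) (b2 A)
  · simp only [List.mem_append] at he
    rcases he with (he | he) | he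
    exacts [a3 e he, (b3 e he).1, ((hJ' e).1 he).1]
  · rintro e ⟨he, heJ⟩ e' he' hne
    simp only [List.mem_append, not_or] at heJ
    have hec : e ∉ cycEdges c := fun h => heJ.2 ((hJ' e).2 ⟨he, h⟩)
    by_cases hc' : e' ∈ cycEdges c
    · obtain ⟨A, hA, hA'⟩ := b4 e ⟨⟨he, hec⟩, heJ.1.2⟩ e' ⟨he', fun h => h.2 hc'⟩ hne
      exact ⟨A, List.mem_append_right _ hA, hA'⟩
    · obtain ⟨A, hA, hA'⟩ := a4 e ⟨he, heJ.1.1⟩ e' ⟨he', hc'⟩ hne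
      exact ⟨A, List.mem_append_left _ hA, hA'⟩

end Clean

section Assembly

variable {V α : Type*} [Fintype V] [Fintype α] {G : SimpleGraph V} {H : SimpleGraph α}

omit [Fintype V] in
theorem IsTK.disjoint_comap {ι κ : Type*} {b : ι × κ → V} {I : Sym2 (ι × κ) → Set V}
    (h : IsTK G b I) {i j : ι} (hij : i ≠ j) :
    Disjoint (tkVerts (b ∘ Prod.mk i) (I ∘ Sym2.map (Prod.mk i)))
      (tkVerts (b ∘ Prod.mk j) (I ∘ Sym2.map (Prod.mk j))) := by
  rw [Set.disjoint_left]
  rintro v (⟨k, rfl⟩ | hv) (⟨k', hk⟩ | hv')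
  · exact hij (congrArg Prod.fst (h.inj hk)).symm
  · obtain ⟨e, he⟩ := Set.mem_iUnion.1 hv'
    exact h.avoid _ _ he
  · obtain ⟨e, he⟩ := Set.mem_iUnion.1 hv
    exact h.avoid _ _ (hk ▸ he)
  · obtain ⟨e, he⟩ := Set.mem_iUnion.1 hv
    obtain ⟨e', he'⟩ := Set.mem_iUnion.1 hv'
    refine Set.disjoint_left.1 (h.disj _ _ fun hee => ?_) he he'
    induction e with | h x y => induction e' with | h x' y' =>
      simp only [Sym2.map_mk, Sym2.eq_iff, Prod.mk.injEq] at hee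
      tauto

/-- `G` has a list of `k` subgraphs as in the statement of the main theorem. -/
def HasSeparatingList (G : SimpleGraph V) (H : SimpleGraph α) (k : ℕ) : Prop :=
  ∃ L : List G.Subgraph, L.length ≤ k ∧ (∀ A ∈ L, IsSingleEdge A ∨ IsSubdivision H A.coe) ∧
    Separates L G.edgeSet G.edgeSet

omit [Fintype V] in
theorem exists_singleEdge {e : Sym2 V} (he : e ∈ G.edgeSet) :
    ∃ A : G.Subgraph, IsSingleEdge A ∧ A.edgeSet = {e} := by
  induction e with
  | h x y => exact ⟨G.subgraphOfAdj he, ⟨x, y, he, rfl⟩, SimpleGraph.edgeSet_subgraphOfAdj he⟩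

omit [Fintype V] in
theorem exists_singleEdges (J : List (Sym2 V)) (hJ : ∀ e ∈ J, e ∈ G.edgeSet) :
    ∃ L : List G.Subgraph, L.length ≤ J.length ∧ (∀ A ∈ L, IsSingleEdge A) ∧
      ∀ e ∈ J, ∃ A ∈ L, A.edgeSet = {e} := by
  have key : ∀ e, ∃ A : G.Subgraph, e ∈ J → IsSingleEdge A ∧ A.edgeSet = {e} := fun e => by
    by_cases he : e ∈ J
    · exact (exists_singleEdge (hJ e he)).imp fun A hA _ => hA
    · exact ⟨⊥, fun h => (he h).elim⟩
  choose f hf using key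
  refine ⟨J.map f, by simp, fun A hA => ?_, fun e he => ⟨f e, List.mem_map_of_mem he, (hf e he).2⟩⟩
  obtain ⟨e, he, rfl⟩ := List.mem_map.1 hA
  exact (hf e he).1

omit [Fintype α] in
theorem hasSeparatingList_of_sparse [DecidableEq V] {k : ℕ} (h : rho G Finset.univ ∅ ≤ k) :
    HasSeparatingList G H k := by
  classical
  let P := (Finset.univ ×ˢ Finset.univ : Finset (V × V)).filter fun p =>
    G.Adj p.1 p.2 ∧ ¬ (p.1 ∈ (∅ : Finset V) ∧ p.2 ∈ (∅ : Finset V))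
  have hP : P.card ≤ k := by
    refine le_trans (le_of_eq ?_) h
    unfold rho
    congr
  have hJ : ∀ e, e ∈ P.toList.map Sym2.mk.uncurry ↔ e ∈ G.edgeSet := by
    intro e
    simp only [List.mem_map, Finset.mem_toList, P, Finset.mem_filter, Finset.mem_product,
      Finset.mem_univ, Finset.notMem_empty, false_and, not_false_eq_true, and_true, true_and]
    constructor
    · rintro ⟨⟨x, y⟩, hxy, rfl⟩
      exact hxy
    · induction e with
      | h x y => exact fun hxy => ⟨(x, y), hxy, rfl⟩
  obtain ⟨L, h1, h2, h3⟩ := exists_singleEdges (P.toList.map Sym2.mk.uncurry) fun e => (hJ e).1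
  refine ⟨L, ?_, fun A hA => Or.inl (h2 A hA), fun e he e' _ hne => ?_⟩
  · rw [List.length_map, Finset.length_toList] at h1
    omega
  · obtain ⟨A, hA, hAe⟩ := h3 e ((hJ e).2 he)
    exact ⟨A, hA, by simp [hAe], by simp [hAe, hne]⟩

theorem hasSeparatingList_of_isTK {κ : Type*} [Fintype κ] {b : Fin 4 × κ → V}
    {I : Sym2 (Fin 4 × κ) → Set V} (h : IsTK G b I) (hG : ThreeConnected G)
    (hH : H.edgeSet.Nonempty) (hcard : Fintype.card α + 2 ≤ Fintype.card κ) :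
    HasSeparatingList G H (4 * (3602 * Fintype.card V)) := by
  classical
  let W : Fin 4 → Set V := fun i => tkVerts (b ∘ Prod.mk i) (I ∘ Sym2.map (Prod.mk i))
  have hW : ∀ v i j, v ∈ W i → v ∈ W j → i = j := by
    intro v i j hi hj
    by_contra hij
    exact Set.disjoint_left.1 (h.disjoint_comap hij) hi hj
  let Γ : Fin 4 → SimpleGraph V := fun i =>
    { Adj := fun x y => G.Adj x y ∧ x ∉ W i ∧ y ∉ W i
      symm := ⟨fun x y h => ⟨h.1.symm, h.2.2, h.2.1⟩⟩
      loopless := ⟨fun x h => G.loopless.irrefl x h.1⟩ }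
  have hΓ : ∀ i, Γ i ≤ G := fun i x y h => h.1
  have key : ∀ i, ∃ L : List G.Subgraph, L.length ≤ 3602 * Fintype.card V ∧
      (∀ A ∈ L, IsSingleEdge A ∨ IsSubdivision H A.coe) ∧
      Separates L (Γ i).edgeSet (outsideEdges (W i)) := by
    intro i
    obtain ⟨L, J, h1, h2, h3, h4⟩ := (h.comap (Prod.mk_right_injective i)).separableAtCost hG hH
      hcard (hΓ i) (fun x y h => h.2.1)
    obtain ⟨L', h1', h2', h3'⟩ := exists_singleEdges J fun e he =>
      SimpleGraph.edgeSet_mono (hΓ i) (h3 e he)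
    refine ⟨L ++ L', by simp only [List.length_append]; omega, fun A hA => ?_,
      fun e he e' he' hne => ?_⟩
    · exact (List.mem_append.1 hA).elim (fun hA => Or.inr (h2 A hA)) fun hA => Or.inl (h2' A hA)
    · by_cases heJ : e ∈ J
      · obtain ⟨A, hA, hAe⟩ := h3' e heJ
        exact ⟨A, List.mem_append_right _ hA, by simp [hAe], by simp [hAe, hne]⟩
      · obtain ⟨A, hA, hA'⟩ := h4 e ⟨he, heJ⟩ e' he' hne
        exact ⟨A, List.mem_append_left _ hA, hA'⟩
  choose L h1 h2 h3 using key
  obtain ⟨L', h1', h2'⟩ := exists_list_union Finset.univ L (fun i _ => h1 i)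
  refine ⟨L', by simpa using h1', fun A hA => ?_, fun e he e' _ hne => ?_⟩
  · obtain ⟨i, -, hi⟩ := (h2' A).1 hA
    exact h2 i A hi
  have hidx : ∀ v, ∃ i, ∀ j, v ∈ W j → j = i := fun v => by
    by_cases hv : ∃ i, v ∈ W i
    · exact hv.imp fun i hi j hj => hW v j i hj hi
    · exact ⟨0, fun j hj => (hv ⟨j, hj⟩).elim⟩
  have hfree : ∀ i j k : Fin 4, ∃ l, l ≠ i ∧ l ≠ j ∧ l ≠ k := by decide
  induction e with | h x y => induction e' with | h x' y' =>
    obtain ⟨i, hi⟩ := hidx x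
    obtain ⟨j, hj⟩ := hidx y
    obtain ⟨k, hk⟩ := hidx x'
    obtain ⟨l, hli, hlj, hlk⟩ := hfree i j k
    obtain ⟨A, hA, hA'⟩ := h3 l s(x, y) ⟨he, fun h => hli (hi l h), fun h => hlj (hj l h)⟩ s(x', y')
      (fun hall => hlk (hk l (hall x' (Sym2.mem_mk_left _ _)))) hne
    exact ⟨A, (h2' A).2 ⟨l, Finset.mem_univ _, hA⟩, hA'⟩

theorem hasSeparatingList (hG : ThreeConnected G) (hH : H.edgeSet.Nonempty) :
    HasSeparatingList G H (144000 * Fintype.card α ^ 2 * Fintype.card V) := by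
  classical
  have hα : 1 ≤ Fintype.card α := by
    obtain ⟨e, -⟩ := hH
    induction e with | h x y => exact Fintype.card_pos_iff.2 ⟨x⟩
  by_cases h : 1000 * Fintype.card (Fin 4 × Option (Option α)) ^ 2 * Fintype.card V <
      rho G Finset.univ ∅
  · obtain ⟨b, I, hTK⟩ := exists_isTK h
    obtain ⟨L, h1, h2, h3⟩ := hasSeparatingList_of_isTK hTK hG hH (by simp)
    refine ⟨L, h1.trans ?_, h2, h3⟩
    rw [← mul_assoc]
    exact Nat.mul_le_mul_right _ (by nlinarith)
  · refine hasSeparatingList_of_sparse ((not_lt.1 h).trans ?_)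
    gcongr ?_ * _
    simp only [Fintype.card_prod, Fintype.card_fin, Fintype.card_option]
    nlinarith

end Assembly

end EdgeSeparation

/-- There is an absolute constant `C > 0` such that for every graph `H` with at least one
edge, every 3-connected graph `G` on `n` vertices admits a family of subgraphs, each a
single edge or a subdivision of `H`, of size at most `C·|H|²·n` that strongly separates
the edges of `G`. -/
theorem edge_separation_by_subdivisions_of_threeConnected :
    ∃ C : ℝ, 0 < C ∧
      ∀ (α β : Type) [Fintype α] [Fintype β] (H : SimpleGraph α) (G : SimpleGraph β),
        H.edgeSet.Nonempty → ThreeConnected G →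
        ∃ F : Set G.Subgraph, F.Finite ∧
          (∀ A ∈ F, IsSingleEdge A ∨ IsSubdivision H A.coe) ∧
          StronglySeparatesEdges G F ∧
          (F.ncard : ℝ) ≤ C * (Fintype.card α : ℝ) ^ 2 * (Fintype.card β : ℝ) := by
  classical
  refine ⟨144000, by norm_num, fun α β _ _ H G hH hG => ?_⟩
  obtain ⟨L, h1, h2, h3⟩ := EdgeSeparation.hasSeparatingList hG hH
  refine ⟨{A | A ∈ L}, L.finite_toSet, h2, fun e he e' he' hne => h3 e he e' he' hne.symm, ?_⟩
  have hcard : ({A | A ∈ L} : Set G.Subgraph).ncard ≤ L.length := by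
    rw [← List.coe_toFinset, Set.ncard_coe_finset]
    exact L.toFinset_card_le
  exact_mod_cast hcard.trans h1
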